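/- Let φ be a partially monotone anisotropy on ℝ² such that W^φ has no vertical facets, I ⊂ ℝ a bounded open interval, p ∈ [1,+∞), and set σ := ( (1/(4^{p−1}·p)) · min{ α₀·φ(e₁)/4, α₀/(2·φ(e₂)), |I|·φ(e₁)/(4·φ(e₂)) } )^{1/p}. If g ∈ L^∞(I) satisfies ‖g‖_∞ < σ, then every minimizer u of G is Lipschitz on I; if moreover φ is a C²-anisotropy and is elliptic, then u ∈ C^{1,1}(I). -/

import Mathlib

open MeasureTheory Set Filter Topology Bornology
open scoped ENNReal NNReal RealInnerProductSpace symmDiff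

noncomputable section

abbrev E2 : Type := EuclideanSpace ℝ (Fin 2)

def vec2 (a b : ℝ) : E2 := (WithLp.equiv 2 (Fin 2 → ℝ)).symm ![a, b]

def e1 : E2 := vec2 1 0
def e2 : E2 := vec2 0 1

/-- `φ` is an anisotropy (a norm) on `ℝ²`. -/
structure IsAnisotropy (φ : E2 → ℝ) : Prop where
  nonneg : ∀ x, 0 ≤ φ x
  eq_zero_iff : ∀ x, φ x = 0 ↔ x = 0
  smul_eq : ∀ (c : ℝ) (x : E2), φ (c • x) = |c| * φ x
  add_le : ∀ x y, φ (x + y) ≤ φ x + φ y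
  bounds : ∃ c ∈ Set.Ioc (0:ℝ) 1, ∀ x : E2, ‖x‖ = 1 → c ≤ φ x ∧ φ x ≤ 1 / c

/-- The dual anisotropy `φ°(ξ) = max {⟪ξ,η⟫ : φ(η) = 1}`. -/
def dualA (φ : E2 → ℝ) (ξ : E2) : ℝ := sSup {r : ℝ | ∃ η : E2, φ η = 1 ∧ r = ⟪ξ, η⟫}

/-- The Wulff shape `W^φ = {φ ≤ 1}`. -/
def wulff (φ : E2 → ℝ) : Set E2 := {x | φ x ≤ 1}

/-- The Wulff shape of radius `r` centered at `x`. -/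
def wulffBall (φ : E2 → ℝ) (r : ℝ) (x : E2) : Set E2 := {y | φ (y - x) ≤ r}

/-- `φ` is partially monotone, i.e. even in each coordinate separately. -/
def PartiallyMonotone (φ : E2 → ℝ) : Prop := ∀ x : E2, φ x = φ (vec2 |x 0| |x 1|)

/-- The Wulff shape of `φ` is symmetric with respect to both coordinate axes. -/
def AxisSymmetric (φ : E2 → ℝ) : Prop :=
  ∀ x : E2, φ (vec2 (-(x 0)) (x 1)) = φ x ∧ φ (vec2 (x 0) (-(x 1))) = φ x

/-- `W^φ` has no vertical facets: `±e₁` is an outer normal to `W^φ` only at `±e₁/φ(e₁)`. -/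
def NoVerticalFacets (φ : E2 → ℝ) : Prop :=
  (∀ η ∈ wulff φ, (∀ y ∈ wulff φ, ⟪e1, y - η⟫ ≤ 0) → η = (φ e1)⁻¹ • e1) ∧
  (∀ η ∈ wulff φ, (∀ y ∈ wulff φ, ⟪-e1, y - η⟫ ≤ 0) → η = -((φ e1)⁻¹ • e1))

/-- `φ` is elliptic: `φ - λ|·|` is again a norm for some `λ > 0`. -/
def IsElliptic (φ : E2 → ℝ) : Prop :=
  ∃ lam > (0:ℝ), IsAnisotropy (fun x => φ x - lam * ‖x‖)

/-- `φ` is a `C²`-anisotropy. -/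
def IsC2Aniso (φ : E2 → ℝ) : Prop := ContDiffOn ℝ 2 φ {(0:E2)}ᶜ

/-- The anisotropic area `𝒜_φ(u,J)` (φ-total variation of `(-Du, L¹)`). -/
def aniArea (φ : E2 → ℝ) (u : ℝ → ℝ) (J : Set ℝ) : ℝ≥0∞ :=
  ⨆ (h₁ : ℝ → ℝ) (h₂ : ℝ → ℝ) (_ : ContDiff ℝ 1 h₁) (_ : ContDiff ℝ 1 h₂)
    (_ : HasCompactSupport h₁) (_ : HasCompactSupport h₂)
    (_ : tsupport h₁ ⊆ J) (_ : tsupport h₂ ⊆ J)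
    (_ : ∀ s ∈ J, φ (vec2 (h₁ s) (h₂ s)) ≤ 1),
    ENNReal.ofReal (∫ s in J, (u s * deriv h₁ s + h₂ s))

/-- The (Euclidean) total variation of `Du` on `J`. -/
def totalVar (u : ℝ → ℝ) (J : Set ℝ) : ℝ≥0∞ :=
  ⨆ (h : ℝ → ℝ) (_ : ContDiff ℝ 1 h) (_ : HasCompactSupport h) (_ : tsupport h ⊆ J)
    (_ : ∀ s ∈ J, |h s| ≤ 1), ENNReal.ofReal (∫ s in J, u s * deriv h s)

/-- `u ∈ BV(I)`. -/
def BVOn (u : ℝ → ℝ) (I : Set ℝ) : Prop := IntegrableOn u I ∧ totalVar u I < ⊤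

/-- `u ∈ BV_loc(I)`. -/
def BVLocOn (u : ℝ → ℝ) (I : Set ℝ) : Prop :=
  ∀ J : Set ℝ, IsOpen J → IsCompact (closure J) → closure J ⊆ I → BVOn u J

/-- The `L^∞`-norm of `u` on `I`. -/
def supNorm (u : ℝ → ℝ) (I : Set ℝ) : ℝ≥0∞ :=
  essSup (fun s => (‖u s‖₊ : ℝ≥0∞)) (volume.restrict I)

/-- The functional `G(u) = 𝒜_φ(u,I) + ∫_I |u-g|^p ds` (with value `+∞` when
`u ∉ BV(I)` or `u - g ∉ L^p(I)`). -/
def Gfun (φ : E2 → ℝ) (p : ℝ) (g : ℝ → ℝ) (I : Set ℝ) (u : ℝ → ℝ) : ℝ≥0∞ :=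
  aniArea φ u I + ∫⁻ s in I, ENNReal.ofReal (|u s - g s| ^ p)

/-- `u` minimizes `G` over `L¹(I)`. -/
def IsMinimizerG (φ : E2 → ℝ) (p : ℝ) (g : ℝ → ℝ) (I : Set ℝ) (u : ℝ → ℝ) : Prop :=
  IntegrableOn u I ∧ ∀ v : ℝ → ℝ, IntegrableOn v I → Gfun φ p g I u ≤ Gfun φ p g I v

/-- `u` is a `Λ`-local minimizer of `𝒜_φ` in `I`. -/
def IsLambdaLocMin (φ : E2 → ℝ) (Λ : ℝ) (I : Set ℝ) (u : ℝ → ℝ) : Prop :=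
  ∀ J : Set ℝ, IsOpen J → IsCompact (closure J) → closure J ⊆ I →
    ∀ ψ : ℝ → ℝ, ContDiff ℝ 1 ψ → HasCompactSupport ψ → tsupport ψ ⊆ J →
      aniArea φ u J ≤ aniArea φ (fun s => u s + ψ s) J + ENNReal.ofReal (Λ * ∫ s in J, |ψ s|)

/-- `ν` is the measure-theoretic outer unit normal of `E` at `x` (De Giorgi blow-up). -/
def IsOuterNormalAt (E : Set E2) (x ν : E2) : Prop :=
  ‖ν‖ = 1 ∧ Tendsto
    (fun r : ℝ => volume (({y : E2 | x + r • y ∈ E} ∆ {y : E2 | ⟪y, ν⟫ ≤ 0}) ∩ Metric.ball (0:E2) 1))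
    (𝓝[>] 0) (𝓝 0)

/-- The reduced boundary `∂*E`. -/
def redBoundary (E : Set E2) : Set E2 := {x | ∃ ν, IsOuterNormalAt E x ν}

open Classical in
/-- The generalized outer unit normal `ν_E`. -/
def genNormal (E : Set E2) (x : E2) : E2 :=
  if h : ∃ ν, IsOuterNormalAt E x ν then h.choose else 0

/-- The anisotropic perimeter `P_φ(E,Ω) = ∫_{Ω ∩ ∂*E} φ°(ν_E) dH¹`. -/
def aniPer (φ : E2 → ℝ) (E : Set E2) (Ω : Set E2) : ℝ≥0∞ :=
  ∫⁻ x in Ω ∩ redBoundary E, ENNReal.ofReal (dualA φ (genNormal E x)) ∂μH[1]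

/-- The divergence of a vector field on `ℝ²`. -/
def div2 (T : E2 → E2) (x : E2) : ℝ :=
  ∑ i : Fin 2, fderiv ℝ T x (EuclideanSpace.single i 1) i

/-- Distributional perimeter of `F` in an open set `Ω`. -/
def perVar (F : Set E2) (Ω : Set E2) : ℝ≥0∞ :=
  ⨆ (T : E2 → E2) (_ : ContDiff ℝ 1 T) (_ : HasCompactSupport T) (_ : tsupport T ⊆ Ω)
    (_ : ∀ x, ‖T x‖ ≤ 1), ENNReal.ofReal (∫ x in F, div2 T x)

/-- `F` has locally finite perimeter in `Ω`. -/
def LocFinPer (F : Set E2) (Ω : Set E2) : Prop :=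
  MeasurableSet F ∧ ∀ Ω' : Set E2, IsOpen Ω' → IsCompact (closure Ω') → closure Ω' ⊆ Ω →
    perVar F Ω' < ⊤

/-- `E` is a `Λ`-local minimizer of `P_φ` in `Ω`. -/
def IsLambdaLocMinPer (φ : E2 → ℝ) (Λ : ℝ) (Ω : Set E2) (E : Set E2) : Prop :=
  LocFinPer E Ω ∧ ∀ Ω' : Set E2, IsOpen Ω' → IsCompact (closure Ω') → closure Ω' ⊆ Ω →
    ∀ F : Set E2, LocFinPer F Ω → IsCompact (closure (E ∆ F)) → closure (E ∆ F) ⊆ Ω' →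
      aniPer φ E Ω' ≤ aniPer φ F Ω' + ENNReal.ofReal Λ * volume (E ∆ F)

/-- The (strict) subgraph of `u` over `I`. -/
def subg (I : Set ℝ) (u : ℝ → ℝ) : Set E2 := {q : E2 | q 0 ∈ I ∧ q 1 < u (q 0)}

/-- The (strict) epigraph of `u` over `I`. -/
def epig (I : Set ℝ) (u : ℝ → ℝ) : Set E2 := {q : E2 | q 0 ∈ I ∧ u (q 0) < q 1}

/-- The vertical strip `I × ℝ`. -/
def strip (I : Set ℝ) : Set E2 := {q : E2 | q 0 ∈ I}

/-- The vertical box `I × A`. -/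
def box (I A : Set ℝ) : Set E2 := {q : E2 | q 0 ∈ I ∧ q 1 ∈ A}

/-- `u` is a `(γ,Λ)`-local minimizer of `𝒜_φ` in `I`. -/
def IsGammaLambdaLocMin (φ : E2 → ℝ) (γ Λ : ℝ) (I : Set ℝ) (u : ℝ → ℝ) : Prop :=
  ∀ Ω : Set E2, IsOpen Ω → IsCompact (closure Ω) → closure Ω ⊆ box I (Set.Ioo (-γ) γ) →
    ∀ F : Set E2, LocFinPer F (strip I) →
      IsCompact (closure (subg I u ∆ F)) → closure (subg I u ∆ F) ⊆ Ω →
        aniPer φ (subg I u) Ω ≤ aniPer φ F Ω + ENNReal.ofReal Λ * volume (subg I u ∆ F)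

/-- The constant `α₀(φ)`. -/
def alpha0 (φ : E2 → ℝ) : ℝ :=
  (aniPer φ (wulff φ) univ).toReal /
    ((2 * (aniPer φ (wulff φ) univ).toReal + 1) * Real.sqrt (volume (wulff φ)).toReal)

/-- `u` admits a Lipschitz representative on `I`. -/
def HasLipschitzRep (u : ℝ → ℝ) (I : Set ℝ) : Prop :=
  ∃ v : ℝ → ℝ, (∀ᵐ s ∂(volume.restrict I), u s = v s) ∧ ∃ K : ℝ≥0, LipschitzOnWith K v I

/-- `u` admits a `C^{1,1}` representative on `I`. -/
def HasC11Rep (u : ℝ → ℝ) (I : Set ℝ) : Prop :=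
  ∃ v v' : ℝ → ℝ, (∀ᵐ s ∂(volume.restrict I), u s = v s) ∧
    (∀ s ∈ I, HasDerivAt v (v' s) s) ∧ ∃ K : ℝ≥0, LipschitzOnWith K v' I

theorem isPicardLindelof_shooting {a b K B C₀ : ℝ} (hab : a < b)
    {D β G χ : ℝ → ℝ} {KD Kβ : ℝ≥0}
    (hDlip : LipschitzWith KD D) (hDK : ∀ z, |D z| ≤ K)
    (hβlip : LipschitzWith Kβ β) (hβB : ∀ x, |β x| ≤ B)
    (hG : Continuous G) (hχ : Continuous χ) (hχ0 : ∀ s, 0 ≤ χ s) (hχ1 : ∀ s, χ s ≤ 1) :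
    IsPicardLindelof (fun s (x : ℝ × ℝ) => (D x.2, -(χ s * β (x.1 - G s))))
      (⟨a, left_mem_Icc.2 hab.le⟩ : Icc a b) ((0, 0) : ℝ × ℝ)
      (C₀.toNNReal + (max K B).toNNReal * (b - a).toNNReal) C₀.toNNReal (max K B).toNNReal
      (max KD Kβ) := by
  have hK : 0 ≤ K := (abs_nonneg _).trans (hDK 0)
  have hKB : 0 ≤ max K B := hK.trans (le_max_left _ _)
  refine ⟨fun t _ => ?_, fun x _ => ?_, fun t _ x _ => ?_, ?_⟩
  · apply LipschitzWith.lipschitzOnWith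
    apply LipschitzWith.of_dist_le_mul
    intro x y
    rw [Prod.dist_eq]
    apply max_le
    · calc dist (D x.2) (D y.2) ≤ KD * dist x.2 y.2 := hDlip.dist_le_mul _ _
        _ ≤ (max KD Kβ : ℝ≥0) * dist x y := by
          gcongr
          · exact le_max_left _ _
          · exact le_max_right _ _
    · have h1 : dist (β (x.1 - G t)) (β (y.1 - G t)) ≤ Kβ * dist x.1 y.1 := by
        simpa using hβlip.dist_le_mul (x.1 - G t) (y.1 - G t)
      have h2 : dist (-(χ t * β (x.1 - G t))) (-(χ t * β (y.1 - G t)))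
          = χ t * dist (β (x.1 - G t)) (β (y.1 - G t)) := by
        rw [dist_neg_neg, Real.dist_eq, Real.dist_eq, ← mul_sub, abs_mul, abs_of_nonneg (hχ0 t)]
      calc dist (-(χ t * β (x.1 - G t))) (-(χ t * β (y.1 - G t)))
          = χ t * dist (β (x.1 - G t)) (β (y.1 - G t)) := h2
        _ ≤ 1 * (Kβ * dist x.1 y.1) := by gcongr; exact hχ1 t
        _ ≤ (max KD Kβ : ℝ≥0) * dist x y := by
          rw [one_mul]
          gcongr
          · exact le_max_right _ _
          · exact le_max_left _ _
  · have := hβlip.continuous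
    fun_prop
  · rw [Real.coe_toNNReal _ hKB, Prod.norm_def]
    apply max_le
    · exact (hDK _).trans (le_max_left _ _)
    · simp only [norm_neg, Real.norm_eq_abs, abs_mul, abs_of_nonneg (hχ0 t)]
      calc χ t * |β (x.1 - G t)| ≤ 1 * B := by
            gcongr
            · exact hχ1 t
            · exact hβB _
        _ ≤ _ := by rw [one_mul]; exact le_max_right _ _
  · have h1 : max (b - a) (a - a) = b - a := by
      rw [sub_self]; exact max_eq_left (by linarith)
    simp only [NNReal.coe_add, NNReal.coe_mul]
    rw [h1, Real.coe_toNNReal _ hKB, Real.coe_toNNReal (b - a) (by linarith)]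
    linarith

theorem le_of_hasDerivWithinAt_nonpos {a b : ℝ} {f f' : ℝ → ℝ}
    (hf : ∀ t ∈ Icc a b, HasDerivWithinAt f (f' t) (Icc a b) t)
    (h0 : ∀ t ∈ Icc a b, f' t ≤ 0) : AntitoneOn f (Icc a b) := by
  apply antitoneOn_of_deriv_nonpos (convex_Icc a b)
    (fun t ht => (hf t ht).continuousWithinAt)
  · rw [interior_Icc]
    intro t ht
    exact ((hf t (Ioo_subset_Icc_self ht)).hasDerivAt (Icc_mem_nhds ht.1 ht.2)).differentiableAt
      |>.differentiableWithinAt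
  · rw [interior_Icc]
    intro t ht
    rw [((hf t (Ioo_subset_Icc_self ht)).hasDerivAt (Icc_mem_nhds ht.1 ht.2)).deriv]
    exact h0 t (Ioo_subset_Icc_self ht)

theorem eq_of_hasDerivWithinAt_Icc {a b : ℝ} {f g h : ℝ → ℝ}
    (hf : ∀ t ∈ Icc a b, HasDerivWithinAt f (h t) (Icc a b) t)
    (hg : ∀ t ∈ Icc a b, HasDerivWithinAt g (h t) (Icc a b) t) (h0 : f a = g a) :
    ∀ t ∈ Icc a b, f t = g t := by
  intro t ht
  have ha : a ∈ Icc a b := ⟨le_rfl, ht.1.trans ht.2⟩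
  have h1 := le_of_hasDerivWithinAt_nonpos (f := fun t => f t - g t) (f' := fun t => h t - h t)
    (fun t ht => (hf t ht).sub (hg t ht)) (by simp) ha ht ht.1
  have h2 := le_of_hasDerivWithinAt_nonpos (f := fun t => g t - f t) (f' := fun t => h t - h t)
    (fun t ht => (hg t ht).sub (hf t ht)) (by simp) ha ht ht.1
  simp only at h1 h2
  linarith

theorem exists_shooting_solution {a b K B M : ℝ} (hab : a < b)
    {D β G χ : ℝ → ℝ} {KD Kβ : ℝ≥0}
    (hDlip : LipschitzWith KD D) (hDK : ∀ z, |D z| ≤ K)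
    (hβlip : LipschitzWith Kβ β) (hβB : ∀ x, |β x| ≤ B)
    (hβ1 : ∀ x, 0 ≤ x → 0 ≤ β x) (hβ2 : ∀ x, x ≤ 0 → β x ≤ 0)
    (hG : Continuous G) (hGM : ∀ s, |G s| ≤ M)
    (hχ : Continuous χ) (hχ0 : ∀ s, 0 ≤ χ s) (hχ1 : ∀ s, χ s ≤ 1)
    (hχs : ∀ s, s ∉ Ioo a b → χ s = 0) :
    ∃ V Z : ℝ → ℝ, (∀ s, HasDerivAt V (D (Z s)) s) ∧
      (∀ s, HasDerivAt Z (-(χ s * β (V s - G s))) s) ∧ Z a = 0 ∧ Z b = 0 := by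
  have hK : 0 ≤ K := (abs_nonneg _).trans (hDK 0)
  have hM : 0 ≤ M := (abs_nonneg _).trans (hGM 0)
  have hβc := hβlip.continuous
  have hDc := hDlip.continuous
  set C₀ : ℝ := M + K * (b - a) with hC₀def
  have hC₀ : 0 ≤ C₀ := by have : 0 ≤ K * (b - a) := mul_nonneg hK (by linarith)
                          linarith
  have ha : a ∈ Icc a b := left_mem_Icc.2 hab.le
  have hb : b ∈ Icc a b := right_mem_Icc.2 hab.le
  obtain ⟨α, hα, L', hL'⟩ := (isPicardLindelof_shooting hab hDlip hDK hβlip hβB hG hχ hχ0 hχ1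
    ).exists_forall_mem_closedBall_eq_hasDerivWithinAt_lipschitzOnWith
  have hmem : ∀ c ∈ Icc (-C₀) C₀, ((c, 0) : ℝ × ℝ) ∈ Metric.closedBall ((0, 0) : ℝ × ℝ)
      (C₀.toNNReal : ℝ) := by
    intro c hc
    rw [Real.coe_toNNReal _ hC₀, mem_closedBall_iff_norm, Prod.norm_def]
    simp only [Prod.fst_sub, Prod.snd_sub, sub_zero, norm_zero, Real.norm_eq_abs]
    exact max_le (abs_le.2 hc) hC₀
  have hd1 : ∀ c ∈ Icc (-C₀) C₀, ∀ t ∈ Icc a b,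
      HasDerivWithinAt (fun t => (α (c, 0) t).1) (D (α (c, 0) t).2) (Icc a b) t := by
    intro c hc t ht
    have h := (hα _ (hmem c hc)).2 t ht
    exact (hasFDerivAt_fst (𝕜 := ℝ) (E := ℝ) (F := ℝ)).comp_hasDerivWithinAt t h
  have hd2 : ∀ c ∈ Icc (-C₀) C₀, ∀ t ∈ Icc a b,
      HasDerivWithinAt (fun t => (α (c, 0) t).2) (-(χ t * β ((α (c, 0) t).1 - G t)))
        (Icc a b) t := by
    intro c hc t ht
    have h := (hα _ (hmem c hc)).2 t ht
    exact (hasFDerivAt_snd (𝕜 := ℝ) (E := ℝ) (F := ℝ)).comp_hasDerivWithinAt t h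
  have hi : ∀ c ∈ Icc (-C₀) C₀, α (c, 0) a = (c, 0) := fun c hc => (hα _ (hmem c hc)).1
  have hcont : ContinuousOn (fun c : ℝ => (α (c, 0) b).2) (Icc (-C₀) C₀) := by
    apply continuous_snd.comp_continuousOn
    exact (hL' b hb).continuousOn.comp (by fun_prop) hmem
  have hneg : (α (C₀, 0) b).2 ≤ 0 := by
    have hc : C₀ ∈ Icc (-C₀) C₀ := ⟨by linarith, le_rfl⟩
    have hV : ∀ t ∈ Icc a b, M ≤ (α (C₀, 0) t).1 := by
      intro t ht
      have := le_of_hasDerivWithinAt_nonpos (f := fun t => -(α (C₀, 0) t).1 - K * t)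
        (f' := fun t => -(D (α (C₀, 0) t).2) - K * 1)
        (fun t ht => (hd1 _ hc t ht).neg.sub ((hasDerivWithinAt_id t _).const_mul K))
        (fun t _ => by have := (abs_le.1 (hDK (α (C₀, 0) t).2)).1; linarith) ha ht ht.1
      simp only [hi _ hc] at this
      have h3 : K * t ≤ K * b := by gcongr; exact ht.2
      linarith
    have := le_of_hasDerivWithinAt_nonpos (hd2 _ hc) (fun t ht => by
      have h1 := (abs_le.1 (hGM t)).2
      have := mul_nonneg (hχ0 t) (hβ1 ((α (C₀, 0) t).1 - G t) (by linarith [hV t ht]))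
      linarith) ha hb hab.le
    simpa only [hi _ hc] using this
  have hpos : 0 ≤ (α (-C₀, 0) b).2 := by
    have hc : -C₀ ∈ Icc (-C₀) C₀ := ⟨le_rfl, by linarith⟩
    have hV : ∀ t ∈ Icc a b, (α (-C₀, 0) t).1 ≤ -M := by
      intro t ht
      have := le_of_hasDerivWithinAt_nonpos (f := fun t => (α (-C₀, 0) t).1 - K * t)
        (f' := fun t => (D (α (-C₀, 0) t).2) - K * 1)
        (fun t ht => (hd1 _ hc t ht).sub ((hasDerivWithinAt_id t _).const_mul K))
        (fun t _ => by have := (abs_le.1 (hDK (α (-C₀, 0) t).2)).2; linarith) ha ht ht.1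
      simp only [hi _ hc] at this
      have h3 : K * t ≤ K * b := by gcongr; exact ht.2
      linarith
    have := le_of_hasDerivWithinAt_nonpos (fun t ht => (hd2 _ hc t ht).neg) (fun t ht => by
      have h1 := (abs_le.1 (hGM t)).1
      have := mul_nonneg (hχ0 t)
        (neg_nonneg.2 (hβ2 ((α (-C₀, 0) t).1 - G t) (by linarith [hV t ht])))
      linarith) ha hb hab.le
    simp only [hi _ hc, Pi.neg_apply] at this
    linarith
  obtain ⟨c, hc, hc0⟩ : ∃ c ∈ Icc (-C₀) C₀, (α (c, 0) b).2 = 0 := by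
    have := intermediate_value_Icc' (by linarith : -C₀ ≤ C₀) hcont ⟨hneg, hpos⟩
    exact this
  set v : ℝ → ℝ := fun t => (α (c, 0) t).1 with hv
  have hvc : ContinuousOn v (Icc a b) := fun t ht => (hd1 c hc t ht).continuousWithinAt
  set ve : ℝ → ℝ := fun t => v (projIcc a b hab.le t) with hve
  have hvec : Continuous ve := (hvc.domRestrict).comp continuous_projIcc
  have hvee : ∀ t ∈ Icc a b, ve t = v t := fun t ht => by simp only [hve, projIcc_of_mem hab.le ht]
  set ζ : ℝ → ℝ := fun s => -(χ s * β (ve s - G s)) with hζ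
  have hζc : Continuous ζ := by fun_prop
  set Z : ℝ → ℝ := fun s => ∫ r in a..s, ζ r with hZ
  have hZd : ∀ s, HasDerivAt Z (ζ s) s := fun s => (hζc.integral_hasStrictDerivAt a s).hasDerivAt
  have hZc : Continuous Z := continuous_iff_continuousAt.2 fun s => (hZd s).continuousAt
  have hDZ : Continuous fun s => D (Z s) := hDc.comp hZc
  set V : ℝ → ℝ := fun s => c + ∫ r in a..s, D (Z r) with hVdef
  have hVd : ∀ s, HasDerivAt V (D (Z s)) s := fun s =>
    ((hDZ.integral_hasStrictDerivAt a s).hasDerivAt).const_add c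
  have hZe : ∀ t ∈ Icc a b, Z t = (α (c, 0) t).2 := by
    refine eq_of_hasDerivWithinAt_Icc (h := ζ) (fun t _ => (hZd t).hasDerivWithinAt)
      (fun t ht => ?_) (by simp [hZ, hi c hc])
    have := hd2 c hc t ht
    simp only [hζ, hvee t ht]
    exact this
  have hVe : ∀ t ∈ Icc a b, V t = v t := by
    refine eq_of_hasDerivWithinAt_Icc (h := fun t => D (Z t))
      (fun t _ => (hVd t).hasDerivWithinAt) (fun t ht => ?_) (by simp [hVdef, hv, hi c hc])
    have := hd1 c hc t ht
    rw [← hZe t ht] at this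
    exact this
  refine ⟨V, Z, hVd, fun s => ?_, by simp [hZ], by rw [hZe b hb, hc0]⟩
  have := hZd s
  by_cases hs : s ∈ Ioo a b
  · rw [hVe s (Ioo_subset_Icc_self hs), ← hvee s (Ioo_subset_Icc_self hs)]
    exact this
  · simpa [hζ, hχs s hs] using this

/-- The symmetric difference quotient of `H` with step `τ`. -/
def symmQuot (H : ℝ → ℝ) (τ x : ℝ) : ℝ := (H (x + τ) - H (x - τ)) / (2 * τ)

theorem ConvexOn.add_symmQuot_mul_le {H : ℝ → ℝ} (hH : ConvexOn ℝ univ H) {τ x L : ℝ} (hτ : 0 < τ)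
    (hL : ∀ s ∈ Icc (x - τ) (x + τ), ∀ t ∈ Icc (x - τ) (x + τ), |H s - H t| ≤ L * |s - t|)
    (y : ℝ) : H x + symmQuot H τ x * (y - x) ≤ H y + 2 * L * τ := by
  have hL0 : 0 ≤ L := by
    have := (abs_nonneg _).trans (hL (x + τ) ⟨by linarith, le_rfl⟩ x ⟨by linarith, by linarith⟩)
    rw [add_sub_cancel_left, abs_of_pos hτ] at this
    exact nonneg_of_mul_nonneg_left this hτ
  have hmid : 2 * H x ≤ H (x + τ) + H (x - τ) := by
    have := hH.2 (mem_univ (x + τ)) (mem_univ (x - τ)) 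
      (show (0:ℝ) ≤ 1 / 2 by norm_num) (show (0:ℝ) ≤ 1 / 2 by norm_num) (by norm_num)
    simp only [smul_eq_mul] at this
    rw [show 1 / 2 * (x + τ) + 1 / 2 * (x - τ) = x by ring] at this
    linarith
  have hq : symmQuot H τ x * (2 * τ) = H (x + τ) - H (x - τ) := by
    unfold symmQuot; field_simp
  have hLτ : 0 ≤ L * τ := by positivity
  rcases le_or_gt (x + τ) y with h | h
  · have hc := hH.2 (mem_univ x) (mem_univ y) 
      (show 0 ≤ (y - x - τ) / (y - x) from div_nonneg (by linarith) (by linarith))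
      (show 0 ≤ τ / (y - x) from div_nonneg hτ.le (by linarith))
      (by rw [← add_div, sub_add_cancel]; exact div_self (by linarith))
    have hyx : y - x ≠ 0 := by linarith
    simp only [smul_eq_mul] at hc
    rw [show (y - x - τ) / (y - x) * x + τ / (y - x) * y = x + τ by field_simp; ring] at hc
    have h1 : H (x + τ) - H x ≤ τ / (y - x) * (H y - H x) := by
      have : (y - x - τ) / (y - x) = 1 - τ / (y - x) := by field_simp
      rw [this] at hc; linarith
    have h2 : symmQuot H τ x * τ ≤ τ / (y - x) * (H y - H x) := by linarith
    have h3 : symmQuot H τ x ≤ (H y - H x) / (y - x) := by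
      rw [← mul_le_mul_iff_left₀ hτ]
      calc _ ≤ _ := h2
        _ = _ := by ring
    rw [le_div_iff₀ (by linarith)] at h3
    linarith
  rcases le_or_gt y (x - τ) with h' | h'
  · have hc := hH.2 (mem_univ x) (mem_univ y) 
      (show 0 ≤ (x - y - τ) / (x - y) from div_nonneg (by linarith) (by linarith))
      (show 0 ≤ τ / (x - y) from div_nonneg hτ.le (by linarith))
      (by rw [← add_div, sub_add_cancel]; exact div_self (by linarith))
    have hyx : x - y ≠ 0 := by linarith
    simp only [smul_eq_mul] at hc
    rw [show (x - y - τ) / (x - y) * x + τ / (x - y) * y = x - τ by field_simp; ring] at hc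
    have h1 : H (x - τ) - H x ≤ τ / (x - y) * (H y - H x) := by
      have : (x - y - τ) / (x - y) = 1 - τ / (x - y) := by field_simp
      rw [this] at hc; linarith
    have h2 : -symmQuot H τ x * τ ≤ τ / (x - y) * (H y - H x) := by linarith
    have h3 : -symmQuot H τ x ≤ (H y - H x) / (x - y) := by
      rw [← mul_le_mul_iff_left₀ hτ]
      calc _ ≤ _ := h2
        _ = _ := by ring
    rw [le_div_iff₀ (by linarith)] at h3
    linarith
  · have hq' : |symmQuot H τ x| ≤ L := by
      have := hL (x + τ) ⟨by linarith, le_rfl⟩ (x - τ) ⟨le_rfl, by linarith⟩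
      rw [← hq, show x + τ - (x - τ) = 2 * τ by ring, abs_mul] at this
      exact le_of_mul_le_mul_right this (abs_pos.2 (by linarith))
    have hyx : |y - x| ≤ τ := abs_le.2 ⟨by linarith, by linarith⟩
    have h1 := (abs_le.1 (hL y ⟨by linarith, by linarith⟩ x ⟨by linarith, by linarith⟩)).1
    have h2 : symmQuot H τ x * (y - x) ≤ L * τ :=
      (le_abs_self _).trans (by rw [abs_mul]; exact mul_le_mul hq' hyx (abs_nonneg _) hL0)
    have h3 := mul_le_mul_of_nonneg_left hyx hL0
    linarith

theorem abs_symmQuot_le {H : ℝ → ℝ} {τ x L : ℝ} (hτ : 0 < τ)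
    (hL : |H (x + τ) - H (x - τ)| ≤ L * |x + τ - (x - τ)|) : |symmQuot H τ x| ≤ L := by
  rw [show x + τ - (x - τ) = 2 * τ by ring, abs_of_pos (by linarith : 0 < 2 * τ)] at hL
  rw [symmQuot, abs_div, abs_of_pos (by linarith : 0 < 2 * τ), div_le_iff₀ (by linarith)]
  exact hL

theorem abs_symmQuot_sub_le {H : ℝ → ℝ} {τ x y L : ℝ} (hτ : 0 < τ)
    (h₁ : |H (x + τ) - H (y + τ)| ≤ L * |x + τ - (y + τ)|)
    (h₂ : |H (x - τ) - H (y - τ)| ≤ L * |x - τ - (y - τ)|) :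
    |symmQuot H τ x - symmQuot H τ y| ≤ L / τ * |x - y| := by
  rw [add_sub_add_right_eq_sub] at h₁
  rw [sub_sub_sub_cancel_right] at h₂
  have : symmQuot H τ x - symmQuot H τ y =
      ((H (x + τ) - H (y + τ)) - (H (x - τ) - H (y - τ))) / (2 * τ) := by
    unfold symmQuot; ring
  rw [this, abs_div, abs_of_pos (by linarith : 0 < 2 * τ), div_le_iff₀ (by linarith)]
  refine (abs_sub _ _).trans ((add_le_add h₁ h₂).trans (le_of_eq ?_))
  field_simp; ring

theorem abs_rpow_sub_abs_rpow_le {p R x y : ℝ} (hp : 1 ≤ p) (hx : |x| ≤ R) (hy : |y| ≤ R) :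
    |(|x| ^ p - |y| ^ p)| ≤ p * R ^ (p - 1) * |x - y| := by
  wlog h : |y| ≤ |x| generalizing x y
  · rw [abs_sub_comm, abs_sub_comm x y]; exact this hy hx (le_of_not_ge h)
  have hmono : |y| ^ p ≤ |x| ^ p := Real.rpow_le_rpow (abs_nonneg _) h (by linarith)
  rw [abs_of_nonneg (by linarith)]
  have hR : 0 ≤ R := (abs_nonneg _).trans hx
  have key : |x| ^ p - |y| ^ p ≤ p * R ^ (p - 1) * (|x| - |y|) := by
    have := (convex_Icc (0:ℝ) R).norm_image_sub_le_of_norm_hasDerivWithin_le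
      (f := fun t => t ^ p) (f' := fun t => p * t ^ (p - 1)) (C := p * R ^ (p - 1))
      (fun t _ => (Real.hasDerivAt_rpow_const (Or.inr hp)).hasDerivWithinAt)
      (fun t ht => by
        rw [Real.norm_eq_abs, abs_of_nonneg (mul_nonneg (by linarith) (Real.rpow_nonneg ht.1 _))]
        exact mul_le_mul_of_nonneg_left (Real.rpow_le_rpow ht.1 ht.2 (by linarith)) (by linarith))
      ⟨abs_nonneg y, hy⟩ ⟨abs_nonneg x, hx⟩
    simp only [Real.norm_eq_abs] at this
    rw [abs_of_nonneg (by linarith : 0 ≤ |x| - |y|)] at this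
    exact (le_abs_self _).trans this
  refine key.trans (mul_le_mul_of_nonneg_left (abs_sub_abs_le_abs_sub x y) ?_)
  exact mul_nonneg (by linarith) (Real.rpow_nonneg hR _)

theorem convexOn_abs_rpow {p : ℝ} (hp : 1 ≤ p) : ConvexOn ℝ univ (fun x : ℝ => |x| ^ p) := by
  refine ⟨convex_univ, fun x _ y _ a b ha hb hab => ?_⟩
  simp only [smul_eq_mul]
  have h := (convexOn_rpow hp).2 (abs_nonneg x : |x| ∈ Ici 0) (abs_nonneg y : |y| ∈ Ici 0) ha hb hab
  simp only [smul_eq_mul] at h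
  refine (Real.rpow_le_rpow (abs_nonneg _) ?_ (by linarith)).trans h
  refine (abs_add_le _ _).trans (le_of_eq ?_)
  rw [abs_mul, abs_mul, abs_of_nonneg ha, abs_of_nonneg hb]

/-- The properties of the upper profile of the Wulff shape that are used below. -/
structure IsProfile (f : ℝ → ℝ) (A : ℝ) : Prop where
  pos : 0 < A
  concave : ConcaveOn ℝ (Icc (-A) A) f
  even : ∀ z, f (-z) = f z
  nonneg : ∀ z ∈ Icc (-A) A, 0 ≤ f z
  zero_pos : 0 < f 0
  small : ∀ η > 0, ∃ z ∈ Ioo 0 A, f z < η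

theorem ConcaveOn.antitoneOn_of_even {f : ℝ → ℝ} {s : Set ℝ} (hf : ConcaveOn ℝ s f)
    (hs : ∀ x ∈ s, -x ∈ s) (heven : ∀ z, f (-z) = f z) {x y : ℝ} (hx : 0 ≤ x) (hxy : x ≤ y)
    (hy : y ∈ s) : f y ≤ f x := by
  rcases hxy.eq_or_lt with rfl | h
  · exact le_rfl
  have hy0 : y ≠ 0 := by linarith
  have := hf.2 hy (hs y hy) 
    (show 0 ≤ (y + x) / (2 * y) from div_nonneg (by linarith) (by linarith))
    (show 0 ≤ (y - x) / (2 * y) from div_nonneg (by linarith) (by linarith))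
    (by field_simp; ring)
  simp only [smul_eq_mul, heven] at this
  rw [show (y + x) / (2 * y) * y + (y - x) / (2 * y) * -y = x by field_simp; ring,
    ← add_mul, show (y + x) / (2 * y) + (y - x) / (2 * y) = 1 by field_simp; ring, one_mul] at this
  exact this

namespace IsProfile
variable {f : ℝ → ℝ} {A : ℝ}

theorem le_of_abs_le (hf : IsProfile f A) {x y : ℝ} (h : |x| ≤ |y|) (hy : |y| ≤ A) :
    f y ≤ f x := by
  have habs : ∀ z, f |z| = f z := fun z => by
    rcases abs_choice z with h | h <;> rw [h]
    exact hf.even z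
  rw [← habs x, ← habs y]
  exact hf.concave.antitoneOn_of_even (fun x hx => ⟨by linarith [hx.2], by linarith [hx.1]⟩) hf.even
    (abs_nonneg _) h ⟨by linarith [abs_nonneg y, hf.pos], hy⟩

theorem sub_le (hf : IsProfile f A) {z₀ z w : ℝ} (hz₀ : z₀ < A) (hz : |z| ≤ z₀) (hw : |w| ≤ A) :
    f w - f z ≤ f 0 / (A - z₀) * |z - w| := by
  wlog h : z ≤ w generalizing z w
  · have := this (z := -z) (w := -w) (by rwa [abs_neg]) (by rwa [abs_neg]) (by linarith)
    rwa [hf.even, hf.even, neg_sub_neg, abs_sub_comm] at this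
  rcases h.eq_or_lt with rfl | h
  · simp
  have hz' := abs_le.1 hz
  have hw' := abs_le.1 hw
  have hzA : z ∈ Icc (-A) A := ⟨by linarith, by linarith⟩
  have hslope := hf.concave.slope_anti_adjacent (x := -A) (y := z) (z := w)
    ⟨le_rfl, by linarith [hf.pos]⟩ hw' (by linarith) h
  have hb : (f z - f (-A)) / (z - -A) ≤ f 0 / (A - z₀) := by
    refine div_le_div₀ hf.zero_pos.le ?_ (by linarith) (by linarith)
    have h1 : f z ≤ f 0 := hf.le_of_abs_le (by simp) (by linarith)
    have h2 := hf.nonneg (-A) ⟨le_rfl, by linarith [hf.pos]⟩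
    linarith
  have := hslope.trans hb
  rw [div_le_iff₀ (by linarith)] at this
  rw [abs_sub_comm, abs_of_pos (by linarith)]
  exact this

theorem exists_extension (hf : IsProfile f A) {z₀ : ℝ} (h0 : 0 ≤ z₀) (hz₀ : z₀ < A) :
    ∃ F : ℝ → ℝ, ∃ K : ℝ, 0 < K ∧ ConcaveOn ℝ univ F ∧ (∀ x y, |F x - F y| ≤ K * |x - y|) ∧
      (∀ z, F (-z) = F z) ∧ (∀ z, |z| ≤ A → f z ≤ F z) ∧ (∀ z, |z| ≤ z₀ → F z = f z) := by
  set K := f 0 / (A - z₀) with hKdef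
  have hK : 0 < K := div_pos hf.zero_pos (by linarith)
  have hA := hf.pos
  set S : ℝ → Set ℝ := fun z => (fun w => f w - K * |z - w|) '' Icc (-A) A with hS
  have hne : ∀ z, (S z).Nonempty := fun z => ⟨_, mem_image_of_mem _ ⟨by linarith, hA.le⟩⟩
  have hbdd : ∀ z, BddAbove (S z) := fun z => ⟨f 0, by
    rintro _ ⟨w, hw, rfl⟩
    have := hf.le_of_abs_le (x := 0) (y := w) (by simp) (abs_le.2 hw)
    have : 0 ≤ K * |z - w| := by positivity
    simp only; linarith⟩
  have hle : ∀ z w, w ∈ Icc (-A) A → f w - K * |z - w| ≤ sSup (S z) := fun z w hw =>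
    le_csSup (hbdd z) (mem_image_of_mem _ hw)
  have hlip : ∀ x y, sSup (S x) - sSup (S y) ≤ K * |x - y| := fun x y => by
    rw [sub_le_iff_le_add]
    refine csSup_le (hne x) ?_
    rintro _ ⟨w, hw, rfl⟩
    have h1 := hle y w hw
    have h2 : |y - w| ≤ |x - y| + |x - w| := by
      rw [abs_sub_comm x y]; exact abs_sub_le y x w
    have := mul_le_mul_of_nonneg_left h2 hK.le
    simp only; linarith
  refine ⟨fun z => sSup (S z), K, hK, ⟨convex_univ, fun x _ y _ a b ha hb hab => ?_⟩,
    fun x y => abs_le.2 ⟨?_, hlip x y⟩, fun z => ?_, fun z hz => ?_, fun z hz => ?_⟩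
  · refine le_of_forall_pos_lt_add fun ε hε => ?_
    obtain ⟨_, ⟨w, hw, rfl⟩, hxw⟩ := exists_lt_of_lt_csSup (hne x)
      (show sSup (S x) - ε / 2 < sSup (S x) by linarith)
    obtain ⟨_, ⟨v, hv, rfl⟩, hyv⟩ := exists_lt_of_lt_csSup (hne y)
      (show sSup (S y) - ε / 2 < sSup (S y) by linarith)
    have hc := hf.concave.2 hw hv ha hb hab
    have hm := hle (a * x + b * y) (a * w + b * v) (hf.concave.1 hw hv ha hb hab)
    have habs : |a * x + b * y - (a * w + b * v)| ≤ a * |x - w| + b * |y - v| := by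
      rw [show a * x + b * y - (a * w + b * v) = a * (x - w) + b * (y - v) by ring]
      refine (abs_add_le _ _).trans (le_of_eq ?_)
      rw [abs_mul, abs_mul, abs_of_nonneg ha, abs_of_nonneg hb]
    have := mul_le_mul_of_nonneg_left habs hK.le
    simp only [smul_eq_mul] at *
    have e1 := mul_le_mul_of_nonneg_left hxw.le ha
    have e2 := mul_le_mul_of_nonneg_left hyv.le hb
    have e3 : a * ε + b * ε = ε := by rw [← add_mul, hab, one_mul]
    nlinarith
  · have := hlip y x
    rw [abs_sub_comm] at this; linarith
  · have hSz : S (-z) = S z := by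
      ext r
      constructor <;>
      · rintro ⟨w, hw, rfl⟩
        refine ⟨-w, ⟨by linarith [hw.2], by linarith [hw.1]⟩, ?_⟩
        simp only [hf.even]
        congr 2
        rw [← abs_neg]; congr 1; ring
    simp only [hSz]
  · have := hle z z (abs_le.1 hz); simpa using this
  · refine le_antisymm (csSup_le (hne z) ?_) (by
      have := hle z z (abs_le.1 (hz.trans hz₀.le)); simpa using this)
    rintro _ ⟨w, hw, rfl⟩
    have := hf.sub_le hz₀ hz (abs_le.2 hw)
    simp only; linarith

end IsProfile

theorem exists_integral_mean {F : ℝ → ℝ} {K τ : ℝ} (hτ : 0 < τ)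
    (hF : ∀ x y, |F x - F y| ≤ K * |x - y|) :
    ∃ E : ℝ → ℝ, (∀ z, HasDerivAt E (symmQuot F τ z) z) ∧ ∀ z, |E z - F z| ≤ K * τ := by
  have hcont : Continuous F :=
    (LipschitzWith.of_dist_le' (K := K) fun x y => hF x y).continuous
  have hK : 0 ≤ K := by simpa using (abs_nonneg _).trans (hF 1 0)
  refine ⟨fun z => (∫ t in (z - τ)..(z + τ), F t) / (2 * τ), fun z => ?_, fun z => ?_⟩
  · have h1 : ∀ z, (∫ t in (z - τ)..(z + τ), F t) =
        (∫ t in (0:ℝ)..(z + τ), F t) - ∫ t in (0:ℝ)..(z - τ), F t := fun z =>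
      (intervalIntegral.integral_interval_sub_left (hcont.intervalIntegrable _ _)
        (hcont.intervalIntegrable _ _)).symm
    simp only [h1]
    have hd : ∀ x, HasDerivAt (fun x => ∫ t in (0:ℝ)..x, F t) (F x) x := fun x =>
      intervalIntegral.integral_hasDerivAt_right (hcont.intervalIntegrable _ _)
        hcont.aestronglyMeasurable.stronglyMeasurableAtFilter hcont.continuousAt
    have ha := (hd (z + τ)).comp_add_const z τ
    have hb := (hd (z - τ)).comp_sub_const z τ
    exact (ha.sub hb).div_const _
  · have hconst : (∫ _ in (z - τ)..(z + τ), F z) = 2 * τ * F z := by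
      rw [intervalIntegral.integral_const, smul_eq_mul]; ring
    have : (∫ t in (z - τ)..(z + τ), F t) / (2 * τ) - F z =
        (∫ t in (z - τ)..(z + τ), (F t - F z)) / (2 * τ) := by
      rw [intervalIntegral.integral_sub (hcont.intervalIntegrable _ _) (by simp), hconst]
      field_simp
    simp only
    rw [this, abs_div, abs_of_pos (by linarith : 0 < 2 * τ), div_le_iff₀ (by linarith)]
    have := intervalIntegral.norm_integral_le_of_norm_le_const (a := z - τ) (b := z + τ)
      (f := fun t => F t - F z) (C := K * τ) (fun t ht => by
        rw [uIoc_of_le (by linarith)] at ht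
        exact (hF t z).trans (mul_le_mul_of_nonneg_left
          (abs_le.2 ⟨by linarith [ht.1], by linarith [ht.2]⟩) hK))
    rwa [Real.norm_eq_abs, show z + τ - (z - τ) = 2 * τ by ring, abs_of_pos (by linarith : 0 < 2 * τ)] at this

theorem hasDerivAt_max_zero_sq (x : ℝ) : HasDerivAt (fun x : ℝ => max x 0 ^ 2) (2 * max x 0) x := by
  rcases lt_trichotomy x 0 with h | rfl | h
  · rw [max_eq_right h.le, mul_zero]
    refine (hasDerivAt_const x (0:ℝ)).congr_of_eventuallyEq ?_
    filter_upwards [Iio_mem_nhds h] with y hy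
    simp [max_eq_right (le_of_lt (mem_Iio.1 hy))]
  · rw [max_self, mul_zero]
    have h2 : HasDerivAt (fun x : ℝ => x ^ 2) 0 0 := by simpa using hasDerivAt_pow 2 (0:ℝ)
    rw [hasDerivAt_iff_isLittleO] at h2 ⊢
    refine (Asymptotics.IsBigO.of_bound 1 (Eventually.of_forall fun y => ?_)).trans_isLittleO h2
    simp only [max_self, smul_eq_mul, mul_zero, sub_zero, norm_pow, Real.norm_eq_abs, one_mul,
      ne_eq, OfNat.ofNat_ne_zero, not_false_eq_true, zero_pow]
    refine pow_le_pow_left₀ (abs_nonneg _) ?_ 2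
    rw [abs_of_nonneg (le_max_right _ _)]
    exact max_le (le_abs_self y) (abs_nonneg y)
  · rw [max_eq_left h.le]
    refine HasDerivAt.congr_of_eventuallyEq (f := fun y => y ^ 2) (by simpa using hasDerivAt_pow 2 x) ?_
    filter_upwards [Ioi_mem_nhds h] with y hy
    rw [max_eq_left (le_of_lt (mem_Ioi.1 hy))]

/-- Solutions of the regularized Euler–Lagrange system with vanishing boundary values of `Z`. -/
structure IsShooting (a a' b' b M B : ℝ) (D β G χ E V Z : ℝ → ℝ) : Prop where
  lt_left : a < a'
  lt_mid : a' < b'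
  lt_right : b' < b
  hM : 0 ≤ M
  D_mul_nonpos : ∀ z, D z * z ≤ 0
  D_zero : D 0 = 0
  β_pos : ∀ x, 0 < x → 0 < β x
  β_neg : ∀ x, x < 0 → β x < 0
  β_le : ∀ x, |β x| ≤ B
  G_le : ∀ s, |G s| ≤ M
  χ_pos : ∀ s ∈ Ioo a' b', 0 < χ s
  χ_zero : ∀ s, s ∉ Ioo a' b' → χ s = 0
  χ_le : ∀ s, χ s ≤ 1
  hE : ∀ z, HasDerivAt E (D z) z
  hV : ∀ s, HasDerivAt V (D (Z s)) s
  hZ : ∀ s, HasDerivAt Z (-(χ s * β (V s - G s))) s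
  Z_left : Z a = 0
  Z_right : Z b = 0

namespace IsShooting
variable {a a' b' b M B : ℝ} {D β G χ E V Z : ℝ → ℝ}

theorem neg (h : IsShooting a a' b' b M B D β G χ E V Z) :
    IsShooting a a' b' b M B (fun z => -D (-z)) (fun x => -β (-x)) (fun s => -G s) χ
      (fun z => E (-z)) (fun s => -V s) (fun s => -Z s) where
  lt_left := h.lt_left
  lt_mid := h.lt_mid
  lt_right := h.lt_right
  hM := h.hM
  D_mul_nonpos z := by have := h.D_mul_nonpos (-z); linarith
  D_zero := by simp [h.D_zero]
  β_pos x hx := by have := h.β_neg (-x) (by linarith); linarith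
  β_neg x hx := by have := h.β_pos (-x) (by linarith); linarith
  β_le x := by simpa using h.β_le (-x)
  G_le s := by simpa using h.G_le s
  χ_pos := h.χ_pos
  χ_zero := h.χ_zero
  χ_le := h.χ_le
  hE z := by
    have : HasDerivAt (fun z => E (-z)) (D (-z) * -1) z := (h.hE (-z)).comp z (hasDerivAt_neg z)
    exact this.congr_deriv (by ring)
  hV s := by
    have : HasDerivAt (fun s => -V s) (-D (Z s)) s := (h.hV s).neg
    exact this.congr_deriv (by rw [neg_neg])
  hZ s := by
    have : HasDerivAt (fun s => -Z s) (- -(χ s * β (V s - G s))) s := (h.hZ s).neg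
    refine this.congr_deriv ?_
    rw [show -(-V s - -G s) = V s - G s by ring]
    ring
  Z_left := by simp [h.Z_left]
  Z_right := by simp [h.Z_right]

theorem χ_nonneg (h : IsShooting a a' b' b M B D β G χ E V Z) (s : ℝ) : 0 ≤ χ s := by
  by_cases hs : s ∈ Ioo a' b'
  · exact (h.χ_pos s hs).le
  · exact (h.χ_zero s hs).ge

theorem Z_eq_zero (h : IsShooting a a' b' b M B D β G χ E V Z) {s : ℝ} (hs : s ∉ Ioo a' b') :
    Z s = 0 := by
  have hd : ∀ x, x ∉ Ioo a' b' → HasDerivAt Z 0 x := fun x hx => by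
    simpa [h.χ_zero x hx] using h.hZ x
  have hconst : ∀ c d, (∀ x ∈ Icc c d, x ∉ Ioo a' b') → c ≤ d → Z d = Z c := fun c d hcd hle =>
    constant_of_has_deriv_right_zero (f := Z) (a := c) (b := d)
      (fun x _ => (h.hZ x).continuousAt.continuousWithinAt)
      (fun x hx => (hd x (hcd x (Ico_subset_Icc_self hx))).hasDerivWithinAt) d ⟨hle, le_rfl⟩
  have h1 := h.lt_left
  have h2 := h.lt_right
  rcases le_or_gt s a' with hsa | hsa
  · rcases le_total s a with hle | hle
    · rw [← hconst s a (fun x hx hx' => by linarith [hx.2, hx'.1]) hle, h.Z_left]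
    · rw [hconst a s (fun x hx hx' => by linarith [hx.2, hx'.1]) hle, h.Z_left]
  · have hsb : b' ≤ s := by by_contra hlt; exact hs ⟨hsa, not_le.1 hlt⟩
    rcases le_total s b with hle | hle
    · rw [← hconst s b (fun x hx hx' => by linarith [hx.1, hx'.2]) hle, h.Z_right]
    · rw [hconst b s (fun x hx hx' => by linarith [hx.1, hx'.2]) hle, h.Z_right]

theorem V_le_of_mem_Ioo (h : IsShooting a a' b' b M B D β G χ E V Z) {s : ℝ} (hs : s ∈ Ioo a' b') :
    V s ≤ M := by
  by_contra! hVM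
  have h1 := h.lt_left
  have h2 := h.lt_right
  set w : ℝ → ℝ := fun s => max (V s - M) 0 ^ 2 * Z s
  set w' : ℝ → ℝ := fun s => 2 * max (V s - M) 0 * D (Z s) * Z s +
    max (V s - M) 0 ^ 2 * -(χ s * β (V s - G s))
  have hw : ∀ s, HasDerivAt w (w' s) s := fun s => by
    have : HasDerivAt (fun s => max (V s - M) 0 ^ 2) (2 * max (V s - M) 0 * D (Z s)) s :=
      (hasDerivAt_max_zero_sq (V s - M)).comp (h := fun s => V s - M) s ((h.hV s).sub_const M)
    exact this.mul (h.hZ s)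
  have hβ : ∀ s, 0 ≤ max (V s - M) 0 ^ 2 * (χ s * β (V s - G s)) := fun s => by
    rcases le_or_gt (V s) M with hle | hlt
    · simp [max_eq_right (sub_nonpos.2 hle)]
    · exact mul_nonneg (sq_nonneg _) (mul_nonneg (h.χ_nonneg s)
        (h.β_pos _ (by linarith [(abs_le.1 (h.G_le s)).2])).le)
  have hD : ∀ s, 2 * max (V s - M) 0 * D (Z s) * Z s ≤ 0 := fun s => by
    rw [mul_assoc]
    exact mul_nonpos_of_nonneg_of_nonpos (by positivity) (h.D_mul_nonpos _)
  have hanti : AntitoneOn w (Icc a b) := le_of_hasDerivWithinAt_nonpos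
    (fun t _ => (hw t).hasDerivWithinAt) (fun t _ => by
      have := hβ t; have := hD t; simp only [w']; linarith)
  have hab : a ≤ b := by linarith [hs.1, hs.2]
  have hzero : ∀ t ∈ Icc a b, w t = 0 := fun t ht => le_antisymm
    ((hanti ⟨le_rfl, hab⟩ ht ht.1).trans (by simp [w, h.Z_left]))
    (le_trans (by simp [w, h.Z_right]) (hanti ht ⟨hab, le_rfl⟩ ht.2))
  have hw0 : w' s = 0 := by
    refine (hw s).unique ((hasDerivAt_const s (0:ℝ)).congr_of_eventuallyEq ?_)
    filter_upwards [Icc_mem_nhds (a := a) (b := b) (by linarith [hs.1]) (by linarith [hs.2])]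
      with t ht using hzero t ht
  have hpos : 0 < max (V s - M) 0 ^ 2 * (χ s * β (V s - G s)) := by
    refine mul_pos (pow_pos (lt_max_of_lt_left (by linarith)) 2) (mul_pos (h.χ_pos s hs)
      (h.β_pos _ (by linarith [(abs_le.1 (h.G_le s)).2])))
  have := hD s
  simp only [w'] at hw0
  linarith

theorem V_le (h : IsShooting a a' b' b M B D β G χ E V Z) {s : ℝ} : V s ≤ M := by
  have hc : Continuous V := continuous_iff_continuousAt.2 fun s => (h.hV s).continuousAt
  have hIcc : Icc a' b' ⊆ {s | V s ≤ M} := by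
    rw [← closure_Ioo h.lt_mid.ne]
    exact closure_minimal (fun s hs => h.V_le_of_mem_Ioo hs) (isClosed_le hc continuous_const)
  have hd : ∀ x, x ∉ Ioo a' b' → HasDerivAt V 0 x := fun x hx => by
    simpa [h.Z_eq_zero hx, h.D_zero] using h.hV x
  have hconst : ∀ c d, (∀ x ∈ Icc c d, x ∉ Ioo a' b') → c ≤ d → V d = V c := fun c d hcd hle =>
    constant_of_has_deriv_right_zero (f := V) (a := c) (b := d)
      (fun x _ => (h.hV x).continuousAt.continuousWithinAt)
      (fun x hx => (hd x (hcd x (Ico_subset_Icc_self hx))).hasDerivWithinAt) d ⟨hle, le_rfl⟩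
  rcases le_or_gt s a' with hsa | hsa
  · rw [← hconst s a' (fun x hx hx' => by linarith [hx.2, hx'.1]) hsa]
    exact hIcc ⟨le_rfl, h.lt_mid.le⟩
  rcases le_or_gt b' s with hsb | hsb
  · rw [hconst b' s (fun x hx hx' => by linarith [hx.1, hx'.2]) hsb]
    exact hIcc ⟨h.lt_mid.le, le_rfl⟩
  · exact hIcc ⟨hsa.le, hsb.le⟩

theorem abs_V_le (h : IsShooting a a' b' b M B D β G χ E V Z) (s : ℝ) : |V s| ≤ M :=
  abs_le.2 ⟨by have := h.neg.V_le (s := s); linarith, h.V_le⟩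

theorem abs_deriv_Z_le (h : IsShooting a a' b' b M B D β G χ E V Z) (s : ℝ) :
    |-(χ s * β (V s - G s))| ≤ B := by
  rw [abs_neg, abs_mul, abs_of_nonneg (h.χ_nonneg s)]
  exact (mul_le_of_le_one_left (abs_nonneg _) (h.χ_le s)).trans (h.β_le _)

theorem E_zero_le_of_pos (h : IsShooting a a' b' b M B D β G χ E V Z) {s : ℝ} (hs : 0 < Z s) :
    E 0 - 2 * M * B ≤ E (Z s) := by
  have hZc : Continuous Z := continuous_iff_continuousAt.2 fun s => (h.hZ s).continuousAt
  have hmem : s ∈ Ioo a' b' := by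
    by_contra hc; exact hs.ne' (h.Z_eq_zero hc)
  have has : a ≤ s := by linarith [hmem.1, h.lt_left]
  obtain ⟨r, ⟨hrI, hrZ⟩, hr⟩ := (isCompact_Icc.inter_right
    (isClosed_le hZc continuous_const : IsClosed {t | Z t ≤ 0})).exists_isGreatest
    (s := Icc a s ∩ {t | Z t ≤ 0}) ⟨a, ⟨le_rfl, has⟩, h.Z_left.le⟩
  have hrs : r < s := lt_of_le_of_ne hrI.2 (by rintro rfl; exact absurd hrZ (not_le.2 hs))
  have hZpos : ∀ t ∈ Ioc r s, 0 < Z t := fun t ht => by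
    by_contra! hle
    exact absurd (hr ⟨⟨hrI.1.trans ht.1.le, ht.2⟩, hle⟩) (not_le.2 ht.1)
  have hZnn : ∀ t ∈ Icc r s, 0 ≤ Z t := by
    rw [← closure_Ioc hrs.ne]
    exact closure_minimal (fun t ht => (hZpos t ht).le) (isClosed_le continuous_const hZc)
  have hZr : Z r = 0 := le_antisymm hrZ (hZnn r ⟨le_rfl, hrs.le⟩)
  have hDn : ∀ t ∈ Icc r s, D (Z t) ≤ 0 := fun t ht => by
    rcases (hZnn t ht).eq_or_lt with h0 | h0
    · rw [← h0, h.D_zero]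
    · exact nonpos_of_mul_nonpos_left (h.D_mul_nonpos _) h0
  have hanti : AntitoneOn (fun t => B * V t - E (Z t)) (Icc r s) := le_of_hasDerivWithinAt_nonpos
    (f' := fun t => B * D (Z t) - D (Z t) * -(χ t * β (V t - G t)))
    (fun t _ => (((h.hV t).const_mul B).sub ((h.hE (Z t)).comp t (h.hZ t))).hasDerivWithinAt)
    (fun t ht => by
      have h1 := (abs_le.1 (h.abs_deriv_Z_le t)).2
      have := mul_nonpos_of_nonpos_of_nonneg (hDn t ht) (sub_nonneg.2 h1)
      linarith)
  have := hanti ⟨le_rfl, hrs.le⟩ ⟨hrs.le, le_rfl⟩ hrs.le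
  simp only [hZr] at this
  have hB : 0 ≤ B := (abs_nonneg _).trans (h.β_le 0)
  have h1 := mul_le_mul_of_nonneg_left (h.V_le (s := r)) hB
  have h2 := mul_le_mul_of_nonneg_left (h.neg.V_le (s := s)) hB
  linarith

theorem E_zero_le (h : IsShooting a a' b' b M B D β G χ E V Z) (s : ℝ) :
    E 0 - 2 * M * B ≤ E (Z s) := by
  rcases lt_trichotomy (Z s) 0 with hs | hs | hs
  · simpa using h.neg.E_zero_le_of_pos (s := s) (by simpa using hs)
  · have hB : 0 ≤ B := (abs_nonneg _).trans (h.β_le 0)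
    have := mul_nonneg h.hM hB
    rw [hs]; linarith
  · exact h.E_zero_le_of_pos hs

end IsShooting

theorem exists_cutoff {a b ε : ℝ} (hab : a < b) (hε : 0 < ε) :
    ∃ (a' b' : ℝ) (χ : ℝ → ℝ), a < a' ∧ a' < b' ∧ b' < b ∧ ContDiff ℝ 1 χ ∧ (∀ s, χ s ≤ 1) ∧
      (∀ s ∈ Ioo a' b', 0 < χ s) ∧ (∀ s, s ∉ Ioo a' b' → χ s = 0) ∧
      ∫ s in Ioo a b, (1 - χ s) ≤ ε := by
  obtain ⟨δ, hδ, hδε, hδab⟩ : ∃ δ > 0, 4 * δ ≤ ε ∧ 8 * δ ≤ b - a :=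
    ⟨min (ε / 4) ((b - a) / 8), lt_min (by linarith) (by linarith),
      by linarith [min_le_left (ε / 4) ((b - a) / 8)],
      by linarith [min_le_right (ε / 4) ((b - a) / 8)]⟩
  let χ : ContDiffBump ((a + b) / 2) :=
    { rIn := (b - a) / 2 - 2 * δ, rOut := (b - a) / 2 - δ
      rIn_pos := by linarith, rIn_lt_rOut := by linarith }
  have hχc : Continuous χ := χ.continuous
  have h0 : ∀ s, 0 ≤ χ s := fun s => χ.nonneg
  have h1 : ∀ s, χ s ≤ 1 := fun s => χ.le_one
  have hone : ∀ s ∈ Icc (a + 2 * δ) (b - 2 * δ), χ s = 1 := fun s hs => by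
    refine χ.one_of_mem_closedBall ?_
    rw [Real.closedBall_eq_Icc]
    exact ⟨by simp only [χ]; linarith [hs.1], by simp only [χ]; linarith [hs.2]⟩
  have hball : Metric.ball ((a + b) / 2) χ.rOut = Ioo (a + δ) (b - δ) := by
    rw [Real.ball_eq_Ioo]
    congr 1 <;> simp only [χ] <;> ring
  refine ⟨a + δ, b - δ, χ, by linarith, by linarith, by linarith, χ.contDiff, h1, fun s hs => ?_,
    fun s hs => ?_, ?_⟩
  · exact χ.pos_of_mem_ball (hball ▸ hs)
  · rw [← hball, ← χ.support_eq] at hs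
    exact Function.notMem_support.1 hs
  · set J : Set ℝ := Ioo a b \ Icc (a + 2 * δ) (b - 2 * δ)
    have hsub : Icc (a + 2 * δ) (b - 2 * δ) ⊆ Ioo a b := Icc_subset_Ioo (by linarith) (by linarith)
    have hint : IntegrableOn (fun s => 1 - χ s) (Ioo a b) :=
      ((continuous_const.sub hχc).integrableOn_Icc (a := a) (b := b)).mono_set Ioo_subset_Icc_self
    have hJ : volume.real J = 4 * δ := by
      rw [measureReal_sdiff hsub measurableSet_Icc (by simp)]
      rw [Real.volume_real_Ioo_of_le hab.le, Real.volume_real_Icc_of_le (by linarith)]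
      ring
    have hle : ∫ s in Ioo a b, (1 - χ s) ≤ ∫ s in Ioo a b, J.indicator 1 s := by
      refine setIntegral_mono_on hint ?_ measurableSet_Ioo fun s hs => ?_
      · exact IntegrableOn.indicator (integrableOn_const (by simp))
          (measurableSet_Ioo.diff measurableSet_Icc)
      · by_cases hs' : s ∈ Icc (a + 2 * δ) (b - 2 * δ)
        · rw [hone s hs', sub_self]
          exact indicator_nonneg (fun _ _ => zero_le_one) _
        · rw [indicator_of_mem (show s ∈ J from ⟨hs, hs'⟩)]
          simp only [Pi.one_apply]; linarith [h0 s]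
    refine hle.trans ?_
    rw [integral_indicator_one (measurableSet_Ioo.diff measurableSet_Icc),
      measureReal_restrict_apply (measurableSet_Ioo.diff measurableSet_Icc),
      inter_eq_left.2 sdiff_subset, hJ]
    exact hδε

theorem exists_continuous_approx {I : Set ℝ} [IsFiniteMeasure (volume.restrict I)]
    {g u : ℝ → ℝ} {M ε : ℝ} (hM : 0 ≤ M)
    (hg : AEStronglyMeasurable g (volume.restrict I)) (hgM : ∀ᵐ s ∂volume.restrict I, |g s| ≤ M)
    (hu : IntegrableOn u I) (hε : 0 < ε) :
    ∃ G : ℝ → ℝ, Continuous G ∧ (∀ s, |G s| ≤ M) ∧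
      ∫ s in I, |G s - g s| * (|u s| + M) ≤ ε := by
  set μ := volume.restrict I
  set d : ℝ → ℝ≥0∞ := fun s => ENNReal.ofReal (|u s| + M)
  have hw : Integrable (fun s => |u s| + M) μ := hu.abs.add (integrable_const M)
  have hd : AEMeasurable d μ := hw.aemeasurable.ennreal_ofReal
  have hdt : ∀ᵐ s ∂μ, d s < ⊤ := ae_of_all _ fun s => ENNReal.ofReal_lt_top
  set ν := μ.withDensity d
  have : IsFiniteMeasure ν := isFiniteMeasure_withDensity_ofReal hw.2
  have hac : ν ≪ μ := withDensity_absolutelyContinuous _ _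
  have hgν : Integrable g ν := Integrable.of_bound (hg.mono_ac hac) M (hac hgM)
  obtain ⟨k, hk, hkint⟩ := hgν.exists_boundedContinuous_integral_sub_le hε
  refine ⟨fun s => max (-M) (min M (k s)), by fun_prop, fun s => abs_le.2 ⟨le_max_left _ _,
    max_le (by linarith) (min_le_left _ _)⟩, ?_⟩
  have hconv : ∫ s, |k s - g s| ∂ν = ∫ s, |k s - g s| * (|u s| + M) ∂μ := by
    rw [integral_withDensity_eq_integral_toReal_smul₀ hd hdt]
    refine integral_congr_ae (ae_of_all _ fun s => ?_)
    have : 0 ≤ |u s| + M := by positivity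
    simp only [d, smul_eq_mul, ENNReal.toReal_ofReal this]
    ring
  have hint : Integrable (fun s => |k s - g s| * (|u s| + M)) μ := by
    refine hw.bdd_mul (c := ‖k‖ + M) ((k.continuous.aestronglyMeasurable.sub hg).norm) ?_
    filter_upwards [hgM] with s hs
    have h1 := k.norm_coe_le_norm s
    rw [Real.norm_eq_abs] at h1
    simp only [Real.norm_eq_abs, abs_abs]
    exact (abs_sub _ _).trans (add_le_add h1 hs)
  calc ∫ s, |max (-M) (min M (k s)) - g s| * (|u s| + M) ∂μ
      ≤ ∫ s, |k s - g s| * (|u s| + M) ∂μ := by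
        refine integral_mono_of_nonneg (ae_of_all _ fun s => by positivity) hint ?_
        filter_upwards [hgM] with s hs
        refine mul_le_mul_of_nonneg_right ?_ (by positivity)
        have h1 := abs_le.1 hs
        rcases le_total M (k s) with h | h
        · rw [min_eq_left h, max_eq_right (by linarith), abs_of_nonneg (by linarith),
            abs_of_nonneg (by linarith)]
          linarith
        · rw [min_eq_right h]
          rcases le_total (-M) (k s) with h' | h'
          · rw [max_eq_right h']
          · rw [max_eq_left h', abs_of_nonpos (by linarith), abs_of_nonpos (by linarith)]
            linarith
    _ = ∫ s, |k s - g s| ∂ν := hconv.symm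
    _ ≤ ε := by
        refine le_trans (le_of_eq ?_) hk
        refine integral_congr_ae (ae_of_all _ fun s => ?_)
        simp only [Real.norm_eq_abs]; exact abs_sub_comm _ _

theorem symmQuot_neg {H : ℝ → ℝ} (hH : ∀ x, H (-x) = H x) (τ x : ℝ) :
    symmQuot H τ (-x) = -symmQuot H τ x := by
  unfold symmQuot
  rw [← neg_div, show -x + τ = -(x - τ) by ring, show -x - τ = -(x + τ) by ring, hH, hH]
  ring

/-- The pairing inequality behind the comparison of `|v - g|^p` with `|u - g|^p`. -/
theorem abs_rpow_le_add_pairing {p M τ B χ V G g u : ℝ} (hp : 1 ≤ p) (hM : 0 ≤ M) (hτ : 0 < τ)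
    (hBτ : p * (2 * M + τ) ^ (p - 1) ≤ B) (hχ0 : 0 ≤ χ) (hχ1 : χ ≤ 1)
    (hV : |V| ≤ M) (hG : |G| ≤ M) (hg : |g| ≤ M) :
    |V - g| ^ p ≤ |u - g| ^ p + -(χ * symmQuot (fun x => |x| ^ p) τ (V - G)) * (u - V) +
      (2 * B * τ + (2 * M) ^ p * (1 - χ) + B / τ * (|G - g| * (|u| + M))) := by
  set H : ℝ → ℝ := fun x => |x| ^ p with hH
  have hVg : |V - g| ≤ 2 * M := (abs_sub _ _).trans (by linarith)
  have hVG : |V - G| ≤ 2 * M := (abs_sub _ _).trans (by linarith)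
  have hmem : ∀ {x s : ℝ}, |x| ≤ 2 * M → |s - x| ≤ τ → |s| ≤ 2 * M + τ := fun {x s} hx hs => by
    have := abs_add_le x (s - x)
    rw [add_sub_cancel] at this
    linarith
  have hlip : ∀ s t : ℝ, |s| ≤ 2 * M + τ → |t| ≤ 2 * M + τ → |H s - H t| ≤ B * |s - t| :=
    fun s t hs ht => (abs_rpow_sub_abs_rpow_le hp hs ht).trans
      (mul_le_mul_of_nonneg_right hBτ (abs_nonneg _))
  have hB : 0 ≤ B := le_trans (by positivity) hBτ
  have h1 := (convexOn_abs_rpow hp).add_symmQuot_mul_le hτ (x := V - g) (L := B)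
    (fun s hs t ht => hlip s t
      (hmem hVg (abs_le.2 ⟨by linarith [hs.1], by linarith [hs.2]⟩))
      (hmem hVg (abs_le.2 ⟨by linarith [ht.1], by linarith [ht.2]⟩))) (u - g)
  rw [sub_sub_sub_cancel_right] at h1
  have h2 : |symmQuot H τ (V - G) - symmQuot H τ (V - g)| ≤ B / τ * |G - g| := by
    have hτ' : |τ| ≤ τ := (abs_of_pos hτ).le
    have := abs_symmQuot_sub_le (H := H) (x := V - G) (y := V - g) (L := B) hτ
      (hlip _ _ (hmem hVG (by rwa [add_sub_cancel_left])) (hmem hVg (by rwa [add_sub_cancel_left])))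
      (hlip _ _ (hmem hVG (by rwa [sub_sub_cancel_left, abs_neg]))
        (hmem hVg (by rwa [sub_sub_cancel_left, abs_neg])))
    rwa [sub_sub_sub_cancel_left, abs_sub_comm g G] at this
  have h3 : (symmQuot H τ (V - G) - symmQuot H τ (V - g)) * (u - V) ≤
      B / τ * (|G - g| * (|u| + M)) := by
    refine (le_abs_self _).trans ?_
    rw [abs_mul, ← mul_assoc]
    refine mul_le_mul h2 ((abs_sub _ _).trans (by linarith)) (abs_nonneg _) (by positivity)
  have h4 : H (V - g) ≤ (2 * M) ^ p := Real.rpow_le_rpow (abs_nonneg _) hVg (by linarith)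
  have h5 : H (V - g) ≤ H (u - g) + -symmQuot H τ (V - G) * (u - V) + 2 * B * τ +
      B / τ * (|G - g| * (|u| + M)) := by linarith
  have h6 : 0 ≤ H (u - g) + 2 * B * τ + B / τ * (|G - g| * (|u| + M)) := by
    have : 0 ≤ H (u - g) := Real.rpow_nonneg (abs_nonneg _) _
    positivity
  have e1 := mul_le_mul_of_nonneg_left h5 hχ0
  have e2 := mul_le_mul_of_nonneg_left h4 (sub_nonneg.2 hχ1)
  have e3 := mul_nonneg (sub_nonneg.2 hχ1) h6
  change H (V - g) ≤ H (u - g) + -(χ * symmQuot H τ (V - G)) * (u - V) + _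
  nlinarith

/-- Clamped symmetric difference quotients of `|·|^p`. -/
def clampQuot (p M τ x : ℝ) : ℝ := symmQuot (fun x => |x| ^ p) τ (max (-(2 * M)) (min (2 * M) x))

theorem clampQuot_eq {p M τ x : ℝ} (hx : |x| ≤ 2 * M) :
    clampQuot p M τ x = symmQuot (fun x => |x| ^ p) τ x := by
  rw [clampQuot, min_eq_right (abs_le.1 hx).2, max_eq_right (abs_le.1 hx).1]

theorem abs_clamp_le {M : ℝ} (hM : 0 ≤ M) (x : ℝ) : |max (-(2 * M)) (min (2 * M) x)| ≤ 2 * M :=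
  abs_le.2 ⟨le_max_left _ _, max_le (by linarith) (min_le_left _ _)⟩

theorem abs_clampQuot_le {p M τ : ℝ} (hp : 1 ≤ p) (hM : 0 ≤ M) (hτ : 0 < τ) (x : ℝ) :
    |clampQuot p M τ x| ≤ p * (2 * M + τ) ^ (p - 1) := by
  have h := abs_le.1 (abs_clamp_le hM x)
  refine abs_symmQuot_le hτ (abs_rpow_sub_abs_rpow_le hp ?_ ?_) <;>
  exact abs_le.2 ⟨by linarith [h.1, h.2], by linarith [h.1, h.2]⟩

theorem lipschitzWith_clampQuot {p M τ : ℝ} (hp : 1 ≤ p) (hM : 0 ≤ M) (hτ : 0 < τ) :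
    ∃ K : ℝ≥0, LipschitzWith K (clampQuot p M τ) := by
  refine ⟨_, LipschitzWith.of_dist_le' (K := p * (2 * M + τ) ^ (p - 1) / τ) fun x y => ?_⟩
  have hx := abs_le.1 (abs_clamp_le hM x)
  have hy := abs_le.1 (abs_clamp_le hM y)
  rw [Real.dist_eq, Real.dist_eq]
  unfold clampQuot
  set cx := max (-(2 * M)) (min (2 * M) x) with hcx
  set cy := max (-(2 * M)) (min (2 * M) y) with hcy
  have hle : ∀ c : ℝ, -(2 * M) ≤ c ∧ c ≤ 2 * M → |c + τ| ≤ 2 * M + τ ∧ |c - τ| ≤ 2 * M + τ :=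
    fun c hc => ⟨abs_le.2 ⟨by linarith, by linarith⟩, abs_le.2 ⟨by linarith, by linarith⟩⟩
  have h0 := abs_symmQuot_sub_le (H := fun x => |x| ^ p) (x := cx) (y := cy) hτ
    (abs_rpow_sub_abs_rpow_le hp (hle cx hx).1 (hle cy hy).1)
    (abs_rpow_sub_abs_rpow_le hp (hle cx hx).2 (hle cy hy).2)
  refine h0.trans (mul_le_mul_of_nonneg_left ?_ (by positivity))
  have h1 : LipschitzWith 1 (fun x : ℝ => max (-(2 * M)) (min (2 * M) x)) :=
    (LipschitzWith.id.const_min (2 * M)).const_max (-(2 * M))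
  simpa [Real.dist_eq] using h1.dist_le_mul x y

theorem clampQuot_pos {p M τ x : ℝ} (hp : 1 ≤ p) (hM : 0 < M) (hτ : 0 < τ) (hx : 0 < x) :
    0 < clampQuot p M τ x := by
  have h : 0 < max (-(2 * M)) (min (2 * M) x) := lt_max_of_lt_right (lt_min (by linarith) hx)
  refine div_pos (sub_pos.2 (Real.rpow_lt_rpow (abs_nonneg _) ?_ (by linarith))) (by linarith)
  rw [abs_of_pos (by linarith : 0 < max (-(2 * M)) (min (2 * M) x) + τ)]
  exact abs_lt.2 ⟨by linarith, by linarith⟩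

theorem clampQuot_neg' {p M τ x : ℝ} (hp : 1 ≤ p) (hM : 0 < M) (hτ : 0 < τ) (hx : x < 0) :
    clampQuot p M τ x < 0 := by
  have h : max (-(2 * M)) (min (2 * M) x) < 0 :=
    max_lt (by linarith) (min_lt_of_right_lt hx)
  refine div_neg_of_neg_of_pos (sub_neg.2 (Real.rpow_lt_rpow (abs_nonneg _) ?_ (by linarith)))
    (by linarith)
  rw [abs_of_neg (by linarith : max (-(2 * M)) (min (2 * M) x) - τ < 0)]
  exact abs_lt.2 ⟨by linarith, by linarith⟩

theorem exists_pos_mul_rpow_lt {p M y : ℝ} (hp : 1 ≤ p) (hM : 0 < M)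
    (h : p * (2 * M) ^ p < y) : ∃ τ > 0, 2 * M * (p * (2 * M + τ) ^ (p - 1)) < y := by
  have hc : ContinuousAt (fun τ : ℝ => 2 * M * (p * (2 * M + τ) ^ (p - 1))) 0 := by
    refine continuousAt_const.mul (continuousAt_const.mul ?_)
    exact (continuousAt_const.add continuousAt_id).rpow_const (Or.inr (by linarith))
  have h0 : 2 * M * (p * (2 * M + 0) ^ (p - 1)) < y := by
    rw [add_zero, Real.rpow_sub_one (by linarith)]
    refine lt_of_eq_of_lt ?_ h
    field_simp
  have hev : ∀ᶠ τ in 𝓝[>] (0:ℝ), 2 * M * (p * (2 * M + τ) ^ (p - 1)) < y :=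
    (hc.eventually (gt_mem_nhds h0)).filter_mono nhdsWithin_le_nhds
  obtain ⟨τ, h1, h2⟩ := (hev.and self_mem_nhdsWithin).exists
  exact ⟨τ, h2, h1⟩

/-- An approximate calibration: `Z` is the horizontal component, `V` a competitor with slope `d`. -/
structure IsApproxField (f : ℝ → ℝ) (A a b M z₀ B err : ℝ) (V d Z Z' : ℝ → ℝ) : Prop where
  hV : ∀ s, HasDerivAt V (d s) s
  d_cont : Continuous d
  hZ : ∀ s, HasDerivAt Z (Z' s) s
  Z'_cont : Continuous Z'
  Z_le : ∀ s, |Z s| ≤ z₀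
  Z'_le : ∀ s, |Z' s| ≤ B
  compact : HasCompactSupport Z
  supp : tsupport Z ⊆ Ioo a b
  V_le : ∀ s, |V s| ≤ M
  slope : ∀ s w, |w| ≤ A → f w ≤ f (Z s) + d s * (w - Z s) + err

theorem IsProfile.exists_approxField {f : ℝ → ℝ} {A a b p M : ℝ} (hf : IsProfile f A)
    (hab : a < b) (hp : 1 ≤ p) (hM : 0 < M) (hsmall : p * (2 * M) ^ p < f 0) :
    ∃ z₀ ∈ Ioo 0 A, ∃ B : ℝ, ∀ g u : ℝ → ℝ, AEStronglyMeasurable g (volume.restrict (Ioo a b)) →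
      (∀ᵐ s ∂volume.restrict (Ioo a b), |g s| ≤ M) → IntegrableOn u (Ioo a b) →
      IntegrableOn (fun s => |u s - g s| ^ p) (Ioo a b) → ∀ err > 0, ∃ V d Z Z' : ℝ → ℝ,
        IsApproxField f A a b M z₀ B err V d Z Z' ∧
        ∫ s in Ioo a b, |V s - g s| ^ p ≤
          (∫ s in Ioo a b, |u s - g s| ^ p) + (∫ s in Ioo a b, Z' s * (u s - V s)) + err := by
  obtain ⟨τ₁, hτ₁, hc⟩ := exists_pos_mul_rpow_lt hp hM hsmall
  set B := p * (2 * M + τ₁) ^ (p - 1) with hBdef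
  set c := f 0 - 2 * M * B with hcdef
  have hc0 : 0 < c := by linarith
  obtain ⟨z₀, hz₀, hfz⟩ := hf.small (c / 2) (by linarith)
  obtain ⟨F, K, hK, hFc, hFl, hFe, hfF, hFf⟩ := hf.exists_extension hz₀.1.le hz₀.2
  refine ⟨z₀, hz₀, B, fun g u hg hgM hu hug err herr => ?_⟩
  have hB : 0 ≤ B := by positivity
  obtain ⟨τ, hτ, hτ1, hτK, hτe, hτe'⟩ : ∃ τ > 0, τ ≤ τ₁ ∧ 2 * K * τ < c / 2 ∧ 2 * K * τ ≤ err ∧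
      2 * B * (b - a) * τ ≤ err / 3 := by
    have hba : 0 < b - a := by linarith
    refine ⟨min (min τ₁ (c / (8 * K))) (min (err / (2 * K)) (err / (6 * (B + 1) * (b - a)))),
      by positivity, (min_le_left _ _).trans (min_le_left _ _), ?_, ?_, ?_⟩
    · have : min (min τ₁ (c / (8 * K))) (min (err / (2 * K)) (err / (6 * (B + 1) * (b - a)))) ≤
        c / (8 * K) := (min_le_left _ _).trans (min_le_right _ _)
      rw [le_div_iff₀ (by positivity)] at this
      linarith
    · have : min (min τ₁ (c / (8 * K))) (min (err / (2 * K)) (err / (6 * (B + 1) * (b - a)))) ≤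
        err / (2 * K) := (min_le_right _ _).trans (min_le_left _ _)
      rw [le_div_iff₀ (by positivity)] at this
      linarith
    · set τ' := min (min τ₁ (c / (8 * K))) (min (err / (2 * K)) (err / (6 * (B + 1) * (b - a))))
      have h1 : τ' ≤ err / (6 * (B + 1) * (b - a)) := (min_le_right _ _).trans (min_le_right _ _)
      have h0 : 0 ≤ τ' * (b - a) := by positivity
      rw [le_div_iff₀ (by positivity)] at h1
      nlinarith
  have hBτ : p * (2 * M + τ) ^ (p - 1) ≤ B := mul_le_mul_of_nonneg_left
    (Real.rpow_le_rpow (by linarith) (by linarith) (by linarith)) (by linarith)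
  obtain ⟨a', b', χ, ha', hab', hb', hχd, hχ1, hχp, hχz, hχi⟩ :=
    exists_cutoff hab (ε := err / (3 * (2 * M) ^ p)) (by positivity)
  obtain ⟨G, hGc, hGM, hGi⟩ := exists_continuous_approx hM.le hg hgM hu
    (ε := err / (3 * (B / τ + 1))) (by positivity)
  have hχc := hχd.continuous
  have hχ0 : ∀ s, 0 ≤ χ s := fun s => by
    by_cases hs : s ∈ Ioo a' b'
    · exact (hχp s hs).le
    · exact (hχz s hs).ge
  obtain ⟨E, hE, hEF⟩ := exists_integral_mean hτ hFl
  set D : ℝ → ℝ := symmQuot F τ with hD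
  have hDK : ∀ z, |D z| ≤ K := fun z => abs_symmQuot_le hτ (hFl _ _)
  have hDl : LipschitzWith (K / τ).toNNReal D := LipschitzWith.of_dist_le' fun x y =>
    abs_symmQuot_sub_le hτ (hFl _ _) (hFl _ _)
  have hDodd : ∀ z, D (-z) = -D z := symmQuot_neg hFe τ
  have hFanti : ∀ x y, |x| ≤ |y| → F y ≤ F x := fun x y h => by
    have habs : ∀ z, F |z| = F z := fun z => by
      rcases abs_choice z with h | h <;> rw [h]
      exact hFe z
    rw [← habs x, ← habs y]
    exact hFc.antitoneOn_of_even (fun _ _ => mem_univ _) hFe (abs_nonneg _) h (mem_univ _)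
  have hDsign : ∀ z, 0 ≤ z → D z ≤ 0 := fun z hz => by
    refine div_nonpos_of_nonpos_of_nonneg (sub_nonpos.2 (hFanti _ _ ?_)) (by linarith)
    rw [abs_of_nonneg (by linarith : 0 ≤ z + τ)]
    exact abs_le.2 ⟨by linarith, by linarith⟩
  have hDmul : ∀ z, D z * z ≤ 0 := fun z => by
    rcases le_total 0 z with h | h
    · exact mul_nonpos_of_nonpos_of_nonneg (hDsign z h) h
    · have := hDsign (-z) (by linarith)
      rw [hDodd] at this
      exact mul_nonpos_of_nonneg_of_nonpos (by linarith) h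
  obtain ⟨Kβ, hβl⟩ := lipschitzWith_clampQuot (p := p) (M := M) (τ := τ) hp hM.le hτ
  have hβB : ∀ x, |clampQuot p M τ x| ≤ B := fun x => (abs_clampQuot_le hp hM.le hτ x).trans hBτ
  have hβ0 : clampQuot p M τ 0 = 0 := by
    rw [clampQuot_eq (by simp [hM.le])]; simp [symmQuot]
  obtain ⟨V, Z, hV, hZ, hZa, hZb⟩ := exists_shooting_solution hab hDl hDK hβl hβB
    (fun x hx => hx.eq_or_lt.elim (fun h => by rw [← h, hβ0]) fun h => (clampQuot_pos hp hM hτ h).le)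
    (fun x hx => hx.eq_or_lt.elim (fun h => by rw [h, hβ0]) fun h => (clampQuot_neg' hp hM hτ h).le)
    hGc hGM hχc hχ0 hχ1 (fun s hs => hχz s fun hs' => hs ⟨by linarith [hs'.1], by linarith [hs'.2]⟩)
  have hS : IsShooting a a' b' b M B D (clampQuot p M τ) G χ E V Z :=
    { lt_left := ha', lt_mid := hab', lt_right := hb', hM := hM.le, D_mul_nonpos := hDmul
      D_zero := by have := hDodd 0; rw [neg_zero] at this; linarith
      β_pos := fun x hx => clampQuot_pos hp hM hτ hx
      β_neg := fun x hx => clampQuot_neg' hp hM hτ hx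
      β_le := hβB, G_le := hGM, χ_pos := hχp, χ_zero := hχz, χ_le := hχ1, hE := hE, hV := hV
      hZ := hZ, Z_left := hZa, Z_right := hZb }
  have hVc : Continuous V := continuous_iff_continuousAt.2 fun s => (hV s).continuousAt
  have hZc : Continuous Z := continuous_iff_continuousAt.2 fun s => (hZ s).continuousAt
  have hβc : Continuous fun s => -(χ s * clampQuot p M τ (V s - G s)) :=
    (hχc.mul (hβl.continuous.comp (hVc.sub hGc))).neg
  have hsuppZ : tsupport Z ⊆ Icc a' b' :=
    closure_minimal (fun s hs => by
      by_contra hc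
      exact hs (hS.Z_eq_zero fun h => hc (Ioo_subset_Icc_self h))) isClosed_Icc
  have hZz : ∀ s, |Z s| ≤ z₀ := fun s => by
    by_contra! hlt
    have h1 := hS.E_zero_le s
    have h2 := (abs_le.1 (hEF 0)).1
    have h3 := (abs_le.1 (hEF (Z s))).2
    have h4 : F 0 = f 0 := hFf 0 (by simpa using hz₀.1.le)
    have h5 : F z₀ = f z₀ := hFf z₀ (abs_of_pos hz₀.1).le
    have h6 := hFanti z₀ (Z s) (by rw [abs_of_pos hz₀.1]; exact hlt.le)
    linarith
  refine ⟨V, fun s => D (Z s), Z, _, ⟨hV, hDl.continuous.comp hZc, hZ, hβc, hZz,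
    hS.abs_deriv_Z_le,
    isCompact_Icc.of_isClosed_subset (isClosed_tsupport _) hsuppZ, hsuppZ.trans (Icc_subset_Ioo ha' hb'),
    hS.abs_V_le,
    fun s w hw => ?_⟩, ?_⟩
  · have h1 := hFc.neg.add_symmQuot_mul_le hτ (x := Z s) (L := K)
      (fun s _ t _ => by
        have := hFl t s
        rwa [← neg_sub_neg, abs_sub_comm t s] at this) w
    have h2 : symmQuot (-F) τ (Z s) = -D (Z s) := by simp only [hD, symmQuot, Pi.neg_apply]; ring
    rw [h2] at h1
    simp only [Pi.neg_apply] at h1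
    have h3 := hfF w hw
    have h4 := hFf (Z s) (hZz s)
    linarith
  · have hμ : ∀ k : ℝ → ℝ, Continuous k → IntegrableOn k (Ioo a b) := fun k hk =>
      (hk.integrableOn_Icc (a := a) (b := b)).mono_set Ioo_subset_Icc_self
    have i2 : IntegrableOn (fun s => -(χ s * clampQuot p M τ (V s - G s)) * (u s - V s))
        (Ioo a b) :=
      (hu.sub (hμ V hVc)).bdd_mul (c := B) hβc.aestronglyMeasurable
        (ae_of_all _ hS.abs_deriv_Z_le)
    have i3 : IntegrableOn (fun _ : ℝ => 2 * B * τ) (Ioo a b) := integrableOn_const (by simp)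
    have i4 : IntegrableOn (fun s => (2 * M) ^ p * (1 - χ s)) (Ioo a b) :=
      (hμ _ (continuous_const.sub hχc)).const_mul _
    have i5 : IntegrableOn (fun s => B / τ * (|G s - g s| * (|u s| + M))) (Ioo a b) := by
      refine Integrable.const_mul ?_ _
      refine Integrable.bdd_mul (c := M + M) (hu.abs.add (integrableOn_const (by simp)))
        (hGc.aestronglyMeasurable.sub hg).norm ?_
      filter_upwards [hgM] with s hs
      simp only [Real.norm_eq_abs, abs_abs]
      exact (abs_sub _ _).trans (add_le_add (hGM s) hs)
    have i0 : IntegrableOn (fun s => |V s - g s| ^ p) (Ioo a b) := by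
      refine Integrable.of_bound (C := (2 * M) ^ p) ?_ ?_
      · exact ((Real.continuous_rpow_const (by linarith)).comp continuous_abs).comp_aestronglyMeasurable
          (hVc.aestronglyMeasurable.sub hg)
      · filter_upwards [hgM] with s hs
        rw [Real.norm_eq_abs, abs_of_nonneg (Real.rpow_nonneg (abs_nonneg _) _)]
        refine Real.rpow_le_rpow (abs_nonneg _) ((abs_sub _ _).trans ?_) (by linarith)
        linarith [hS.abs_V_le s]
    have i12 : IntegrableOn (fun s => |u s - g s| ^ p +
        -(χ s * clampQuot p M τ (V s - G s)) * (u s - V s)) (Ioo a b) := hug.add i2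
    have i34 : IntegrableOn (fun s => 2 * B * τ + (2 * M) ^ p * (1 - χ s)) (Ioo a b) := i3.add i4
    have i345 : IntegrableOn (fun s => 2 * B * τ + (2 * M) ^ p * (1 - χ s) +
        B / τ * (|G s - g s| * (|u s| + M))) (Ioo a b) := i34.add i5
    have hmono : ∫ s in Ioo a b, |V s - g s| ^ p ≤
        ∫ s in Ioo a b, (|u s - g s| ^ p + -(χ s * clampQuot p M τ (V s - G s)) * (u s - V s) +
          (2 * B * τ + (2 * M) ^ p * (1 - χ s) + B / τ * (|G s - g s| * (|u s| + M)))) := by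
      refine integral_mono_ae i0 (i12.add i345) ?_
      filter_upwards [hgM] with s hs
      have hVG : |V s - G s| ≤ 2 * M :=
        (abs_sub _ _).trans (by linarith [hS.abs_V_le s, hGM s])
      simp only [clampQuot_eq hVG]
      exact abs_rpow_le_add_pairing hp hM.le hτ hBτ (hχ0 s) (hχ1 s) (hS.abs_V_le s) (hGM s) hs
    refine hmono.trans ?_
    rw [integral_add i12 i345, integral_add hug i2, integral_add i34 i5, integral_add i3 i4,
      integral_const_mul ((2 * M) ^ p), integral_const_mul (B / τ), setIntegral_const, Real.volume_real_Ioo_of_le hab.le, smul_eq_mul]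
    have hMp : 0 < (2 * M) ^ p := by positivity
    have e1 : (2 * M) ^ p * ∫ s in Ioo a b, (1 - χ s) ≤ err / 3 := by
      rw [le_div_iff₀ (by positivity)] at hχi
      linarith
    have e2 : B / τ * ∫ s in Ioo a b, |G s - g s| * (|u s| + M) ≤ err / 3 := by
      have h0 : 0 ≤ ∫ s in Ioo a b, |G s - g s| * (|u s| + M) :=
        integral_nonneg fun s => by positivity
      rw [le_div_iff₀ (by positivity)] at hGi
      linarith
    linarith

@[simp] theorem vec2_apply_zero (a b : ℝ) : vec2 a b 0 = a := rfl
@[simp] theorem vec2_apply_one (a b : ℝ) : vec2 a b 1 = b := rfl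

theorem vec2_eta (x : E2) : vec2 (x 0) (x 1) = x := by
  ext i; fin_cases i <;> rfl

theorem vec2_add (a b c d : ℝ) : vec2 a b + vec2 c d = vec2 (a + c) (b + d) := by
  ext i; fin_cases i <;> rfl

theorem smul_vec2 (r a b : ℝ) : r • vec2 a b = vec2 (r * a) (r * b) := by
  ext i; fin_cases i <;> rfl

theorem inner_eq_sum_two (x y : E2) : ⟪x, y⟫ = x 0 * y 0 + x 1 * y 1 := by
  simp [PiLp.inner_apply, Fin.sum_univ_two, mul_comm]

/-- The upper profile of the Wulff shape. -/
def profile (φ : E2 → ℝ) (z : ℝ) : ℝ := sSup {y | φ (vec2 z y) ≤ 1}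

namespace IsAnisotropy
variable {φ : E2 → ℝ}

theorem e1_pos (hφ : IsAnisotropy φ) : 0 < φ e1 :=
  lt_of_le_of_ne (hφ.nonneg _) fun h => by
    have := congrArg (fun x : E2 => x 0) ((hφ.eq_zero_iff e1).1 h.symm)
    simp [e1] at this

theorem e2_pos (hφ : IsAnisotropy φ) : 0 < φ e2 :=
  lt_of_le_of_ne (hφ.nonneg _) fun h => by
    have := congrArg (fun x : E2 => x 1) ((hφ.eq_zero_iff e2).1 h.symm)
    simp [e2] at this

theorem vec2_zero_right (hφ : IsAnisotropy φ) (z : ℝ) : φ (vec2 z 0) = |z| * φ e1 := by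
  rw [← hφ.smul_eq, e1, smul_vec2, mul_one, mul_zero]

theorem vec2_zero_left (hφ : IsAnisotropy φ) (y : ℝ) : φ (vec2 0 y) = |y| * φ e2 := by
  rw [← hφ.smul_eq, e2, smul_vec2, mul_one, mul_zero]

theorem convex_comb_le (hφ : IsAnisotropy φ) {x y : E2} {s t : ℝ} (hs : 0 ≤ s) (ht : 0 ≤ t) :
    φ (s • x + t • y) ≤ s * φ x + t * φ y := by
  refine (hφ.add_le _ _).trans ?_
  rw [hφ.smul_eq, hφ.smul_eq, abs_of_nonneg hs, abs_of_nonneg ht]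

theorem le_add_right (hφ : IsAnisotropy φ) (z y y' : ℝ) :
    φ (vec2 z y) ≤ φ (vec2 z y') + |y - y'| * φ e2 := by
  rw [← hφ.vec2_zero_left]
  refine le_trans (le_of_eq ?_) (hφ.add_le _ _)
  rw [vec2_add, add_zero, add_sub_cancel]

theorem le_add_left (hφ : IsAnisotropy φ) (z z' y : ℝ) :
    φ (vec2 z y) ≤ φ (vec2 z' y) + |z - z'| * φ e1 := by
  rw [← hφ.vec2_zero_right]
  refine le_trans (le_of_eq ?_) (hφ.add_le _ _)
  rw [vec2_add, add_zero, add_sub_cancel]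

theorem vec2_neg_right (hpm : PartiallyMonotone φ) (z y : ℝ) : φ (vec2 z (-y)) = φ (vec2 z y) := by
  rw [hpm, hpm (vec2 z y)]; simp

theorem vec2_neg_left (hpm : PartiallyMonotone φ) (z y : ℝ) : φ (vec2 (-z) y) = φ (vec2 z y) := by
  rw [hpm, hpm (vec2 z y)]; simp

theorem mono_right (hφ : IsAnisotropy φ) (hpm : PartiallyMonotone φ) {z y y' : ℝ}
    (h : |y| ≤ |y'|) : φ (vec2 z y) ≤ φ (vec2 z y') := by
  rcases eq_or_ne y' 0 with rfl | h0
  · rw [abs_zero, abs_nonpos_iff] at h; rw [h]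
  have h1 : |y / y'| ≤ 1 := by
    rw [abs_div]; exact div_le_one_of_le₀ h (abs_nonneg _)
  have h2 := abs_le.1 h1
  have := hφ.convex_comb_le (x := vec2 z y') (y := vec2 z (-y')) (s := (1 + y / y') / 2)
    (t := (1 - y / y') / 2) (by linarith) (by linarith)
  rw [vec2_neg_right hpm, smul_vec2, smul_vec2, vec2_add, ← add_mul, ← add_mul] at this
  convert this using 3
  · ring
  · field_simp; ring
  · ring

theorem mono_left (hφ : IsAnisotropy φ) (hpm : PartiallyMonotone φ) {z z' y : ℝ}
    (h : |z| ≤ |z'|) : φ (vec2 z y) ≤ φ (vec2 z' y) := by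
  rcases eq_or_ne z' 0 with rfl | h0
  · rw [abs_zero, abs_nonpos_iff] at h; rw [h]
  have h1 : |z / z'| ≤ 1 := by
    rw [abs_div]; exact div_le_one_of_le₀ h (abs_nonneg _)
  have h2 := abs_le.1 h1
  have := hφ.convex_comb_le (x := vec2 z' y) (y := vec2 (-z') y) (s := (1 + z / z') / 2)
    (t := (1 - z / z') / 2) (by linarith) (by linarith)
  rw [vec2_neg_left hpm, smul_vec2, smul_vec2, vec2_add, ← add_mul, ← add_mul] at this
  convert this using 3
  · field_simp; ring
  · ring
  · ring

theorem abs_left_le (hφ : IsAnisotropy φ) (hpm : PartiallyMonotone φ) {z y : ℝ}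
    (h : φ (vec2 z y) ≤ 1) : |z| ≤ (φ e1)⁻¹ := by
  have := (hφ.mono_right hpm (z := z) (y := 0) (y' := y) (by simp)).trans h
  rwa [hφ.vec2_zero_right, ← le_div_iff₀ hφ.e1_pos, one_div] at this

theorem abs_right_le (hφ : IsAnisotropy φ) (hpm : PartiallyMonotone φ) {z y : ℝ}
    (h : φ (vec2 z y) ≤ 1) : |y| ≤ (φ e2)⁻¹ := by
  have := (hφ.mono_left hpm (z := 0) (z' := z) (y := y) (by simp)).trans h
  rwa [hφ.vec2_zero_left, ← le_div_iff₀ hφ.e2_pos, one_div] at this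

theorem bddAbove_profile (hφ : IsAnisotropy φ) (hpm : PartiallyMonotone φ) (z : ℝ) :
    BddAbove {y | φ (vec2 z y) ≤ 1} :=
  ⟨_, fun _ hy => (le_abs_self _).trans (hφ.abs_right_le hpm hy)⟩

theorem vec2_zero_le (hφ : IsAnisotropy φ) {z : ℝ} (hz : |z| ≤ (φ e1)⁻¹) : φ (vec2 z 0) ≤ 1 := by
  rwa [hφ.vec2_zero_right, ← le_div_iff₀ hφ.e1_pos, one_div]

theorem le_profile (hφ : IsAnisotropy φ) (hpm : PartiallyMonotone φ) {z y : ℝ}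
    (h : φ (vec2 z y) ≤ 1) : |y| ≤ profile φ z :=
  le_csSup (hφ.bddAbove_profile hpm z) (show φ (vec2 z |y|) ≤ 1 by
    rcases abs_choice y with hy | hy <;> rw [hy]
    exacts [h, by rwa [vec2_neg_right hpm]])

theorem vec2_profile_le (hφ : IsAnisotropy φ) {z : ℝ}
    (hz : |z| ≤ (φ e1)⁻¹) : φ (vec2 z (profile φ z)) ≤ 1 := by
  refine le_of_forall_pos_lt_add fun ε hε => ?_
  have hne : {y | φ (vec2 z y) ≤ 1}.Nonempty := ⟨0, hφ.vec2_zero_le hz⟩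
  by_cases hb : BddAbove {y | φ (vec2 z y) ≤ 1}
  · have h2 := hφ.e2_pos
    obtain ⟨y, hy, hyε⟩ := exists_lt_of_lt_csSup hne
      (show profile φ z - ε / (2 * φ e2) < profile φ z by
        have : 0 < ε / (2 * φ e2) := by positivity
        linarith)
    have hyle : y ≤ profile φ z := le_csSup hb hy
    have := hφ.le_add_right z (profile φ z) y
    have hd : |profile φ z - y| * φ e2 ≤ ε / 2 := by
      rw [abs_of_nonneg (by linarith), ← le_div_iff₀ h2, div_div]
      linarith
    have hy1 : φ (vec2 z y) ≤ 1 := hy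
    linarith
  · rw [profile, Real.sSup_of_not_bddAbove hb]
    linarith [hφ.vec2_zero_le hz]

theorem vec2_le_one (hφ : IsAnisotropy φ) (hpm : PartiallyMonotone φ) {z y : ℝ}
    (hz : |z| ≤ (φ e1)⁻¹) (hy : |y| ≤ profile φ z) : φ (vec2 z y) ≤ 1 :=
  (hφ.mono_right hpm (hy.trans (le_abs_self _))).trans (hφ.vec2_profile_le hz)

theorem isProfile (hφ : IsAnisotropy φ) (hpm : PartiallyMonotone φ) (hnv : NoVerticalFacets φ) :
    IsProfile (profile φ) (φ e1)⁻¹ where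
  pos := inv_pos.2 hφ.e1_pos
  concave := by
    refine ⟨convex_Icc _ _, fun z hz w hw s t hs ht hst => ?_⟩
    refine (le_abs_self _).trans (hφ.le_profile hpm ?_)
    simp only [smul_eq_mul]
    rw [← vec2_add, ← smul_vec2, ← smul_vec2]
    refine (hφ.convex_comb_le hs ht).trans ?_
    have h1 := mul_le_mul_of_nonneg_left (hφ.vec2_profile_le (abs_le.2 hz)) hs
    have h2 := mul_le_mul_of_nonneg_left (hφ.vec2_profile_le (abs_le.2 hw)) ht
    linarith
  even z := by simp only [profile, vec2_neg_left hpm]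
  nonneg z hz := (abs_nonneg _).trans (hφ.le_profile hpm (hφ.vec2_zero_le (abs_le.2 hz)))
  zero_pos := by
    refine lt_of_lt_of_le (inv_pos.2 hφ.e2_pos) ((le_abs_self _).trans (hφ.le_profile hpm ?_))
    rw [hφ.vec2_zero_left, abs_of_pos (inv_pos.2 hφ.e2_pos), inv_mul_cancel₀ hφ.e2_pos.ne']
  small η hη := by
    set A := (φ e1)⁻¹ with hA
    have hA0 : 0 < A := inv_pos.2 hφ.e1_pos
    have hend : ∀ y, φ (vec2 A y) ≤ 1 → y = 0 := fun y hy => by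
      have := hnv.1 (vec2 A y) hy fun x hx => by
        have hx' : |x 0| ≤ A := hφ.abs_left_le hpm (y := x 1) (by rw [vec2_eta]; exact hx)
        rw [inner_eq_sum_two]
        simp only [e1, vec2_apply_zero, vec2_apply_one, PiLp.sub_apply]
        linarith [le_abs_self (x 0)]
      have := congrArg (fun x : E2 => x 1) this
      simpa [e1] using this
    by_contra! hc
    have : φ (vec2 A η) ≤ 1 := by
      refine le_of_forall_pos_lt_add fun ε hε => ?_
      have h1 := hφ.e1_pos
      set δ := min (A / 2) (ε / (2 * φ e1))
      have hδ : 0 < δ := by positivity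
      have hδA : δ ≤ A / 2 := min_le_left _ _
      have hδε : δ * φ e1 ≤ ε / 2 := by
        rw [← le_div_iff₀ h1, div_div]; exact min_le_right _ _
      have h2 := hφ.vec2_le_one hpm (z := A - δ) (y := η)
        (by rw [abs_of_pos (by linarith)]; linarith)
        (by rw [abs_of_pos hη]; exact hc _ ⟨by linarith, by linarith⟩)
      have h3 := hφ.le_add_left A (A - δ) η
      rw [sub_sub_cancel, abs_of_pos hδ] at h3
      linarith
    exact hη.ne' (hend η this)

theorem profile_zero (hφ : IsAnisotropy φ) (hpm : PartiallyMonotone φ) :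
    profile φ 0 = (φ e2)⁻¹ := by
  refine le_antisymm ((le_abs_self _).trans (hφ.abs_right_le hpm
    (hφ.vec2_profile_le (by simpa using hφ.e1_pos.le))))
    ((le_abs_self _).trans (hφ.le_profile hpm ?_))
  rw [hφ.vec2_zero_left, abs_of_pos (inv_pos.2 hφ.e2_pos), inv_mul_cancel₀ hφ.e2_pos.ne']

end IsAnisotropy

theorem setIntegral_mul_deriv_eq_neg {a b : ℝ} (hab : a < b) {V d h h' : ℝ → ℝ}
    (hV : ∀ s, HasDerivAt V (d s) s) (hd : Continuous d) (hh : ∀ s, HasDerivAt h (h' s) s)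
    (hh' : Continuous h') (hs : tsupport h ⊆ Ioo a b) :
    ∫ s in Ioo a b, V s * h' s = -∫ s in Ioo a b, d s * h s := by
  have ha : h a = 0 := image_eq_zero_of_notMem_tsupport fun hm => lt_irrefl a (hs hm).1
  have hb : h b = 0 := image_eq_zero_of_notMem_tsupport fun hm => lt_irrefl b (hs hm).2
  have := intervalIntegral.integral_mul_deriv_eq_deriv_mul (a := a) (b := b)
    (fun s _ => hV s) (fun s _ => hh s) (hd.intervalIntegrable a b) (hh'.intervalIntegrable a b)
  rw [ha, hb, mul_zero, mul_zero, sub_zero, zero_sub, intervalIntegral.integral_of_le hab.le,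
    intervalIntegral.integral_of_le hab.le, integral_Ioc_eq_integral_Ioo,
    integral_Ioc_eq_integral_Ioo] at this
  exact this

theorem Continuous.integrableOn_Ioo' {f : ℝ → ℝ} (hf : Continuous f) (a b : ℝ) :
    IntegrableOn f (Ioo a b) :=
  hf.integrableOn_Icc.mono_set Ioo_subset_Icc_self

theorem setIntegral_const_Ioo {a b : ℝ} (hab : a < b) (c : ℝ) :
    ∫ _ in Ioo a b, c = c * (b - a) := by
  rw [setIntegral_const, Real.volume_real_Ioo_of_le hab.le, smul_eq_mul, mul_comm]

theorem IsProfile.abs_sub_le {f : ℝ → ℝ} {A z₀ z w : ℝ} (hf : IsProfile f A) (h₀ : z₀ < A)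
    (hz : |z| ≤ z₀) (hw : |w| ≤ z₀) : |f z - f w| ≤ f 0 / (A - z₀) * |z - w| := by
  rw [abs_sub_le_iff]
  refine ⟨?_, hf.sub_le h₀ hz (hw.trans h₀.le)⟩
  rw [abs_sub_comm]
  exact hf.sub_le h₀ hw (hz.trans h₀.le)

theorem IsProfile.continuous_comp {f Z : ℝ → ℝ} {A z₀ : ℝ} (hf : IsProfile f A) (h₀ : z₀ < A)
    (hZ : Continuous Z) (hZ₀ : ∀ s, |Z s| ≤ z₀) : Continuous fun s => f (Z s) := by
  have hK : 0 ≤ f 0 / (A - z₀) := div_nonneg hf.zero_pos.le (sub_pos.2 h₀).le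
  have : LipschitzOnWith ⟨_, hK⟩ f {z | |z| ≤ z₀} :=
    LipschitzOnWith.of_dist_le_mul fun z hz w hw => hf.abs_sub_le h₀ hz hw
  exact this.continuousOn.comp_continuous hZ hZ₀

theorem IsProfile.pos_of_lt {f : ℝ → ℝ} {A z : ℝ} (hf : IsProfile f A) (h₀ : 0 ≤ z) (hz : z < A) :
    0 < f z := by
  have hA := hf.pos
  have hne : f A ≥ 0 := hf.nonneg A ⟨by linarith, le_rfl⟩
  have := hf.concave.2 (x := 0) (y := A) ⟨by linarith, hA.le⟩ ⟨by linarith, le_rfl⟩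
    (show 0 ≤ 1 - z / A by rw [sub_nonneg]; exact div_le_one_of_le₀ hz.le hA.le)
    (show 0 ≤ z / A by positivity) (by ring)
  simp only [smul_eq_mul, mul_zero, zero_add, div_mul_cancel₀ z hA.ne'] at this
  have h1 : 0 < (1 - z / A) * f 0 :=
    mul_pos (by rw [sub_pos]; exact (div_lt_one hA).2 hz) hf.zero_pos
  have h2 : 0 ≤ z / A * f A := by positivity
  linarith

section
variable {φ : E2 → ℝ} {a b : ℝ}

theorem IsApproxField.aniArea_le {M z₀ B err : ℝ} {V d Z Z' : ℝ → ℝ}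
    (hV : IsApproxField (profile φ) (φ e1)⁻¹ a b M z₀ B err V d Z Z')
    (hf : IsProfile (profile φ) (φ e1)⁻¹)
    (hφ : IsAnisotropy φ) (hpm : PartiallyMonotone φ) (hab : a < b) (hz : z₀ < (φ e1)⁻¹) :
    aniArea φ V (Ioo a b) ≤
      ENNReal.ofReal ((∫ s in Ioo a b, (V s * Z' s + profile φ (Z s))) + err * (b - a)) := by
  have hZc : Continuous Z := continuous_iff_continuousAt.2 fun s => (hV.hZ s).continuousAt
  have hVc : Continuous V := continuous_iff_continuousAt.2 fun s => (hV.hV s).continuousAt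
  have hfZ := hf.continuous_comp hz hZc hV.Z_le
  have hdc := hV.d_cont
  have hZ'c := hV.Z'_cont
  refine iSup_le fun h₁ => iSup_le fun h₂ => iSup_le fun hc₁ => iSup_le fun hc₂ => iSup_le fun _ =>
    iSup_le fun _ => iSup_le fun hs₁ => iSup_le fun _ => iSup_le fun hle =>
    ENNReal.ofReal_le_ofReal ?_
  have hh₁ : ∀ s, HasDerivAt h₁ (deriv h₁ s) s := fun s =>
    (hc₁.differentiable one_ne_zero s).hasDerivAt
  have hc₁' : Continuous (deriv h₁) := hc₁.continuous_deriv le_rfl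
  have h₁c := hc₁.continuous
  have h₂c := hc₂.continuous
  have e₁ := setIntegral_mul_deriv_eq_neg hab hV.hV hdc hh₁ hc₁' hs₁
  have e₂ := setIntegral_mul_deriv_eq_neg hab hV.hV hdc hV.hZ hZ'c hV.supp
  have i₁ : IntegrableOn (fun s => V s * deriv h₁ s) (Ioo a b) := (hVc.mul hc₁').integrableOn_Ioo' a b
  have i₂ := h₂c.integrableOn_Ioo' a b
  have i₃ : IntegrableOn (fun s => V s * Z' s) (Ioo a b) := (hVc.mul hZ'c).integrableOn_Ioo' a b
  have i₄ := hfZ.integrableOn_Ioo' a b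
  have i₅ : IntegrableOn (fun s => d s * h₁ s) (Ioo a b) := (hdc.mul h₁c).integrableOn_Ioo' a b
  have i₆ : IntegrableOn (fun s => d s * Z s) (Ioo a b) := (hdc.mul hZc).integrableOn_Ioo' a b
  have i₇ := (continuous_const (y := err)).integrableOn_Ioo' a b
  have key : ∫ s in Ioo a b, h₂ s ≤
      ∫ s in Ioo a b, (((profile φ (Z s) + d s * h₁ s) - d s * Z s) + err) := by
    refine setIntegral_mono_on i₂ (((i₄.add i₅).sub i₆).add i₇) measurableSet_Ioo fun s hs => ?_
    have hs' := hle s hs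
    have := hV.slope s (h₁ s) (hφ.abs_left_le hpm hs')
    have := (le_abs_self _).trans (hφ.le_profile hpm hs')
    linarith
  rw [integral_add (by exact (i₄.add i₅).sub i₆) i₇, integral_sub (by exact i₄.add i₅) i₆,
    integral_add i₄ i₅, setIntegral_const_Ioo hab] at key
  rw [integral_add i₁ i₂, integral_add i₃ i₄]
  linarith

theorem ofReal_integral_le_aniArea (hf : IsProfile (profile φ) (φ e1)⁻¹)
    (hφ : IsAnisotropy φ) (hpm : PartiallyMonotone φ) (hab : a < b) {u h : ℝ → ℝ} {z : ℝ}
    (hu : IntegrableOn u (Ioo a b)) (hh : ContDiff ℝ 1 h) (hhc : HasCompactSupport h)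
    (hs : tsupport h ⊆ Ioo a b) (hz : z < (φ e1)⁻¹) (hhz : ∀ s, |h s| ≤ z) :
    ENNReal.ofReal (∫ s in Ioo a b, (u s * deriv h s + profile φ (h s))) ≤
      aniArea φ u (Ioo a b) := by
  have hq := hf.continuous_comp hz hh.continuous hhz
  have hz0 : 0 ≤ z := (abs_nonneg _).trans (hhz 0)
  have hfz := hf.pos_of_lt hz0 hz
  have hf0 := hf.zero_pos
  have hint : IntegrableOn (fun s => u s * deriv h s) (Ioo a b) := by
    obtain ⟨C, hC⟩ := (hh.continuous_deriv le_rfl).bounded_above_of_compact_support hhc.deriv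
    exact Integrable.mul_bdd hu (hh.continuous_deriv le_rfl).aestronglyMeasurable
      (Eventually.of_forall hC)
  refine ENNReal.le_of_forall_pos_le_add fun η hη _ => ?_
  set ε : ℝ := min (profile φ z / 2) (η / (2 * (b - a) + profile φ 0)) with hε
  have hden : 0 < 2 * (b - a) + profile φ 0 := by linarith
  have hε0 : 0 < ε := lt_min (by linarith) (div_pos hη hden)
  have hε1 : 2 * ε ≤ profile φ z := by linarith [min_le_left (profile φ z / 2) (η / (2 * (b - a) + profile φ 0))]
  have hε2 : ε * (2 * (b - a) + profile φ 0) ≤ η := by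
    rw [← le_div_iff₀ hden]; exact min_le_right _ _
  obtain ⟨P, hP⟩ := exists_polynomial_near_of_continuousOn a b _ hq.continuousOn ε hε0
  obtain ⟨a', b', θ, ha', hab', hb', hθd, hθ1, hθpos, hθ0, hθint⟩ := exists_cutoff hab hε0
  have hθ0' : ∀ s, 0 ≤ θ s := fun s => by
    by_cases hs : s ∈ Ioo a' b'
    exacts [(hθpos s hs).le, (hθ0 s hs).ge]
  set h₂ : ℝ → ℝ := fun s => θ s * (P.eval s - ε) with hh₂
  have hPd : ContDiff ℝ 1 fun s => P.eval s - ε := by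
    refine ContDiff.sub ?_ contDiff_const
    simpa only [Polynomial.coe_aeval_eq_eval] using P.contDiff_aeval (𝕜 := ℝ) 1
  have hh₂d : ContDiff ℝ 1 h₂ := hθd.mul hPd
  have hsub : tsupport h₂ ⊆ Icc a' b' := by
    refine closure_minimal (fun s hs => ?_) isClosed_Icc
    by_contra hc
    exact hs (by simp [hh₂, hθ0 s fun h => hc (Ioo_subset_Icc_self h)])
  have hq_lo : ∀ s, profile φ z ≤ profile φ (h s) := fun s =>
    hf.le_of_abs_le (by rw [abs_of_nonneg hz0]; exact hhz s) (by rw [abs_of_nonneg hz0]; exact hz.le)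
  have hq_hi : ∀ s, profile φ (h s) ≤ profile φ 0 := fun s =>
    hf.le_of_abs_le (by simp) ((hhz s).trans hz.le)
  have hPq : ∀ s ∈ Ioo a b, |P.eval s - profile φ (h s)| < ε := fun s hs =>
    hP s (Ioo_subset_Icc_self hs)
  have i₁ := hq.integrableOn_Ioo' a b
  have i₂ := hh₂d.continuous.integrableOn_Ioo' a b
  have i₃ := (continuous_const (y := 2 * ε)).integrableOn_Ioo' a b
  have i₄ := ((continuous_const (y := (1:ℝ))).sub hθd.continuous).integrableOn_Ioo' a b
  have i₅ : IntegrableOn (fun s => profile φ 0 * (1 - θ s)) (Ioo a b) := i₄.const_mul _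
  have key : ∫ s in Ioo a b, profile φ (h s) ≤
      ∫ s in Ioo a b, ((h₂ s + 2 * ε) + profile φ 0 * (1 - θ s)) := by
    refine setIntegral_mono_on i₁ ((i₂.add i₃).add i₅) measurableSet_Ioo fun s hs => ?_
    have h1 := abs_lt.1 (hPq s hs)
    have h2 := mul_le_mul_of_nonneg_right (show P.eval s - ε ≤ profile φ 0 by
      linarith [hq_hi s]) (sub_nonneg.2 (hθ1 s))
    simp only [hh₂]
    nlinarith
  rw [integral_add (by exact i₂.add i₃) i₅, integral_add i₂ i₃, setIntegral_const_Ioo hab,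
    integral_const_mul] at key
  have h5 := mul_le_mul_of_nonneg_left hθint hf0.le
  have hle : ∫ s in Ioo a b, (u s * deriv h s + profile φ (h s)) ≤
      (∫ s in Ioo a b, (u s * deriv h s + h₂ s)) + η := by
    rw [integral_add hint i₁, integral_add hint i₂]
    linarith
  refine (ENNReal.ofReal_le_ofReal hle).trans (ENNReal.ofReal_add_le.trans ?_)
  refine add_le_add ?_ (by rw [ENNReal.ofReal_coe_nnreal])
  refine le_iSup_of_le h <| le_iSup_of_le h₂ <| le_iSup_of_le hh <| le_iSup_of_le hh₂d <|
    le_iSup_of_le hhc <| le_iSup_of_le (isCompact_Icc.of_isClosed_subset (isClosed_tsupport _) hsub) <|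
    le_iSup_of_le hs <| le_iSup_of_le (hsub.trans (Icc_subset_Ioo ha' hb')) <|
    le_iSup_of_le (fun s hs => ?_) le_rfl
  refine hφ.vec2_le_one hpm ((hhz s).trans hz.le) ?_
  have h1 := abs_lt.1 (hPq s hs)
  have h2 : 0 ≤ P.eval s - ε := by linarith [hq_lo s]
  rw [abs_of_nonneg (mul_nonneg (hθ0' s) h2)]
  have := mul_le_of_le_one_left h2 (hθ1 s)
  linarith

end

/-- `Z` is an admissible field on `(a, b)` which calibrates `u` up to `err`. -/
structure IsAlmostCalibration (f : ℝ → ℝ) (A a b z₀ B err : ℝ) (u Z Z' : ℝ → ℝ) : Prop where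
  hZ : ∀ s, HasDerivAt Z (Z' s) s
  Z'_cont : Continuous Z'
  Z_le : ∀ s, |Z s| ≤ z₀
  Z'_le : ∀ s, |Z' s| ≤ B
  compact : HasCompactSupport Z
  supp : tsupport Z ⊆ Ioo a b
  le : ∀ (h : ℝ → ℝ) (z : ℝ), ContDiff ℝ 1 h → HasCompactSupport h → tsupport h ⊆ Ioo a b →
    z < A → (∀ s, |h s| ≤ z) → ∫ s in Ioo a b, (u s * deriv h s + f (h s)) ≤
      (∫ s in Ioo a b, (u s * Z' s + f (Z s))) + err

theorem aniArea_zero_lt_top {φ : E2 → ℝ} {a b : ℝ} (hab : a < b) (hφ : IsAnisotropy φ)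
    (hpm : PartiallyMonotone φ) : aniArea φ (fun _ => 0) (Ioo a b) < ⊤ := by
  refine lt_of_le_of_lt (b := ENNReal.ofReal ((φ e2)⁻¹ * (b - a))) ?_ ENNReal.ofReal_lt_top
  refine iSup_le fun h₁ => iSup_le fun h₂ => iSup_le fun _ => iSup_le fun hc₂ => iSup_le fun _ =>
    iSup_le fun _ => iSup_le fun _ => iSup_le fun _ => iSup_le fun hle =>
    ENNReal.ofReal_le_ofReal ?_
  rw [← setIntegral_const_Ioo hab]
  simp only [zero_mul, zero_add]
  exact setIntegral_mono_on (hc₂.continuous.integrableOn_Ioo' a b)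
    (continuous_const.integrableOn_Ioo' a b) measurableSet_Ioo fun s hs =>
      (le_abs_self _).trans (hφ.abs_right_le hpm (hle s hs))

theorem lintegral_ofReal_abs_rpow_lt_top {a b p M : ℝ} {v g : ℝ → ℝ} (hp : 1 ≤ p)
    (h : ∀ᵐ s ∂volume.restrict (Ioo a b), |v s - g s| ≤ M) :
    ∫⁻ s in Ioo a b, ENNReal.ofReal (|v s - g s| ^ p) < ⊤ := by
  refine lt_of_le_of_lt (lintegral_mono_ae (g := fun _ => ENNReal.ofReal (M ^ p)) ?_) ?_
  · filter_upwards [h] with s hs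
    exact ENNReal.ofReal_le_ofReal (Real.rpow_le_rpow (abs_nonneg _) hs (by linarith))
  · rw [setLIntegral_const]
    exact ENNReal.mul_lt_top ENNReal.ofReal_lt_top (by simp)

theorem IsMinimizerG.exists_almostCalibration {φ : E2 → ℝ} {a b p M : ℝ} {g u : ℝ → ℝ}
    (hf : IsProfile (profile φ) (φ e1)⁻¹) (hφ : IsAnisotropy φ) (hpm : PartiallyMonotone φ)
    (hab : a < b) (hp : 1 ≤ p) (hM : 0 < M) (hsmall : p * (2 * M) ^ p < profile φ 0)
    (hg : AEStronglyMeasurable g (volume.restrict (Ioo a b)))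
    (hgM : ∀ᵐ s ∂volume.restrict (Ioo a b), |g s| ≤ M)
    (hu : IsMinimizerG φ p g (Ioo a b) u) :
    ∃ z₀ ∈ Ioo 0 (φ e1)⁻¹, ∃ B : ℝ, ∀ err > 0, ∃ Z Z' : ℝ → ℝ,
      IsAlmostCalibration (profile φ) (φ e1)⁻¹ a b z₀ B err u Z Z' := by
  obtain ⟨z₀, hz₀, B, H⟩ := hf.exists_approxField hab hp hM hsmall
  refine ⟨z₀, hz₀, B, fun err herr => ?_⟩
  obtain ⟨huI, hmin⟩ := hu
  have hba : 0 < b - a := sub_pos.2 hab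
  have hmeas : ∀ v : ℝ → ℝ, IntegrableOn v (Ioo a b) →
      AEStronglyMeasurable (fun s => |v s - g s| ^ p) (volume.restrict (Ioo a b)) := fun v hv =>
    ((hv.aestronglyMeasurable.sub hg).norm.aemeasurable.pow_const p).aestronglyMeasurable
  have hpos : ∀ v : ℝ → ℝ, 0 ≤ᵐ[volume.restrict (Ioo a b)] fun s => |v s - g s| ^ p :=
    fun v => Eventually.of_forall fun s => by positivity
  have hG : Gfun φ p g (Ioo a b) u < ⊤ := by
    refine (hmin (fun _ => 0) integrableOn_zero).trans_lt (ENNReal.add_lt_top.2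
      ⟨aniArea_zero_lt_top hab hφ hpm, lintegral_ofReal_abs_rpow_lt_top (M := M) hp ?_⟩)
    filter_upwards [hgM] with s hs
    simpa using hs
  have hug : IntegrableOn (fun s => |u s - g s| ^ p) (Ioo a b) :=
    (lintegral_ofReal_ne_top_iff_integrable (hmeas u huI) (hpos u)).1
      (ENNReal.add_lt_top.1 hG).2.ne
  set e := err / (b - a + 1) with he
  have he0 : 0 < e := by positivity
  obtain ⟨V, d, Z, Z', hV, hVle⟩ := H g u hg hgM huI hug e he0
  refine ⟨Z, Z', hV.hZ, hV.Z'_cont, hV.Z_le, hV.Z'_le, hV.compact, hV.supp,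
    fun h z hh hhc hhs hz hhz => ?_⟩
  have hZc : Continuous Z := continuous_iff_continuousAt.2 fun s => (hV.hZ s).continuousAt
  have hVc : Continuous V := continuous_iff_continuousAt.2 fun s => (hV.hV s).continuousAt
  have hfZ := hf.continuous_comp hz₀.2 hZc hV.Z_le
  have i₁ := hfZ.integrableOn_Ioo' a b
  have i₂ : IntegrableOn (fun s => d s * Z s) (Ioo a b) :=
    (hV.d_cont.mul hZc).integrableOn_Ioo' a b
  have i₃ : IntegrableOn (fun s => V s * Z' s) (Ioo a b) :=
    (hVc.mul hV.Z'_cont).integrableOn_Ioo' a b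
  have i₄ := (continuous_const (y := e)).integrableOn_Ioo' a b
  have i₅ : IntegrableOn (fun s => u s * Z' s) (Ioo a b) :=
    Integrable.mul_bdd huI hV.Z'_cont.aestronglyMeasurable (Eventually.of_forall hV.Z'_le)
  have hVI := hVc.integrableOn_Ioo' a b
  have hVg : IntegrableOn (fun s => |V s - g s| ^ p) (Ioo a b) := by
    refine (lintegral_ofReal_ne_top_iff_integrable (hmeas V hVI) (hpos V)).1
      (lintegral_ofReal_abs_rpow_lt_top (M := M + M) hp ?_).ne
    filter_upwards [hgM] with s hs
    exact (abs_sub _ _).trans (add_le_add (hV.V_le s) hs)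
  have hα : 0 ≤ (∫ s in Ioo a b, (V s * Z' s + profile φ (Z s))) + e * (b - a) := by
    have h1 : ∫ _ in Ioo a b, (0:ℝ) ≤ ∫ s in Ioo a b, ((profile φ (Z s) - d s * Z s) + e) := by
      refine setIntegral_mono_on integrableOn_zero ((i₁.sub i₂).add i₄) measurableSet_Ioo
        fun s _ => ?_
      have := hV.slope s 0 (by simpa using hf.pos.le)
      linarith [hf.zero_pos]
    rw [integral_zero, integral_add (by exact i₁.sub i₂) i₄, integral_sub i₁ i₂,
      setIntegral_const_Ioo hab] at h1
    rw [integral_add i₃ i₁, setIntegral_mul_deriv_eq_neg hab hV.hV hV.d_cont hV.hZ hV.Z'_cont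
      hV.supp]
    linarith
  have hcmp := hmin V hVI
  have hlow := ofReal_integral_le_aniArea hf hφ hpm hab huI hh hhc hhs hz hhz
  have hup := hV.aniArea_le hf hφ hpm hab hz₀.2
  have hcmp' : ENNReal.ofReal ((∫ s in Ioo a b, (u s * deriv h s + profile φ (h s))) +
      ∫ s in Ioo a b, |u s - g s| ^ p) ≤
      ENNReal.ofReal ((∫ s in Ioo a b, (V s * Z' s + profile φ (Z s))) + e * (b - a) +
        ∫ s in Ioo a b, |V s - g s| ^ p) := by
    rw [ENNReal.ofReal_add hα (integral_nonneg fun s => by positivity)]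
    refine ENNReal.ofReal_add_le.trans ?_
    rw [ofReal_integral_eq_lintegral_ofReal hug (hpos u),
      ofReal_integral_eq_lintegral_ofReal hVg (hpos V)]
    exact (add_le_add_left hlow _).trans (hcmp.trans (add_le_add_left hup _))
  rw [ENNReal.ofReal_le_ofReal_iff
    (add_nonneg hα (integral_nonneg fun s => by positivity))] at hcmp'
  have hZ'u : ∫ s in Ioo a b, Z' s * (u s - V s) =
      (∫ s in Ioo a b, u s * Z' s) - ∫ s in Ioo a b, V s * Z' s := by
    rw [← integral_sub i₅ i₃]
    exact integral_congr_ae (Eventually.of_forall fun s => by ring)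
  have heq : e * (b - a + 1) = err := div_mul_cancel₀ _ (by linarith)
  rw [integral_add i₃ i₁] at hcmp'
  rw [integral_add i₅ i₁]
  linarith

open scoped ContDiff in
/-- The smooth bump `t ↦ ∫ s in (x - t)..(y - t), ρ s` for a mollifier `ρ`. -/
theorem exists_mollified_indicator (ρ : ContDiffBump (0 : ℝ)) {x y : ℝ} (hxy : x ≤ y) :
    ∃ η : ℝ → ℝ, ContDiff ℝ ∞ η ∧
      (∀ t, HasDerivAt η (ρ.normed volume (x - t) - ρ.normed volume (y - t)) t) ∧
      tsupport η ⊆ Icc (x - ρ.rOut) (y + ρ.rOut) ∧ ∀ t, |η t| ≤ 1 := by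
  set f : ℝ → ℝ := ρ.normed volume with hf
  have hfc : ContDiff ℝ ∞ f := ρ.contDiff_normed
  have hfi : ∀ c d, IntervalIntegrable f volume c d := fun c d => hfc.continuous.intervalIntegrable c d
  have hR : ∀ w, HasDerivAt (fun w => ∫ s in (0:ℝ)..w, f s) (f w) w := fun w =>
    (hfc.continuous.integral_hasStrictDerivAt 0 w).hasDerivAt
  set η : ℝ → ℝ := fun t => (∫ s in (0:ℝ)..(y - t), f s) - ∫ s in (0:ℝ)..(x - t), f s with hη
  have hη' : ∀ t, HasDerivAt η (f (x - t) - f (y - t)) t := fun t => by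
    have h1 : HasDerivAt (fun t => ∫ s in (0:ℝ)..(y - t), f s) (-f (y - t)) t := by
      simpa using (hR (y - t)).comp_const_sub y t
    have h2 : HasDerivAt (fun t => ∫ s in (0:ℝ)..(x - t), f s) (-f (x - t)) t := by
      simpa using (hR (x - t)).comp_const_sub x t
    exact (h1.sub h2).congr_deriv (by ring)
  have hη_eq : ∀ t, η t = ∫ s in (x - t)..(y - t), f s := fun t =>
    intervalIntegral.integral_interval_sub_left (hfi _ _) (hfi _ _)
  refine ⟨η, ?_, hη', ?_, fun t => ?_⟩
  · refine contDiff_infty_iff_deriv.2 ⟨fun t => (hη' t).differentiableAt, ?_⟩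
    rw [show deriv η = fun t => f (x - t) - f (y - t) from funext fun t => (hη' t).deriv]
    exact (hfc.comp (contDiff_const.sub contDiff_id)).sub (hfc.comp (contDiff_const.sub contDiff_id))
  · refine closure_minimal (fun t ht => ?_) isClosed_Icc
    by_contra hc
    refine ht ?_
    rw [hη_eq]
    refine intervalIntegral.integral_zero_ae (Eventually.of_forall fun s hs => ?_)
    rw [uIoc_of_le (by linarith)] at hs
    have : s ∉ Function.support f := by
      rw [hf, ρ.support_normed_eq, Real.ball_eq_Ioo]
      rintro ⟨h1, h2⟩
      exact hc ⟨by linarith [hs.1], by linarith [hs.2]⟩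
    exact Function.notMem_support.1 this
  · have hint : ∫ s, f s = 1 := ρ.integral_normed
    have hnn : ∀ s, 0 ≤ f s := fun s => ρ.nonneg_normed s
    rw [hη_eq, intervalIntegral.integral_of_le (by linarith), abs_of_nonneg
      (setIntegral_nonneg measurableSet_Ioc fun s _ => hnn s), ← hint]
    exact setIntegral_le_integral ρ.integrable_normed (Eventually.of_forall hnn)

open scoped ContDiff Convolution in
/-- An integrable function whose distributional derivative is bounded by `K` has a `K`-Lipschitz
representative. -/
theorem exists_lipschitzWith_of_integral_mul_deriv_le {u : ℝ → ℝ} {a b : ℝ} {K : ℝ≥0}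
    (hu : IntegrableOn u (Ioo a b))
    (H : ∀ η : ℝ → ℝ, ContDiff ℝ ∞ η → HasCompactSupport η → tsupport η ⊆ Ioo a b →
      ∫ s in Ioo a b, u s * deriv η s ≤ K * ∫ s in Ioo a b, |η s|) :
    ∃ v : ℝ → ℝ, LipschitzWith K v ∧ ∀ᵐ s ∂volume.restrict (Ioo a b), u s = v s := by
  set U : ℝ → ℝ := (Ioo a b).indicator u with hU
  have hUi : Integrable U := hu.integrable_indicator measurableSet_Ioo
  let ρ : ℕ → ContDiffBump (0 : ℝ) := fun n =>
    { rIn := 1 / (n + 1), rOut := 2 / (n + 1)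
      rIn_pos := by positivity, rIn_lt_rOut := by gcongr; norm_num }
  have hr : Tendsto (fun n => (ρ n).rOut) atTop (𝓝 0) := by
    have := (tendsto_one_div_add_atTop_nhds_zero_nat (𝕜 := ℝ)).const_mul 2
    rw [mul_zero] at this
    exact this.congr fun n => by simp only [ρ]; ring
  have hae := ContDiffBump.ae_convolution_tendsto_right_of_locallyIntegrable (μ := volume) (K := 2)
    hr (Eventually.of_forall fun n => by simp only [ρ]; apply le_of_eq; ring) hUi.locallyIntegrable
  have hconv : ∀ n x, ((ρ n).normed volume ⋆[ContinuousLinearMap.lsmul ℝ ℝ, volume] U) x =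
      ∫ t in Ioo a b, u t * (ρ n).normed volume (x - t) := fun n x => by
    rw [convolution_lsmul_swap, ← integral_indicator measurableSet_Ioo]
    refine integral_congr_ae (Eventually.of_forall fun t => ?_)
    by_cases ht : t ∈ Ioo a b <;> simp [hU, ht, mul_comm]
  have hint : ∀ n x, IntegrableOn (fun t => u t * (ρ n).normed volume (x - t)) (Ioo a b) := by
    intro n x
    obtain ⟨C, hC⟩ := (ρ n).continuous_normed.bounded_above_of_compact_support
      ((ρ n).hasCompactSupport_normed (μ := volume))
    exact Integrable.mul_bdd hu ((ρ n).continuous_normed.comp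
      (continuous_const.sub continuous_id)).aestronglyMeasurable (Eventually.of_forall fun t => hC _)
  set S : Set ℝ := {x | x ∈ Ioo a b ∧ Tendsto (fun n =>
    ((ρ n).normed volume ⋆[ContinuousLinearMap.lsmul ℝ ℝ, volume] U) x) atTop (𝓝 (U x))} with hS
  have hkey : ∀ x ∈ S, ∀ y ∈ S, x ≤ y → |U x - U y| ≤ K * (y - x) := by
    rintro x ⟨hx, hxt⟩ y ⟨hy, hyt⟩ hxy
    have hlim : Tendsto (fun n => (K:ℝ) * (y - x + 2 * (ρ n).rOut)) atTop (𝓝 (K * (y - x))) := by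
      simpa using ((hr.const_mul 2).const_add (y - x)).const_mul (K:ℝ)
    refine le_of_tendsto_of_tendsto (hxt.sub hyt).abs hlim ?_
    have hev : ∀ᶠ n in atTop, (ρ n).rOut < min (x - a) (b - y) :=
      hr.eventually_lt_const (lt_min (by linarith [hx.1]) (by linarith [hy.2]))
    filter_upwards [hev] with n hn
    obtain ⟨hn1, hn2⟩ := lt_min_iff.1 hn
    obtain ⟨η, hηd, hη', hηs, hη1⟩ := exists_mollified_indicator (ρ n) hxy
    have hr0 := (ρ n).rOut_pos
    have hηc : HasCompactSupport η := isCompact_Icc.of_isClosed_subset (isClosed_tsupport _) hηs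
    have hηI : tsupport η ⊆ Ioo a b := hηs.trans (Icc_subset_Ioo (by linarith) (by linarith))
    have hval : ∫ s in Ioo a b, u s * deriv η s =
        (∫ t in Ioo a b, u t * (ρ n).normed volume (x - t)) -
          ∫ t in Ioo a b, u t * (ρ n).normed volume (y - t) := by
      rw [← integral_sub (hint n x) (hint n y)]
      refine integral_congr_ae (Eventually.of_forall fun t => ?_)
      simp only [(hη' t).deriv]
      ring
    have hL1 : ∫ s in Ioo a b, |η s| ≤ y - x + 2 * (ρ n).rOut := by
      have h1 : ∫ s in Ioo a b, |η s| ≤ ∫ s, |η s| :=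
        setIntegral_le_integral (hηd.continuous.abs.integrable_of_hasCompactSupport
          (hηc.comp_left (g := fun z : ℝ => |z|) abs_zero)) (Eventually.of_forall fun _ => abs_nonneg _)
      have h2 : ∫ s in Icc (x - (ρ n).rOut) (y + (ρ n).rOut), |η s| = ∫ s, |η s| :=
        setIntegral_eq_integral_of_forall_compl_eq_zero fun s hs => by
          rw [image_eq_zero_of_notMem_tsupport fun h => hs (hηs h), abs_zero]
      have h3 : ∫ s in Icc (x - (ρ n).rOut) (y + (ρ n).rOut), |η s| ≤
          ∫ _ in Icc (x - (ρ n).rOut) (y + (ρ n).rOut), (1:ℝ) :=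
        setIntegral_mono_on hηd.continuous.abs.integrableOn_Icc (integrableOn_const (by simp))
          measurableSet_Icc fun s _ => hη1 s
      rw [setIntegral_const, Real.volume_real_Icc_of_le (by linarith), smul_eq_mul, mul_one] at h3
      linarith
    have hK := mul_le_mul_of_nonneg_left hL1 K.coe_nonneg
    have hp := H η hηd hηc hηI
    have hm := H (fun s => -η s) hηd.neg (hηc.comp_left (g := fun z : ℝ => -z) neg_zero)
      ((tsupport_comp_subset (g := fun z : ℝ => -z) neg_zero η).trans hηI)
    simp only [deriv.fun_neg, mul_neg, integral_neg, abs_neg] at hm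
    rw [hconv, hconv, abs_le]
    constructor <;> linarith
  have hlip : LipschitzOnWith K U S := LipschitzOnWith.of_dist_le_mul fun x hx y hy => by
    rw [Real.dist_eq, Real.dist_eq]
    rcases le_total x y with h | h
    · rw [abs_sub_comm x y, abs_of_nonneg (sub_nonneg.2 h)]
      exact hkey x hx y hy h
    · rw [abs_sub_comm, abs_of_nonneg (sub_nonneg.2 h)]
      exact hkey y hy x hx h
  obtain ⟨v, hv, hvU⟩ := hlip.extend_real
  refine ⟨v, hv, ?_⟩
  filter_upwards [ae_restrict_of_ae hae, ae_restrict_mem measurableSet_Ioo] with s hs hsI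
  rw [← hvU ⟨hsI, hs⟩, hU, indicator_of_mem hsI]

section
open scoped ContDiff

theorem exists_abs_le_of_hasCompactSupport {η : ℝ → ℝ} (hη : Continuous η)
    (hηc : HasCompactSupport η) : ∃ C > 0, ∀ s, |η s| ≤ C := by
  obtain ⟨C, hC⟩ := hη.bounded_above_of_compact_support hηc
  exact ⟨max C 1, by positivity, fun s => (hC s).trans (le_max_left _ _)⟩

namespace IsAlmostCalibration
variable {f : ℝ → ℝ} {A a b z₀ B err : ℝ} {u Z Z' : ℝ → ℝ}

theorem contDiff (h : IsAlmostCalibration f A a b z₀ B err u Z Z') : ContDiff ℝ 1 Z := by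
  rw [contDiff_one_iff_deriv]
  exact ⟨fun s => (h.hZ s).differentiableAt, by
    rw [show deriv Z = Z' from funext fun s => (h.hZ s).deriv]; exact h.Z'_cont⟩

/-- The first variation inequality for the perturbation `Z + t η`. -/
theorem mul_integral_le (h : IsAlmostCalibration f A a b z₀ B err u Z Z') (hf : IsProfile f A)
    (h₀ : z₀ < A) (hu : IntegrableOn u (Ioo a b)) {η : ℝ → ℝ} (hη : ContDiff ℝ 1 η)
    (hηc : HasCompactSupport η) (hηs : tsupport η ⊆ Ioo a b) {C t : ℝ} (hC : ∀ s, |η s| ≤ C)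
    (ht : 0 ≤ t) (htC : t * C ≤ (A - z₀) / 2) :
    t * ∫ s in Ioo a b, u s * deriv η s ≤
      (∫ s in Ioo a b, (f (Z s) - f (Z s + t * η s))) + err := by
  have hbd : ∀ s, |Z s + t * η s| ≤ (A + z₀) / 2 := fun s => by
    refine (abs_add_le _ _).trans ?_
    rw [abs_mul, abs_of_nonneg ht]
    linarith [h.Z_le s, mul_le_mul_of_nonneg_left (hC s) ht]
  have hη' := hη.continuous_deriv le_rfl
  have hder : ∀ s, HasDerivAt (fun s => Z s + t * η s) (Z' s + t * deriv η s) s := fun s =>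
    (h.hZ s).add (((hη.differentiable one_ne_zero s).hasDerivAt).const_mul t)
  have hP : ContDiff ℝ 1 fun s => Z s + t * η s := h.contDiff.add (contDiff_const.mul hη)
  have hsub : Function.support (fun s => Z s + t * η s) ⊆ tsupport Z ∪ tsupport η := fun s hs => by
    by_contra hc
    rw [mem_union, not_or] at hc
    exact hs (by simp [image_eq_zero_of_notMem_tsupport hc.1, image_eq_zero_of_notMem_tsupport hc.2])
  have hts : tsupport (fun s => Z s + t * η s) ⊆ tsupport Z ∪ tsupport η :=
    closure_minimal hsub ((isClosed_tsupport _).union (isClosed_tsupport _))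
  have key := h.le _ ((A + z₀) / 2) hP
    ((h.compact.isCompact.union hηc.isCompact).of_isClosed_subset (isClosed_tsupport _) hts)
    (hts.trans (union_subset h.supp hηs)) (by linarith) hbd
  have i₁ : IntegrableOn (fun s => u s * Z' s) (Ioo a b) :=
    Integrable.mul_bdd hu h.Z'_cont.aestronglyMeasurable (Eventually.of_forall h.Z'_le)
  have i₂ : IntegrableOn (fun s => u s * deriv η s) (Ioo a b) := by
    obtain ⟨C', hC'⟩ := hη'.bounded_above_of_compact_support hηc.deriv
    exact Integrable.mul_bdd hu hη'.aestronglyMeasurable (Eventually.of_forall hC')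
  have i₃ := (hf.continuous_comp h₀ h.contDiff.continuous h.Z_le).integrableOn_Ioo' a b
  have i₄ := (hf.continuous_comp (by linarith) hP.continuous hbd).integrableOn_Ioo' a b
  have e₁ : ∫ s in Ioo a b, (u s * deriv (fun s => Z s + t * η s) s + f (Z s + t * η s)) =
      ∫ s in Ioo a b, ((u s * Z' s + t * (u s * deriv η s)) + f (Z s + t * η s)) :=
    integral_congr_ae (Eventually.of_forall fun s => by simp only [(hder s).deriv]; ring)
  rw [e₁, integral_add (by exact i₁.add (i₂.const_mul t)) i₄, integral_add i₁ (i₂.const_mul t),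
    integral_const_mul, integral_add i₁ i₃] at key
  rw [integral_sub i₃ i₄]
  linarith

end IsAlmostCalibration

theorem exists_pos_mul_le {C c : ℝ} (hC : 0 < C) (hc : 0 < c) : ∃ t > 0, t * C ≤ c :=
  ⟨c / C, div_pos hc hC, (div_mul_cancel₀ c hC.ne').le⟩

section
variable {f : ℝ → ℝ} {A a b z₀ B : ℝ} {u : ℝ → ℝ}

theorem exists_lipschitzWith_of_almostCalibration (hf : IsProfile f A) (h₀ : z₀ < A)
    (hu : IntegrableOn u (Ioo a b))
    (H : ∀ err > 0, ∃ Z Z' : ℝ → ℝ, IsAlmostCalibration f A a b z₀ B err u Z Z') :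
    ∃ (K : ℝ≥0) (v : ℝ → ℝ), LipschitzWith K v ∧ ∀ᵐ s ∂volume.restrict (Ioo a b), u s = v s := by
  set K : ℝ := f 0 / (A - (A + z₀) / 2) with hK
  have hK0 : 0 ≤ K := div_nonneg hf.zero_pos.le (by linarith)
  refine ⟨⟨K, hK0⟩, exists_lipschitzWith_of_integral_mul_deriv_le hu fun η hη hηc hηs => ?_⟩
  have hη1 : ContDiff ℝ 1 η := hη.of_le (by simp)
  obtain ⟨C, hC0, hC⟩ := exists_abs_le_of_hasCompactSupport hη.continuous hηc
  obtain ⟨t, ht, htC⟩ := exists_pos_mul_le hC0 (show 0 < (A - z₀) / 2 by linarith)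
  change _ ≤ K * _
  refine le_of_mul_le_mul_left (le_of_forall_pos_le_add fun err herr => ?_) ht
  obtain ⟨Z, Z', hZ⟩ := H err herr
  refine (hZ.mul_integral_le hf h₀ hu hη1 hηc hηs hC ht.le htC).trans (add_le_add_left ?_ err)
  have hbd : ∀ s, |Z s + t * η s| ≤ (A + z₀) / 2 := fun s => by
    refine (abs_add_le _ _).trans ?_
    rw [abs_mul, abs_of_nonneg ht.le]
    linarith [hZ.Z_le s, mul_le_mul_of_nonneg_left (hC s) ht.le]
  have hP : ContDiff ℝ 1 fun s => Z s + t * η s := hZ.contDiff.add (contDiff_const.mul hη1)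
  have i₃ := (hf.continuous_comp h₀ hZ.contDiff.continuous hZ.Z_le).integrableOn_Ioo' a b
  have i₄ := (hf.continuous_comp (by linarith) hP.continuous hbd).integrableOn_Ioo' a b
  rw [← integral_const_mul, ← integral_const_mul]
  refine setIntegral_mono_on (i₃.sub i₄)
    (((hη.continuous.abs.integrableOn_Ioo' a b).const_mul K).const_mul t) measurableSet_Ioo
    fun s _ => ?_
  have := hf.abs_sub_le (z₀ := (A + z₀) / 2) (by linarith) ((hZ.Z_le s).trans (by linarith)) (hbd s)
  refine (le_abs_self _).trans (this.trans (le_of_eq ?_))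
  rw [sub_add_cancel_left, abs_neg, abs_mul, abs_of_nonneg ht.le]
  ring

theorem exists_taylor_bound {f : ℝ → ℝ} {A z : ℝ} (hf : ContDiffOn ℝ 2 f (Ioo (-A) A))
    (hz : z < A) : ∃ C : ℝ, 0 ≤ C ∧ (∀ x, |x| ≤ z → |deriv (deriv f) x| ≤ C) ∧
      ∀ x y, |x| ≤ z → |y| ≤ z → f x - f y ≤ deriv f x * (x - y) + C * (x - y) ^ 2 := by
  have hd : ContDiffOn ℝ 1 (deriv f) (Ioo (-A) A) := hf.deriv_of_isOpen isOpen_Ioo (by norm_num)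
  have hsub : Icc (-z) z ⊆ Ioo (-A) A := Icc_subset_Ioo (by linarith) hz
  have hc : ContinuousOn (deriv (deriv f)) (Icc (-z) z) :=
    (hd.continuousOn_deriv_of_isOpen isOpen_Ioo le_rfl).mono hsub
  have hdf : ∀ x ∈ Icc (-z) z, HasDerivAt f (deriv f x) x := fun x hx =>
    ((hf.contDiffAt (isOpen_Ioo.mem_nhds (hsub hx))).differentiableAt (by norm_num)).hasDerivAt
  have hddf : ∀ x ∈ Icc (-z) z, HasDerivAt (deriv f) (deriv (deriv f) x) x := fun x hx =>
    ((hd.contDiffAt (isOpen_Ioo.mem_nhds (hsub hx))).differentiableAt (by norm_num)).hasDerivAt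
  obtain ⟨C, hC⟩ := isCompact_Icc.exists_bound_of_continuousOn hc
  refine ⟨max C 0, le_max_right _ _, fun x hx => (hC x (abs_le.1 hx)).trans (le_max_left _ _),
    fun x y hx hy => ?_⟩
  have hxy : uIcc x y ⊆ Icc (-z) z := uIcc_subset_Icc (abs_le.1 hx) (abs_le.1 hy)
  have h1 : ∀ w ∈ uIcc x y, ‖deriv f w - deriv f x‖ ≤ max C 0 * |x - y| := fun w hw => by
    have := (convex_Icc (-z) z).norm_image_sub_le_of_norm_hasDerivWithin_le
      (fun w hw => (hddf w hw).hasDerivWithinAt) (fun w hw => (hC w hw).trans (le_max_left C 0))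
      (hxy left_mem_uIcc) (hxy hw)
    refine this.trans (mul_le_mul_of_nonneg_left ?_ (le_max_right _ _))
    rw [Real.norm_eq_abs, abs_sub_comm x y]
    exact abs_sub_left_of_mem_uIcc hw
  have h2 := (convex_uIcc x y).norm_image_sub_le_of_norm_hasDerivWithin_le
    (f := fun w => f w - deriv f x * w) (f' := fun w => deriv f w - deriv f x)
    (fun w hw => ((hdf w (hxy hw)).sub ((hasDerivAt_id w).const_mul (deriv f x)
      |>.congr_deriv (mul_one _))).hasDerivWithinAt) h1 right_mem_uIcc left_mem_uIcc
  rw [Real.norm_eq_abs, Real.norm_eq_abs, mul_assoc, ← abs_mul, ← sq, abs_of_nonneg (sq_nonneg (x - y))] at h2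
  have := (le_abs_self _).trans h2
  linarith

theorem exists_lipschitzWith_deriv_of_almostCalibration (hf : IsProfile f A)
    (hf2 : ContDiffOn ℝ 2 f (Ioo (-A) A)) (h₀ : z₀ < A) (hu : IntegrableOn u (Ioo a b))
    (H : ∀ err > 0, ∃ Z Z' : ℝ → ℝ, IsAlmostCalibration f A a b z₀ B err u Z Z') :
    ∃ K : ℝ≥0, ∀ η : ℝ → ℝ, ContDiff ℝ ∞ η → HasCompactSupport η → tsupport η ⊆ Ioo a b →
      ∫ s in Ioo a b, u s * deriv (deriv η) s ≤ K * ∫ s in Ioo a b, |η s| := by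
  obtain ⟨C, hC0, hC2, hT⟩ := exists_taylor_bound hf2 (show (A + z₀) / 2 < A by linarith)
  have hB : 0 ≤ B := by
    obtain ⟨Z, Z', hZ⟩ := H 1 one_pos
    exact (abs_nonneg _).trans (hZ.Z'_le 0)
  refine ⟨⟨C * B, by positivity⟩, fun η hη hηc hηs => ?_⟩
  change _ ≤ C * B * _
  have hab : a < b ∨ ¬ a < b := em _
  rcases hab with hab | hab
  swap
  · rw [Ioo_eq_empty hab]; simp
  have hη' : ContDiff ℝ ∞ (deriv η) := (contDiff_infty_iff_deriv.1 hη).2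
  have hη'1 : ContDiff ℝ 1 (deriv η) := hη'.of_le (by simp)
  have hη'c : HasCompactSupport (deriv η) := hηc.deriv
  have hη's : tsupport (deriv η) ⊆ Ioo a b := tsupport_deriv_subset.trans hηs
  have hηd : ∀ s, HasDerivAt η (deriv η s) s := fun s =>
    ((contDiff_infty_iff_deriv.1 hη).1 s).hasDerivAt
  obtain ⟨D, hD0, hD⟩ := exists_abs_le_of_hasCompactSupport hη'.continuous hη'c
  set Q := ∫ s in Ioo a b, deriv η s ^ 2 with hQ
  have hQ0 : 0 ≤ Q := integral_nonneg fun s => sq_nonneg _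
  have key : ∀ t > 0, t * D ≤ (A - z₀) / 2 → ∫ s in Ioo a b, u s * deriv (deriv η) s ≤
      C * B * (∫ s in Ioo a b, |η s|) + C * t * Q := by
    intro t ht htD
    refine le_of_mul_le_mul_left (le_of_forall_pos_le_add fun err herr => ?_) ht
    obtain ⟨Z, Z', hZ⟩ := H err herr
    refine (hZ.mul_integral_le hf h₀ hu hη'1 hη'c hη's hD ht.le htD).trans (add_le_add_left ?_ err)
    have hbd : ∀ s, |Z s + t * deriv η s| ≤ (A + z₀) / 2 := fun s => by
      refine (abs_add_le _ _).trans ?_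
      rw [abs_mul, abs_of_nonneg ht.le]
      linarith [hZ.Z_le s, mul_le_mul_of_nonneg_left (hD s) ht.le]
    have hbZ : ∀ s, |Z s| ≤ (A + z₀) / 2 := fun s => (hZ.Z_le s).trans (by linarith)
    have hZm : ∀ s, Z s ∈ Ioo (-A) A := fun s => abs_lt.1 ((hZ.Z_le s).trans_lt h₀)
    have hZc := hZ.contDiff.continuous
    have hP : ContDiff ℝ 1 fun s => Z s + t * deriv η s := hZ.contDiff.add (contDiff_const.mul hη'1)
    have i₃ := (hf.continuous_comp h₀ hZc hZ.Z_le).integrableOn_Ioo' a b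
    have i₄ := (hf.continuous_comp (by linarith) hP.continuous hbd).integrableOn_Ioo' a b
    have hd : ContDiffOn ℝ 1 (deriv f) (Ioo (-A) A) := hf2.deriv_of_isOpen isOpen_Ioo (by norm_num)
    have hd2 : ContinuousOn (deriv (deriv f)) (Ioo (-A) A) :=
      hd.continuousOn_deriv_of_isOpen isOpen_Ioo le_rfl
    have c₁ : Continuous fun s => deriv f (Z s) := hd.continuousOn.comp_continuous hZc hZm
    have c₂ : Continuous fun s => deriv (deriv f) (Z s) * Z' s :=
      (hd2.comp_continuous hZc hZm).mul hZ.Z'_cont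
    have hfZ : ∀ s, HasDerivAt (fun s => deriv f (Z s)) (deriv (deriv f) (Z s) * Z' s) s := fun s =>
      (((hd.contDiffAt (isOpen_Ioo.mem_nhds (hZm s))).differentiableAt
        (by norm_num)).hasDerivAt).comp s (hZ.hZ s)
    have hibp := setIntegral_mul_deriv_eq_neg hab hfZ c₂ hηd hη'.continuous hηs
    have i₅ : IntegrableOn (fun s => deriv f (Z s) * deriv η s) (Ioo a b) :=
      (c₁.mul hη'.continuous).integrableOn_Ioo' a b
    have i₆ : IntegrableOn (fun s => deriv η s ^ 2) (Ioo a b) :=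
      (hη'.continuous.pow 2).integrableOn_Ioo' a b
    have h1 : ∫ s in Ioo a b, (f (Z s) - f (Z s + t * deriv η s)) ≤
        ∫ s in Ioo a b, (-t * (deriv f (Z s) * deriv η s) + C * t ^ 2 * deriv η s ^ 2) := by
      refine setIntegral_mono_on (i₃.sub i₄) ((i₅.const_mul _).add (i₆.const_mul _))
        measurableSet_Ioo fun s _ => ?_
      have := hT _ _ (hbZ s) (hbd s)
      rw [sub_add_cancel_left] at this
      nlinarith
    rw [integral_add (i₅.const_mul _) (i₆.const_mul _), integral_const_mul, integral_const_mul,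
      hibp, ← hQ] at h1
    have h2 : ∫ s in Ioo a b, deriv (deriv f) (Z s) * Z' s * η s ≤
        ∫ s in Ioo a b, C * B * |η s| := by
      refine setIntegral_mono_on ((c₂.mul hη.continuous).integrableOn_Ioo' a b)
        ((hη.continuous.abs.integrableOn_Ioo' a b).const_mul _) measurableSet_Ioo fun s _ => ?_
      refine (le_abs_self _).trans ?_
      rw [abs_mul, abs_mul]
      exact mul_le_mul_of_nonneg_right (mul_le_mul (hC2 _ (hbZ s)) (hZ.Z'_le s)
        (abs_nonneg _) hC0) (abs_nonneg _)
    rw [integral_const_mul] at h2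
    have h3 := mul_le_mul_of_nonneg_left h2 ht.le
    linarith
  refine le_of_forall_pos_le_add fun ε hε => ?_
  obtain ⟨t₁, ht₁, h₁⟩ := exists_pos_mul_le hD0 (show 0 < (A - z₀) / 2 by linarith)
  obtain ⟨t₂, ht₂, h₂⟩ := exists_pos_mul_le (show 0 < C * Q + 1 by positivity) hε
  have hmin : 0 < min t₁ t₂ := lt_min ht₁ ht₂
  refine (key _ hmin ((mul_le_mul_of_nonneg_right (min_le_left _ _) hD0.le).trans h₁)).trans ?_
  have := mul_le_mul_of_nonneg_right (min_le_right t₁ t₂) (show 0 ≤ C * Q + 1 by positivity)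
  nlinarith

end

theorem hasC11Rep_of_lipschitzWith {u v : ℝ → ℝ} {a b : ℝ} {K L : ℝ≥0} (hab : a < b)
    (hv : LipschitzWith L v) (huv : ∀ᵐ s ∂volume.restrict (Ioo a b), u s = v s)
    (H : ∀ η : ℝ → ℝ, ContDiff ℝ ∞ η → HasCompactSupport η → tsupport η ⊆ Ioo a b →
      ∫ s in Ioo a b, u s * deriv (deriv η) s ≤ K * ∫ s in Ioo a b, |η s|) :
    HasC11Rep u (Ioo a b) := by
  have hac : ∀ c d, AbsolutelyContinuousOnInterval v c d := fun c d =>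
    (hv.lipschitzOnWith (s := uIcc c d)).absolutelyContinuousOnInterval
  have hDi : IntegrableOn (deriv v) (Ioo a b) := by
    have := (hac a b).intervalIntegrable_deriv
    rw [intervalIntegrable_iff_integrableOn_Ioo_of_le hab.le] at this
    exact this
  have hDη : ∀ η : ℝ → ℝ, ContDiff ℝ ∞ η → HasCompactSupport η → tsupport η ⊆ Ioo a b →
      ∫ s in Ioo a b, deriv v s * deriv η s = -∫ s in Ioo a b, u s * deriv (deriv η) s := by
    intro η hη hηc hηs
    have hη' : ContDiff ℝ ∞ (deriv η) := (contDiff_infty_iff_deriv.1 hη).2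
    have hη's : tsupport (deriv η) ⊆ Ioo a b := tsupport_deriv_subset.trans hηs
    obtain ⟨C, hC⟩ := ContDiff.lipschitzWith_of_hasCompactSupport hηc.deriv
      (hη'.of_le (by simp) : ContDiff ℝ 1 (deriv η)) one_ne_zero
    have := (hac a b).integral_mul_deriv_eq_deriv_mul
      (hC.lipschitzOnWith (s := uIcc a b)).absolutelyContinuousOnInterval
    rw [image_eq_zero_of_notMem_tsupport fun hm => lt_irrefl a (hη's hm).1,
      image_eq_zero_of_notMem_tsupport fun hm => lt_irrefl b (hη's hm).2,
      intervalIntegral.integral_of_le hab.le, intervalIntegral.integral_of_le hab.le,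
      integral_Ioc_eq_integral_Ioo, integral_Ioc_eq_integral_Ioo] at this
    have huv' : ∫ s in Ioo a b, u s * deriv (deriv η) s = ∫ s in Ioo a b, v s * deriv (deriv η) s :=
      integral_congr_ae (huv.mono fun s hs => by simp only [hs])
    rw [huv']
    linarith
  obtain ⟨w, hw, hDw⟩ := exists_lipschitzWith_of_integral_mul_deriv_le (K := K) hDi
    fun η hη hηc hηs => by
      have := H (fun s => -η s) hη.neg (hηc.comp_left (g := fun z : ℝ => -z) neg_zero)
        ((tsupport_comp_subset (g := fun z : ℝ => -z) neg_zero η).trans hηs)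
      have e : deriv (deriv fun s => -η s) = fun s => -deriv (deriv η) s := by
        rw [show (deriv fun s => -η s) = fun s => -deriv η s from funext fun s => deriv.fun_neg]
        exact funext fun s => deriv.fun_neg
      rw [e] at this
      simp only [mul_neg, integral_neg, abs_neg] at this
      rw [hDη η hη hηc hηs]
      exact this
  refine ⟨fun s => v a + ∫ r in a..s, w r, w, ?_, fun s _ => ?_, K, hw.lipschitzOnWith⟩
  · filter_upwards [huv, ae_restrict_mem measurableSet_Ioo] with s hs hsI
    rw [hs, ← sub_eq_iff_eq_add', ← (hac a s).integral_deriv_eq_sub]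
    refine intervalIntegral.integral_congr_ae_restrict ?_
    rw [uIoc_of_le hsI.1.le]
    refine ae_mono (Measure.restrict_mono_set _ ?_) hDw
    exact fun r hr => ⟨hr.1, hr.2.trans_lt hsI.2⟩
  · exact ((hw.continuous.integral_hasStrictDerivAt a s).hasDerivAt).const_add _

end

theorem contDiff_vec2 {n : WithTop ℕ∞} : ContDiff ℝ n fun q : ℝ × ℝ => vec2 q.1 q.2 := by
  rw [contDiff_euclidean]
  intro i
  fin_cases i
  exacts [contDiff_fst, contDiff_snd]

theorem IsProfile.continuousAt {f : ℝ → ℝ} {A z : ℝ} (hf : IsProfile f A) (hz : |z| < A) :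
    ContinuousAt f z := by
  have h₀ : |z| < (|z| + A) / 2 := by linarith
  have h₁ : (|z| + A) / 2 < A := by linarith
  have hK : 0 ≤ f 0 / (A - (|z| + A) / 2) := div_nonneg hf.zero_pos.le (sub_pos.2 h₁).le
  have : LipschitzOnWith ⟨_, hK⟩ f {z' | |z'| ≤ (|z| + A) / 2} :=
    LipschitzOnWith.of_dist_le_mul fun z' hz' w hw => hf.abs_sub_le h₁ hz' hw
  exact this.continuousOn.continuousAt
    (mem_of_superset ((isOpen_lt continuous_abs continuous_const).mem_nhds h₀) fun w (hw : |w| < _) => hw.le)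

namespace IsAnisotropy
variable {φ : E2 → ℝ}

theorem vec2_profile_eq (hφ : IsAnisotropy φ) (hpm : PartiallyMonotone φ) {z : ℝ}
    (hz : |z| ≤ (φ e1)⁻¹) : φ (vec2 z (profile φ z)) = 1 := by
  refine le_antisymm (hφ.vec2_profile_le hz) (le_of_forall_pos_lt_add fun ε hε => ?_)
  by_contra! hc
  have h2 := hφ.e2_pos
  have hδ : 0 < ε / φ e2 := by positivity
  have h1 := hφ.le_add_right z (profile φ z + ε / φ e2) (profile φ z)
  rw [add_sub_cancel_left, abs_of_pos hδ, div_mul_cancel₀ _ h2.ne'] at h1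
  have := (le_abs_self _).trans (hφ.le_profile hpm (h1.trans hc))
  linarith

theorem contDiffOn_profile (hφ : IsAnisotropy φ) (hpm : PartiallyMonotone φ)
    (hf : IsProfile (profile φ) (φ e1)⁻¹) (hC : IsC2Aniso φ) :
    ContDiffOn ℝ 2 (profile φ) (Ioo (-(φ e1)⁻¹) (φ e1)⁻¹) := by
  intro z hz
  have hz' : |z| < (φ e1)⁻¹ := abs_lt.2 hz
  have hy : 0 < profile φ z := by
    have := hf.pos_of_lt (abs_nonneg z) hz'
    rcases abs_choice z with h | h <;> rw [h] at this
    exacts [this, by rwa [hf.even] at this]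
  set Φ : ℝ × ℝ → ℝ := fun q => φ (vec2 q.1 q.2) with hΦ
  set q₀ : ℝ × ℝ := (z, profile φ z) with hq₀
  have hne : vec2 q₀.1 q₀.2 ≠ 0 := fun h => hy.ne' (congrArg (fun x : E2 => x 1) h)
  have hd : ContDiffAt ℝ 2 Φ q₀ :=
    ContDiffAt.comp q₀ (hC.contDiffAt (isOpen_compl_singleton.mem_nhds hne)) contDiff_vec2.contDiffAt
  have hval : Φ q₀ = 1 := hφ.vec2_profile_eq hpm hz'.le
  set L : ℝ →L[ℝ] ℝ := fderiv ℝ Φ q₀ ∘L .inr ℝ ℝ ℝ with hL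
  have hder : HasDerivAt (fun y => Φ (z, y)) (L 1) (profile φ z) := by
    have h1 : HasFDerivAt Φ (fderiv ℝ Φ q₀) q₀ := (hd.differentiableAt (by norm_num)).hasFDerivAt
    exact (h1.comp (profile φ z) (hasFDerivAt_prodMk_right z (profile φ z))).hasDerivAt
  have hconv : ConvexOn ℝ univ fun y => Φ (z, y) := by
    refine ⟨convex_univ, fun y _ y' _ s t hs ht hst => ?_⟩
    have := hφ.convex_comb_le (x := vec2 z y) (y := vec2 z y') hs ht
    rw [smul_vec2, smul_vec2, vec2_add, ← add_mul, hst, one_mul] at this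
    exact this
  have hpos : 0 < L 1 := by
    refine lt_of_lt_of_le ?_ (hconv.slope_le_of_hasDerivAt (mem_univ 0) (mem_univ _) hy hder)
    rw [slope_def_field, sub_zero]
    refine div_pos (sub_pos.2 ?_) hy
    rw [show Φ (z, profile φ z) = 1 from hval]
    change φ (vec2 z 0) < 1
    rw [hφ.vec2_zero_right]
    rwa [← lt_div_iff₀ hφ.e1_pos, one_div]
  have hinv : L.IsInvertible := by
    refine ⟨ContinuousLinearEquiv.unitsEquivAut ℝ (Units.mk0 (L 1) hpos.ne'), ?_⟩
    ext
    simp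
  have hcd := hd.contDiffAt_implicitFunction (by norm_num) hinv
  refine (hcd.congr_of_eventuallyEq ?_).contDiffWithinAt
  have hcont : Tendsto (fun w => ((w, profile φ w) : ℝ × ℝ)) (𝓝 z) (𝓝 q₀) :=
    continuousAt_id.prodMk (hf.continuousAt hz')
  filter_upwards [hcont.eventually (hd.eventually_apply_eq_iff_implicitFunction (by norm_num) hinv),
    isOpen_Ioo.mem_nhds hz] with w hw hwI
  exact (hw.1 ((hφ.vec2_profile_eq hpm (abs_lt.2 hwI).le).trans hval.symm)).symm

end IsAnisotropy

theorem cosh_le_exp_abs_mul_cosh (x y : ℝ) : Real.cosh x ≤ Real.exp |x - y| * Real.cosh y := by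
  have h1 : Real.exp x ≤ Real.exp |x - y| * Real.exp y := by
    rw [← Real.exp_add]; gcongr; linarith [le_abs_self (x - y)]
  have h2 : Real.exp (-x) ≤ Real.exp |x - y| * Real.exp (-y) := by
    rw [← Real.exp_add]; gcongr; linarith [neg_abs_le (x - y)]
  rw [Real.cosh_eq, Real.cosh_eq]
  linarith

theorem norm_sq_eq_of_ne {i j : Fin 2} (hij : i ≠ j) (x : E2) : ‖x‖ ^ 2 = x i ^ 2 + x j ^ 2 := by
  rw [EuclideanSpace.real_norm_sq_eq, Fin.sum_univ_two]
  fin_cases i <;> fin_cases j <;> simp_all [add_comm]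

theorem inner_eq_of_ne {i j : Fin 2} (hij : i ≠ j) (x y : E2) :
    ⟪x, y⟫ = x i * y i + x j * y j := by
  rw [inner_eq_sum_two]
  fin_cases i <;> fin_cases j <;> simp_all [add_comm]

section
variable {i j : Fin 2} {ε : ℝ} {T : Set E2} {ν : E2 → E2}

/-- Supporting lines, in slope form. -/
theorem mul_sub_le_of_inner_nonpos (hij : i ≠ j) (hε : ε ^ 2 = 1) {q q' n : E2}
    (hn : 0 < ε * n j) (h : ⟪q' - q, n⟫ ≤ 0) :
    ε * (q' j - q j) ≤ -((q' i - q i) * (n i / (ε * n j))) := by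
  rw [inner_eq_of_ne hij, PiLp.sub_apply, PiLp.sub_apply] at h
  rw [← mul_div_assoc, ← neg_div, le_div_iff₀ hn]
  have h2 : ε * (q' j - q j) * (ε * n j) = (q' j - q j) * n j := by
    linear_combination (q' j - q j) * n j * hε
  linarith

theorem cosh_arsinh_mul_eq_one (hij : i ≠ j) (hε : ε ^ 2 = 1) {n : E2} (hn : 0 < ε * n j)
    (h1 : ‖n‖ = 1) : Real.cosh (Real.arsinh (n i / (ε * n j))) * (ε * n j) = 1 := by
  have h := norm_sq_eq_of_ne hij n
  have hc := Real.cosh_sq (Real.arsinh (n i / (ε * n j)))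
  rw [Real.sinh_arsinh] at hc
  have h2 : (Real.cosh (Real.arsinh (n i / (ε * n j))) * (ε * n j)) ^ 2 = 1 := by
    rw [mul_pow, hc, add_mul, div_pow, div_mul_cancel₀ _ (by positivity), mul_pow, hε]
    rw [h1] at h
    linarith
  exact (pow_eq_one_iff_of_nonneg (mul_nonneg (Real.cosh_pos _).le hn.le) two_ne_zero).1 h2

theorem abs_sub_floor_div_four_le (t : ℝ) : |t - ⌊4 * t⌋ / 4| ≤ 1 / 4 := by
  have h1 := Int.floor_le (4 * t)
  have h2 := Int.lt_floor_add_one (4 * t)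
  rw [abs_le]
  constructor <;> linarith

theorem ofReal_le_slice (hε : ε = 1 ∨ ε = -1) {y : ℝ} {S : Set ℝ}
    (hS : ∀ t, 0 < ε * t → ε * t < ε * y → t ∈ S) : ENNReal.ofReal (ε * y) ≤ volume S := by
  rcases hε with rfl | rfl
  · refine le_trans (le_of_eq ?_) (measure_mono (s := Ioo 0 y) fun t ht =>
      hS t (by linarith [ht.1]) (by linarith [ht.2]))
    rw [Real.volume_Ioo]; simp
  · refine le_trans (le_of_eq ?_) (measure_mono (s := Ioo y 0) fun t ht =>
      hS t (by linarith [ht.2]) (by linarith [ht.1]))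
    rw [Real.volume_Ioo]; simp

theorem hausdorffMeasure_inter_preimage_le {S : ℝ≥0} (hS : ∀ q ∈ T, ∀ q' ∈ T,
    dist q q' ≤ S * |q i - q' i|) (A : Set ℝ) :
    μH[1] ((fun q : E2 => q i) ⁻¹' A ∩ T) ≤ S * volume (A ∩ (fun q : E2 => q i) '' T) := by
  set g := Function.invFunOn (fun q : E2 => q i) T
  have hg : ∀ q ∈ T, g (q i) ∈ T ∧ (g (q i)) i = q i := fun q hq =>
    ⟨Function.invFunOn_mem (f := fun q : E2 => q i) ⟨q, hq, rfl⟩,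
      Function.invFunOn_eq (f := fun q : E2 => q i) ⟨q, hq, rfl⟩⟩
  have hgq : ∀ q ∈ T, g (q i) = q := fun q hq => by
    have := hS _ (hg q hq).1 q hq
    rw [(hg q hq).2, sub_self, abs_zero, mul_zero] at this
    exact dist_le_zero.1 this
  have hlip : LipschitzOnWith S g ((fun q : E2 => q i) '' T) := by
    refine LipschitzOnWith.of_dist_le_mul ?_
    rintro _ ⟨q, hq, rfl⟩ _ ⟨q', hq', rfl⟩
    simp only [hgq q hq, hgq q' hq', Real.dist_eq]
    exact hS q hq q' hq'
  have hsub : (fun q : E2 => q i) ⁻¹' A ∩ T ⊆ g '' (A ∩ (fun q : E2 => q i) '' T) :=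
    fun q hq => ⟨q i, ⟨hq.1, q, hq.2, rfl⟩, hgq q hq.2⟩
  have := (hlip.mono (inter_subset_right (s := A))).hausdorffMeasure_image_le zero_le_one
  rw [hausdorffMeasure_real, ENNReal.rpow_one] at this
  exact (measure_mono hsub).trans this

theorem lintegral_comp_coord_le {S : ℝ≥0} (hS : ∀ q ∈ T, ∀ q' ∈ T, dist q q' ≤ S * |q i - q' i|)
    {H : Set ℝ} (hTH : ∀ q ∈ T, q i ∈ H) {F : ℝ → ℝ≥0∞} (hF : Measurable F) :
    ∫⁻ q in T, F (q i) ∂μH[1] ≤ S * ∫⁻ x in H, F x := by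
  have hp : Measurable fun q : E2 => q i := by fun_prop
  rw [← lintegral_map hF hp, ← smul_eq_mul, ← lintegral_smul_measure]
  refine lintegral_mono' (Measure.le_iff.2 fun A hA => ?_) le_rfl
  rw [Measure.map_apply hp hA, Measure.restrict_apply (hp hA), Measure.smul_apply,
    Measure.restrict_apply hA, smul_eq_mul]
  refine (hausdorffMeasure_inter_preimage_le hS A).trans ?_
  gcongr
  rintro _ ⟨q, hq, rfl⟩
  exact hTH q hq

theorem setLIntegral_le_of_supporting (hij : i ≠ j) (hε : ε = 1 ∨ ε = -1)
    (hν : ∀ q ∈ T, ‖ν q‖ = 1) (hνj : ∀ q ∈ T, 0 < ε * ν q j) (hqj : ∀ q ∈ T, 0 < ε * q j)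
    (hsupp : ∀ q ∈ T, ∀ q' ∈ T, ⟪q' - q, ν q⟫ ≤ 0) {V : Set (ℝ × ℝ)} (hV : MeasurableSet V)
    (hseg : ∀ q ∈ T, ∀ t, 0 < ε * t → ε * t < ε * q j → (q i, t) ∈ V) {f : E2 → ℝ≥0∞}
    (hf : ∀ q ∈ T, f q ≤ 2 * ENNReal.ofReal (q j * ν q j)) :
    ∫⁻ q in T, f q ∂μH[1] ≤ 4 * volume V := by
  have hε2 : ε ^ 2 = 1 := by rcases hε with rfl | rfl <;> norm_num
  set m : E2 → ℝ := fun q => ν q i / (ε * ν q j) with hm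
  set t : E2 → ℝ := fun q => Real.arsinh (m q) with ht
  set κ : E2 → ℤ := fun q => ⌊4 * t q⌋ with hκ
  have hA : ∀ q ∈ T, ∀ q' ∈ T, ε * (q' j - q j) ≤ -((q' i - q i) * m q) := fun q hq q' hq' =>
    mul_sub_le_of_inner_nonpos hij hε2 (hνj q hq) (hsupp q hq q' hq')
  have hmono : ∀ q ∈ T, ∀ q' ∈ T, q i ≤ q' i → κ q ≤ κ q' := by
    intro q hq q' hq' h
    have h1 := hA q hq q' hq'
    have h2 := hA q' hq' q hq
    rcases h.eq_or_lt with h | h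
    · have h3 : ε * (q' j - q j) = 0 := by
        rw [h, sub_self, zero_mul, neg_zero] at h1 h2
        linarith
      have hε0 : ε ≠ 0 := by rintro rfl; norm_num at hε2
      have h4 : q' j = q j := sub_eq_zero.1 ((mul_eq_zero.1 h3).resolve_left hε0)
      have h5 : q = q' := by
        rw [← sub_eq_zero, ← norm_eq_zero, ← sq_eq_zero_iff, norm_sq_eq_of_ne hij]
        simp [h, h4]
      rw [h5]
    · have h3 : 0 ≤ (q' i - q i) * (m q' - m q) := by linarith
      have h4 := nonneg_of_mul_nonneg_right h3 (sub_pos.2 h)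
      exact Int.floor_mono (by
        have := Real.arsinh_le_arsinh.2 (sub_nonneg.1 h4)
        simp only [ht]; linarith)
  set c : ℤ → ℝ := fun k => Real.cosh (k / 4) with hc
  have hc0 : ∀ k, 0 < c k := fun k => Real.cosh_pos _
  set r : ℝ := Real.exp (1 / 4) with hr
  have hr0 : 0 < r := Real.exp_pos _
  have hr2 : r * r ≤ 2 := by
    rw [hr, ← Real.exp_add]
    have h1 := Real.exp_one_lt_d9
    have h2 : Real.exp (1 / 4 + 1 / 4) ^ 2 = Real.exp 1 := by
      rw [← Real.exp_nat_mul]; norm_num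
    nlinarith [Real.exp_pos (1 / 4 + 1 / 4)]
  have hcosh : ∀ q, Real.cosh (t q) ≤ r * c (κ q) := fun q =>
    (cosh_le_exp_abs_mul_cosh _ _).trans (mul_le_mul_of_nonneg_right
      (Real.exp_le_exp.2 (abs_sub_floor_div_four_le _)) (hc0 _).le)
  have hcosh' : ∀ q, c (κ q) ≤ r * Real.cosh (t q) := fun q =>
    (cosh_le_exp_abs_mul_cosh _ (t q)).trans (mul_le_mul_of_nonneg_right
      (Real.exp_le_exp.2 (by rw [abs_sub_comm]; exact abs_sub_floor_div_four_le _))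
      (Real.cosh_pos _).le)
  set P : ℤ → Set E2 := fun k => {q ∈ T | κ q = k} with hP
  set H : ℤ → Set ℝ := fun k => {x | ∃ q ∈ P k, ∃ q' ∈ P k, q i ≤ x ∧ x ≤ q' i} with hH
  have hHm : ∀ k, MeasurableSet (H k) := fun k => by
    refine OrdConnected.measurableSet ⟨?_⟩
    rintro x ⟨q, hq, _, _, hx, _⟩ y ⟨_, _, q', hq', _, hy⟩ z hz
    exact ⟨q, hq, q', hq', hx.trans hz.1, hz.2.trans hy⟩
  have hHd : Pairwise (Function.onFun Disjoint H) := by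
    have aux : ∀ k l, k < l → Disjoint (H k) (H l) := by
      intro k l hkl
      rw [Set.disjoint_left]
      rintro x ⟨_, _, q', hq', _, hx⟩ ⟨q, hq, _, _, hx', _⟩
      have := hmono q hq.1 q' hq'.1 (hx'.trans hx)
      rw [hq.2, hq'.2] at this
      exact absurd this (not_le.2 hkl)
    intro k l hkl
    rcases hkl.lt_or_gt with h | h
    exacts [aux k l h, (aux l k h).symm]
  set F : ℝ → ℝ≥0∞ := fun x => volume (Prod.mk x ⁻¹' V) with hF
  have hFm : Measurable F := measurable_measure_prodMk_left hV
  have hpiece : ∀ k, ∫⁻ q in P k, f q ∂μH[1] ≤ 4 * ∫⁻ x in H k, F x := by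
    intro k
    have hS0 : 0 ≤ r * c k := (mul_pos hr0 (hc0 k)).le
    have hLip : ∀ q ∈ P k, ∀ q' ∈ P k, dist q q' ≤ (⟨r * c k, hS0⟩ : ℝ≥0) * |q i - q' i| := by
      have hmle : ∀ q ∈ P k, 1 + m q ^ 2 ≤ (r * c k) ^ 2 := fun q hq => by
        have h1 := hcosh q
        rw [hq.2] at h1
        have h2 := pow_le_pow_left₀ (Real.cosh_pos _).le h1 2
        rwa [Real.cosh_sq, Real.sinh_arsinh, add_comm] at h2
      intro q hq q' hq'
      change _ ≤ r * c k * _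
      set M := Real.sqrt ((r * c k) ^ 2 - 1) with hM
      have hM0 : 0 ≤ M := Real.sqrt_nonneg _
      have hMsq : M ^ 2 = (r * c k) ^ 2 - 1 :=
        Real.sq_sqrt (by nlinarith [hmle q hq, sq_nonneg (m q)])
      have hmM : ∀ q ∈ P k, |m q| ≤ M := fun q hq => Real.abs_le_sqrt (by linarith [hmle q hq])
      have hb : ∀ q ∈ P k, ∀ q' ∈ P k, ε * (q' j - q j) ≤ M * |q i - q' i| := fun q hq q' hq' => by
        refine (hA q hq.1 q' hq'.1).trans ((neg_le_abs _).trans ?_)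
        rw [abs_mul, abs_sub_comm, mul_comm]
        exact mul_le_mul_of_nonneg_right (hmM q hq) (abs_nonneg _)
      have h1 := hb q hq q' hq'
      have h2 := hb q' hq' q hq
      rw [abs_sub_comm] at h2
      have h3 : (ε * (q' j - q j)) ^ 2 ≤ (M * |q i - q' i|) ^ 2 :=
        sq_le_sq' (by linarith) h1
      rw [mul_pow, mul_pow, hε2, hMsq, sq_abs] at h3
      refine abs_le_of_sq_le_sq' ?_ (mul_nonneg hS0 (abs_nonneg _)) |>.2
      rw [dist_eq_norm, norm_sq_eq_of_ne hij, mul_pow, sq_abs, PiLp.sub_apply, PiLp.sub_apply]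
      nlinarith
    have hfle : ∀ q ∈ P k, f q ≤ ENNReal.ofReal (2 * (r / c k)) * F (q i) := by
      intro q hq
      have hsl : ENNReal.ofReal (ε * q j) ≤ F (q i) :=
        ofReal_le_slice hε fun t h1 h2 => hseg q hq.1 t h1 h2
      have hn : ε * ν q j ≤ r / c k := by
        rw [le_div_iff₀ (hc0 k)]
        have h1 := hcosh' q
        rw [hq.2] at h1
        have h2 := mul_le_mul_of_nonneg_left h1 (hνj q hq.1).le
        have h3 := cosh_arsinh_mul_eq_one hij hε2 (hνj q hq.1) (hν q hq.1)
        calc ε * ν q j * c k ≤ ε * ν q j * (r * Real.cosh (t q)) := h2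
          _ = r * (Real.cosh (t q) * (ε * ν q j)) := by ring
          _ = r := by rw [h3, mul_one]
      refine (hf q hq.1).trans ?_
      rw [show q j * ν q j = ε * ν q j * (ε * q j) by linear_combination -(q j * ν q j) * hε2,
        ENNReal.ofReal_mul (p := ε * ν q j) (hνj q hq.1).le,
        ENNReal.ofReal_mul (p := 2) (by norm_num), mul_assoc, ENNReal.ofReal_ofNat]
      exact mul_le_mul_right (mul_le_mul' (ENNReal.ofReal_le_ofReal hn) hsl) 2
    calc ∫⁻ q in P k, f q ∂μH[1] ≤ ∫⁻ q in P k, ENNReal.ofReal (2 * (r / c k)) * F (q i) ∂μH[1] :=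
          setLIntegral_mono ((hFm.comp (by fun_prop)).const_mul _) hfle
      _ = ENNReal.ofReal (2 * (r / c k)) * ∫⁻ q in P k, F (q i) ∂μH[1] :=
          lintegral_const_mul _ (hFm.comp (by fun_prop))
      _ ≤ ENNReal.ofReal (2 * (r / c k)) * (ENNReal.ofReal (r * c k) * ∫⁻ x in H k, F x) := by
          gcongr
          rw [ENNReal.ofReal_eq_coe_nnreal hS0]
          exact lintegral_comp_coord_le hLip (H := H k) (fun q hq => ⟨q, hq, q, hq, le_rfl, le_rfl⟩) hFm
      _ ≤ 4 * ∫⁻ x in H k, F x := by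
          rw [← mul_assoc, ← ENNReal.ofReal_mul (by positivity [hc0 k])]
          gcongr
          rw [← ENNReal.ofReal_ofNat]
          refine ENNReal.ofReal_le_ofReal ?_
          have := (hc0 k).ne'
          calc 2 * (r / c k) * (r * c k) = 2 * (r * r) := by field_simp
            _ ≤ 4 := by linarith
  have hcover : T = ⋃ k, P k := by
    ext q
    simp [hP]
  calc ∫⁻ q in T, f q ∂μH[1] = ∫⁻ q in ⋃ k, P k, f q ∂μH[1] := by rw [← hcover]
    _ ≤ ∑' k, ∫⁻ q in P k, f q ∂μH[1] := lintegral_iUnion_le _ _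
    _ ≤ ∑' k, 4 * ∫⁻ x in H k, F x := ENNReal.tsum_le_tsum hpiece
    _ = 4 * ∫⁻ x in ⋃ k, H k, F x := by rw [ENNReal.tsum_mul_left, lintegral_iUnion hHm hHd]
    _ ≤ 4 * ∫⁻ x, F x := by gcongr; exact Measure.restrict_le_self
    _ = 4 * volume V := by rw [Measure.volume_eq_prod, Measure.prod_apply hV]

end

namespace IsAnisotropy
variable {φ : E2 → ℝ}

theorem continuous (hφ : IsAnisotropy φ) : Continuous φ := by
  obtain ⟨c, hc, hb⟩ := hφ.bounds
  have hc' : 0 ≤ 1 / c := one_div_nonneg.2 hc.1.le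
  have hle : ∀ z, φ z ≤ 1 / c * ‖z‖ := by
    intro z
    rcases eq_or_ne z 0 with rfl | hz
    · simp [(hφ.eq_zero_iff 0).2 rfl]
    · have hz' := norm_pos_iff.2 hz
      have h1 := (hb (‖z‖⁻¹ • z) (by rw [norm_smul, norm_inv, norm_norm, inv_mul_cancel₀ hz'.ne'])).2
      rw [hφ.smul_eq, abs_of_pos (inv_pos.2 hz'), inv_mul_le_iff₀ hz'] at h1
      linarith
  refine (LipschitzWith.of_le_add_mul ⟨1 / c, hc'⟩ fun x y => ?_).continuous
  calc φ x = φ (y + (x - y)) := by rw [add_sub_cancel]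
    _ ≤ φ y + φ (x - y) := hφ.add_le _ _
    _ ≤ φ y + 1 / c * dist x y := by rw [dist_eq_norm]; gcongr; exact hle _

theorem mono_of_abs_le (hφ : IsAnisotropy φ) (hpm : PartiallyMonotone φ) {q q' : E2}
    (h : ∀ k, |q k| ≤ |q' k|) : φ q ≤ φ q' := by
  rw [← vec2_eta q, ← vec2_eta q']
  exact (hφ.mono_left hpm (h 0)).trans (hφ.mono_right hpm (h 1))

theorem isClosed_wulff (hφ : IsAnisotropy φ) : IsClosed (wulff φ) :=
  isClosed_le hφ.continuous continuous_const

end IsAnisotropy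

namespace IsOuterNormalAt
variable {E : Set E2} {x ν : E2}

theorem not_eventually_subset (h : IsOuterNormalAt E x ν) {U : Set E2} (hU : IsOpen U)
    (hne : U.Nonempty) (hU1 : U ⊆ Metric.ball 0 1) :
    ¬ ∀ᶠ r : ℝ in 𝓝[>] 0, U ⊆ {y : E2 | x + r • y ∈ E} ∆ {y : E2 | ⟪y, ν⟫ ≤ 0} := fun hsub =>
  (hU.measure_pos volume hne).not_ge
    (ge_of_tendsto h.2 (hsub.mono fun _ hr => measure_mono (subset_inter hr hU1)))

theorem mem_of_isClosed (h : IsOuterNormalAt E x ν) (hE : IsClosed E) : x ∈ E := by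
  by_contra hx
  obtain ⟨δ, hδ, hball⟩ := Metric.isOpen_iff.1 hE.isOpen_compl x hx
  refine h.not_eventually_subset (U := {y | ⟪y, ν⟫ < 0} ∩ Metric.ball 0 1)
    ((isOpen_lt (by fun_prop) continuous_const).inter Metric.isOpen_ball)
    ⟨-((1 / 2 : ℝ) • ν), ?_, ?_⟩ inter_subset_right ?_
  · simp [inner_neg_left, real_inner_smul_left, h.1]
  · rw [mem_ball_zero_iff, norm_neg, norm_smul, h.1]; norm_num
  · filter_upwards [Ioo_mem_nhdsGT hδ] with r hr y hy
    refine Or.inr ⟨show ⟪y, ν⟫ ≤ 0 from le_of_lt hy.1, fun hy' => hball ?_ hy'⟩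
    have := mem_ball_zero_iff.1 hy.2
    rw [mem_ball_iff_norm, add_sub_cancel_left, norm_smul, Real.norm_of_nonneg hr.1.le]
    nlinarith [hr.1, hr.2, norm_nonneg y]

theorem inner_sub_nonpos {φ : E2 → ℝ} (hφ : IsAnisotropy φ) (h : IsOuterNormalAt (wulff φ) x ν)
    {y : E2} (hy : y ∈ wulff φ) : ⟪y - x, ν⟫ ≤ 0 := by
  by_contra! hpos
  have hx : φ x ≤ 1 := h.mem_of_isClosed hφ.isClosed_wulff
  obtain ⟨t, ht, ht1⟩ : ∃ t : ℝ, 0 < ⟪t • y - x, ν⟫ ∧ t ∈ Ioo (0:ℝ) 1 := by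
    have hc : Continuous fun t : ℝ => ⟪t • y - x, ν⟫ := by fun_prop
    have h1 : ∀ᶠ t : ℝ in 𝓝[<] 1, 0 < ⟪t • y - x, ν⟫ :=
      (hc.tendsto' 1 _ (by rw [one_smul])).eventually_const_lt hpos |>.filter_mono nhdsWithin_le_nhds
    exact (h1.and (Ioo_mem_nhdsLT zero_lt_one)).exists
  have hz : φ (t • y) < 1 := by
    rw [hφ.smul_eq, abs_of_pos ht1.1]
    have : φ y ≤ 1 := hy
    nlinarith [ht1.1, ht1.2]
  obtain ⟨s, hs, hs1⟩ : ∃ s : ℝ, ‖s • (t • y - x)‖ < 1 ∧ s ∈ Ioo (0:ℝ) 1 := by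
    have hc : Continuous fun s : ℝ => ‖s • (t • y - x)‖ := by fun_prop
    have h1 : ∀ᶠ s : ℝ in 𝓝[>] 0, ‖s • (t • y - x)‖ < 1 :=
      (hc.tendsto' 0 0 (by simp)).eventually_lt_const zero_lt_one |>.filter_mono nhdsWithin_le_nhds
    exact (h1.and (Ioo_mem_nhdsGT zero_lt_one)).exists
  have hφc := hφ.continuous
  refine h.not_eventually_subset
    (U := ({u | φ (x + u) < 1} ∩ {u | 0 < ⟪u, ν⟫}) ∩ Metric.ball 0 1)
    (((isOpen_lt (by fun_prop) continuous_const).inter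
      (isOpen_lt continuous_const (by fun_prop))).inter Metric.isOpen_ball)
    ⟨s • (t • y - x), ⟨?_, ?_⟩, mem_ball_zero_iff.2 hs⟩ inter_subset_right ?_
  · have h1 := hφ.convex_comb_le (x := x) (y := t • y) (sub_nonneg.2 hs1.2.le) hs1.1.le
    have h2 : (1 - s) • x + s • t • y = x + s • (t • y - x) := by module
    rw [h2] at h1
    refine h1.trans_lt ?_
    nlinarith [hs1.1, hs1.2]
  · change 0 < ⟪s • (t • y - x), ν⟫
    rw [real_inner_smul_left]
    exact mul_pos hs1.1 ht
  · filter_upwards [Ioo_mem_nhdsGT zero_lt_one] with r hr u hu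
    refine Or.inl ⟨?_, fun hu' : ⟪u, ν⟫ ≤ 0 => hu'.not_gt hu.1.2⟩
    have h1 := hφ.convex_comb_le (x := x) (y := x + u) (sub_nonneg.2 hr.2.le) hr.1.le
    have h2 : (1 - r) • x + r • (x + u) = x + r • u := by module
    rw [h2] at h1
    have h3 : φ (x + u) < 1 := hu.1.1
    change φ (x + r • u) ≤ 1
    nlinarith [hr.1, hr.2]

theorem dualA_le {φ : E2 → ℝ} (hφ : IsAnisotropy φ) (h : IsOuterNormalAt (wulff φ) x ν) :
    dualA φ ν ≤ ⟪x, ν⟫ := by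
  refine csSup_le ⟨_, (φ e1)⁻¹ • e1, ?_, rfl⟩ ?_
  · rw [hφ.smul_eq, abs_of_pos (inv_pos.2 hφ.e1_pos), inv_mul_cancel₀ hφ.e1_pos.ne']
  · rintro _ ⟨η, hη, rfl⟩
    have := h.inner_sub_nonpos hφ (y := η) hη.le
    rw [inner_sub_left] at this
    rw [real_inner_comm]
    linarith

end IsOuterNormalAt

theorem isOuterNormalAt_genNormal {E : Set E2} {x : E2} (hx : x ∈ redBoundary E) :
    IsOuterNormalAt E x (genNormal E x) := by
  have hx' : ∃ ν, IsOuterNormalAt E x ν := hx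
  rw [genNormal, dif_pos hx']
  exact hx'.choose_spec

theorem exists_coord_measurableEquiv {i j : Fin 2} (hij : i ≠ j) :
    ∃ e : E2 ≃ᵐ ℝ × ℝ, (∀ q, e q = (q i, q j)) ∧ MeasurePreserving e := by
  have h1 := (volume_preserving_finTwoArrow ℝ).comp (PiLp.volume_preserving_ofLp (Fin 2))
  have h2 : ∀ q : E2, ((MeasurableEquiv.toLp 2 (Fin 2 → ℝ)).symm.trans
    MeasurableEquiv.finTwoArrow) q = (q 0, q 1) := fun q => rfl
  have key : (i = 0 ∧ j = 1) ∨ (i = 1 ∧ j = 0) := by omega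
  rcases key with ⟨rfl, rfl⟩ | ⟨rfl, rfl⟩
  · exact ⟨_, h2, h1⟩
  · exact ⟨((MeasurableEquiv.toLp 2 (Fin 2 → ℝ)).symm.trans
      MeasurableEquiv.finTwoArrow).trans MeasurableEquiv.prodComm, fun q => rfl,
      Measure.measurePreserving_swap.comp h1⟩

section
variable {φ : E2 → ℝ}

/-- The part of the reduced boundary of the Wulff shape on the side `ε` of the `j`-th axis where
the `j`-th coordinate carries at least half of the anisotropic perimeter density. -/
def boundaryPart (φ : E2 → ℝ) (j : Fin 2) (ε : ℝ) : Set E2 :=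
  {q ∈ redBoundary (wulff φ) | dualA φ (genNormal (wulff φ) q) ≤ 2 * (q j * genNormal (wulff φ) q j) ∧
    0 < ε * q j ∧ 0 < ε * genNormal (wulff φ) q j}

theorem setLIntegral_boundaryPart_le (hφ : IsAnisotropy φ) (hpm : PartiallyMonotone φ) (j : Fin 2)
    {ε : ℝ} (hε : ε = 1 ∨ ε = -1) :
    ∫⁻ q in boundaryPart φ j ε, ENNReal.ofReal (dualA φ (genNormal (wulff φ) q)) ∂μH[1] ≤
      4 * volume (wulff φ ∩ {q | 0 < ε * q j}) := by
  obtain ⟨i, hij⟩ := exists_ne j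
  obtain ⟨e, he, hmp⟩ := exists_coord_measurableEquiv hij
  have hA : MeasurableSet (wulff φ ∩ {q : E2 | 0 < ε * q j}) :=
    hφ.isClosed_wulff.measurableSet.inter
      (isOpen_lt continuous_const (by fun_prop)).measurableSet
  rw [← (hmp.symm e).measure_preimage_equiv]
  refine setLIntegral_le_of_supporting hij hε (ν := genNormal (wulff φ))
    (fun q hq => (isOuterNormalAt_genNormal hq.1).1) (fun q hq => hq.2.2.2) (fun q hq => hq.2.2.1)
    (fun q hq q' hq' => (isOuterNormalAt_genNormal hq.1).inner_sub_nonpos hφ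
      ((isOuterNormalAt_genNormal hq'.1).mem_of_isClosed hφ.isClosed_wulff))
    (e.symm.measurable hA) ?_ ?_
  · intro q hq t ht htq
    have h1 := he (e.symm (q i, t))
    rw [e.apply_symm_apply, Prod.mk.injEq] at h1
    refine ⟨(hφ.mono_of_abs_le hpm fun k => ?_).trans
      ((isOuterNormalAt_genNormal hq.1).mem_of_isClosed hφ.isClosed_wulff), ?_⟩
    · obtain rfl | rfl : k = i ∨ k = j := by omega
      · rw [← h1.1]
      · rw [← h1.2]
        have h2 : ∀ s : ℝ, |s| = |ε * s| := fun s => by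
          rcases hε with rfl | rfl <;> simp
        rw [h2, h2 (q k), abs_of_pos ht]
        exact htq.le.trans (le_abs_self _)
    · change 0 < ε * _
      rwa [← h1.2]
  · intro q hq
    refine (ENNReal.ofReal_le_ofReal hq.2.1).trans_eq ?_
    rw [ENNReal.ofReal_mul zero_le_two, ENNReal.ofReal_ofNat]

theorem setLIntegral_boundaryPart_union_le (hφ : IsAnisotropy φ) (hpm : PartiallyMonotone φ)
    (j : Fin 2) :
    ∫⁻ q in boundaryPart φ j 1 ∪ boundaryPart φ j (-1),
      ENNReal.ofReal (dualA φ (genNormal (wulff φ) q)) ∂μH[1] ≤ 4 * volume (wulff φ) := by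
  have hm : ∀ ε : ℝ, MeasurableSet {q : E2 | 0 < ε * q j} := fun ε =>
    (isOpen_lt continuous_const (by fun_prop)).measurableSet
  calc _ ≤ _ := lintegral_union_le _ _ _
    _ ≤ 4 * volume (wulff φ ∩ {q | 0 < 1 * q j}) + 4 * volume (wulff φ ∩ {q | 0 < -1 * q j}) :=
      add_le_add (setLIntegral_boundaryPart_le hφ hpm j (.inl rfl))
        (setLIntegral_boundaryPart_le hφ hpm j (.inr rfl))
    _ = 4 * volume (wulff φ ∩ {q | 0 < 1 * q j} ∪ wulff φ ∩ {q | 0 < -1 * q j}) := by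
      rw [← mul_add, measure_union (Set.disjoint_left.2 fun q h1 h2 => ?_)
        (hφ.isClosed_wulff.measurableSet.inter (hm _))]
      have h3 : 0 < 1 * q j := h1.2
      have h4 : 0 < -1 * q j := h2.2
      linarith
    _ ≤ 4 * volume (wulff φ) := by
      gcongr
      exact union_subset inter_subset_left inter_subset_left

theorem aniPer_wulff_le (hφ : IsAnisotropy φ) (hpm : PartiallyMonotone φ) :
    aniPer φ (wulff φ) univ ≤ 8 * volume (wulff φ) := by
  set R₀ : Set E2 := {q | dualA φ (genNormal (wulff φ) q) ≤ 0}
  have hcover : univ ∩ redBoundary (wulff φ) ⊆ R₀ ∪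
      ((boundaryPart φ 0 1 ∪ boundaryPart φ 0 (-1)) ∪
        (boundaryPart φ 1 1 ∪ boundaryPart φ 1 (-1))) := by
    rintro q ⟨-, hq⟩
    rcases le_or_gt (dualA φ (genNormal (wulff φ) q)) 0 with h0 | h0
    · exact Or.inl h0
    right
    have h1 := (isOuterNormalAt_genNormal hq).dualA_le hφ
    rw [inner_eq_sum_two] at h1
    have key : ∀ j : Fin 2, dualA φ (genNormal (wulff φ) q) ≤ 2 * (q j * genNormal (wulff φ) q j) →
        q ∈ boundaryPart φ j 1 ∪ boundaryPart φ j (-1) := by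
      intro j hj
      have hpos : 0 < q j * genNormal (wulff φ) q j := by linarith
      rcases pos_and_pos_or_neg_and_neg_of_mul_pos hpos with h | h
      · exact Or.inl ⟨hq, hj, by linarith [h.1], by linarith [h.2]⟩
      · exact Or.inr ⟨hq, hj, by linarith [h.1], by linarith [h.2]⟩
    rcases le_total (q 0 * genNormal (wulff φ) q 0) (q 1 * genNormal (wulff φ) q 1) with h | h
    · exact Or.inr (key 1 (by linarith))
    · exact Or.inl (key 0 (by linarith))
  have hR₀ : ∫⁻ q in R₀, ENNReal.ofReal (dualA φ (genNormal (wulff φ) q)) ∂μH[1] = 0 :=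
    le_zero_iff.1 ((setLIntegral_mono measurable_const fun q hq =>
      (ENNReal.ofReal_of_nonpos hq).le).trans_eq lintegral_zero)
  calc aniPer φ (wulff φ) univ ≤ _ := lintegral_mono_set hcover
    _ ≤ _ := lintegral_union_le _ _ _
    _ ≤ _ := add_le_add hR₀.le (lintegral_union_le _ _ _)
    _ ≤ 0 + (4 * volume (wulff φ) + 4 * volume (wulff φ)) := by
      gcongr <;> exact setLIntegral_boundaryPart_union_le hφ hpm _
    _ = 8 * volume (wulff φ) := by rw [zero_add, ← add_mul]; norm_num

theorem alpha0_le_one (hφ : IsAnisotropy φ) (hpm : PartiallyMonotone φ) : alpha0 φ ≤ 1 := by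
  have h := aniPer_wulff_le hφ hpm
  rw [alpha0]
  by_cases hw : volume (wulff φ) = ⊤
  · simp [hw]
  have h8 := ENNReal.toReal_mono (ENNReal.mul_ne_top (by norm_num) hw) h
  rw [ENNReal.toReal_mul, ENNReal.toReal_ofNat] at h8
  set P := (aniPer φ (wulff φ) univ).toReal
  set w := (volume (wulff φ)).toReal
  have hP : 0 ≤ P := ENNReal.toReal_nonneg
  have hw0 : 0 ≤ w := ENNReal.toReal_nonneg
  refine div_le_one_of_le₀ (abs_le_of_sq_le_sq' ?_ (by positivity)).2 (by positivity)
  rw [mul_pow, Real.sq_sqrt hw0]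
  nlinarith [mul_le_mul_of_nonneg_left h8 (sq_nonneg (2 * P + 1)),
    mul_nonneg hP (sq_nonneg (2 * P - 1))]

end

theorem alpha0_nonneg (φ : E2 → ℝ) : 0 ≤ alpha0 φ := by
  unfold alpha0; positivity

theorem exists_bound_of_supNorm_lt {φ : E2 → ℝ} (hφ : IsAnisotropy φ) (hpm : PartiallyMonotone φ) {a b p σ c : ℝ} (hp : 1 ≤ p)
    (hc : 0 ≤ c)
    (hσ : σ = ((1 / ((4:ℝ) ^ (p - 1) * p)) *
        min (alpha0 φ * φ e1 / 4) (min (alpha0 φ / (2 * φ e2)) c)) ^ (1 / p)) {g : ℝ → ℝ}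
    (hgσ : supNorm g (Ioo a b) < ENNReal.ofReal σ) :
    ∃ M > 0, p * (2 * M) ^ p < (φ e2)⁻¹ ∧ ∀ᵐ s ∂volume.restrict (Ioo a b), |g s| ≤ M := by
  have h2 := hφ.e2_pos
  have hp0 : 0 < p := by linarith
  have hσ0 : 0 < σ := ENNReal.ofReal_pos.1 (lt_of_le_of_lt zero_le hgσ)
  set m := (supNorm g (Ioo a b)).toReal with hm
  have hmσ : m < σ := (ENNReal.lt_ofReal_iff_toReal_lt hgσ.ne_top).1 hgσ
  have hm0 : 0 ≤ m := ENNReal.toReal_nonneg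
  refine ⟨(m + σ) / 2, by linarith, ?_, ?_⟩
  · set μ := min (alpha0 φ * φ e1 / 4) (min (alpha0 φ / (2 * φ e2)) c) with hμ
    set k : ℝ := (4:ℝ) ^ (p - 1) with hk
    have hk0 : 0 < k := by positivity
    have hμ0 : 0 ≤ μ := by
      have := alpha0_nonneg φ
      have := hφ.e1_pos
      exact le_min (by positivity) (le_min (by positivity) hc)
    have hX : 0 ≤ 1 / (k * p) * μ := by positivity
    have hσp : σ ^ p = 1 / (k * p) * μ := by
      rw [hσ, ← Real.rpow_mul hX, one_div_mul_cancel hp0.ne', Real.rpow_one]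
    have hμle : μ ≤ 1 / (2 * φ e2) :=
      (min_le_right _ _).trans ((min_le_left _ _).trans
        (div_le_div_of_nonneg_right (alpha0_le_one hφ hpm) (by positivity)))
    have h2k : (2:ℝ) ^ p ≤ 2 * k := by
      rw [hk, show (4:ℝ) = 2 ^ (2:ℝ) by norm_num, ← Real.rpow_mul (by norm_num)]
      nth_rw 2 [← Real.rpow_one 2]
      rw [← Real.rpow_add (by norm_num)]
      exact Real.rpow_le_rpow_of_exponent_le (by norm_num) (by linarith)
    calc p * (2 * ((m + σ) / 2)) ^ p < p * (2 * σ) ^ p := by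
          gcongr
          linarith
      _ = p * 2 ^ p * σ ^ p := by rw [Real.mul_rpow (by norm_num) hσ0.le, mul_assoc]
      _ ≤ p * (2 * k) * (1 / (k * p) * (1 / (2 * φ e2))) := by
          rw [hσp]
          gcongr
      _ = (φ e2)⁻¹ := by field_simp
  · filter_upwards [ae_le_essSup (μ := volume.restrict (Ioo a b)) (f := fun s => (‖g s‖₊ : ℝ≥0∞))]
      with s hs
    have := ENNReal.toReal_mono hgσ.ne_top hs
    simp only [ENNReal.coe_toReal, coe_nnnorm, Real.norm_eq_abs] at this
    exact this.trans (by linarith)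

/-- Theorem: regularity of minimizers, explicit threshold. -/
theorem stmt1
    (φ : E2 → ℝ) (hφ : IsAnisotropy φ) (hpm : PartiallyMonotone φ) (hnv : NoVerticalFacets φ)
    (a b : ℝ) (hab : a < b) (p : ℝ) (hp : 1 ≤ p) (σ : ℝ)
    (hσ : σ = ((1 / ((4:ℝ) ^ (p - 1) * p)) *
        min (alpha0 φ * φ e1 / 4)
          (min (alpha0 φ / (2 * φ e2)) ((b - a) * φ e1 / (4 * φ e2)))) ^ (1 / p))
    (g : ℝ → ℝ) (hg : AEStronglyMeasurable g (volume.restrict (Set.Ioo a b)))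
    (hgσ : supNorm g (Set.Ioo a b) < ENNReal.ofReal σ)
    (u : ℝ → ℝ) (hu : IsMinimizerG φ p g (Set.Ioo a b) u) :
    HasLipschitzRep u (Set.Ioo a b) ∧
      (IsC2Aniso φ → IsElliptic φ → HasC11Rep u (Set.Ioo a b)) := by
  have hf := hφ.isProfile hpm hnv
  obtain ⟨M, hM, hsmall, hgM⟩ := exists_bound_of_supNorm_lt hφ hpm hp
    (div_nonneg (mul_nonneg (sub_pos.2 hab).le hφ.e1_pos.le) (by linarith [hφ.e2_pos])) hσ hgσ
  rw [← hφ.profile_zero hpm] at hsmall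
  obtain ⟨z₀, hz₀, B, H⟩ := hu.exists_almostCalibration hf hφ hpm hab hp hM hsmall hg hgM
  obtain ⟨L, v, hv, huv⟩ := exists_lipschitzWith_of_almostCalibration hf hz₀.2 hu.1 H
  refine ⟨⟨v, huv, L, hv.lipschitzOnWith⟩, fun hC _ => ?_⟩
  obtain ⟨K, hK⟩ := exists_lipschitzWith_deriv_of_almostCalibration hf
    (hφ.contDiffOn_profile hpm hf hC) hz₀.2 hu.1 H
  exact hasC11Rep_of_lipschitzWith hab hv huv hK

end
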